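/- Let X be a GC_4 set and let ℓ be a 4-node line of X. Then |X_ℓ| = 6 or |X_ℓ| = 3. Moreover: |X_ℓ| = 6 if and only if there exists a maximal line M₀ of X such that no node of X lies on both M₀ and ℓ, and in this case X_ℓ = X \ (ℓ ∪ M₀) is a GC_2 set; and |X_ℓ| = 3 if and only if there exist two maximal lines M′, M″ of X whose intersection point is a node of X lying on ℓ, and in this case X_ℓ = X \ (ℓ ∪ M′ ∪ M″) is a GC_1 set. -/

import Mathlib

open MvPolynomial

/-- Points of the plane `ℝ²`. -/
abbrev Pt : Type := Fin 2 → ℝ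

/-- Bivariate real polynomials. -/
abbrev BPoly : Type := MvPolynomial (Fin 2) ℝ

/-- `X` is an `n`-poised node set: it has `N = (n+1)(n+2)/2` nodes and every
interpolation problem with polynomials of total degree at most `n` has a unique solution. -/
def IsPoised (n : ℕ) (X : Set Pt) : Prop :=
  X.ncard = (n + 1) * (n + 2) / 2 ∧
  ∀ c : Pt → ℝ, ∃! p : BPoly, p.totalDegree ≤ n ∧ ∀ A ∈ X, eval A p = c A

/-- `p` is an `n`-fundamental polynomial of the node `A` for the node set `X`. -/
def IsFund (n : ℕ) (X : Set Pt) (A : Pt) (p : BPoly) : Prop :=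
  p.totalDegree ≤ n ∧ eval A p = 1 ∧ ∀ B ∈ X, B ≠ A → eval B p = 0

/-- `X` is a `GC_n` set: it is `n`-poised and each node has a fundamental polynomial
that is a product of `n` polynomials of degree `1`. -/
def IsGC (n : ℕ) (X : Set Pt) : Prop :=
  IsPoised n X ∧
  ∀ A ∈ X, ∃ p : BPoly, IsFund n X A p ∧
    ∃ f : Fin n → BPoly, (∀ i, (f i).totalDegree = 1) ∧ p = ∏ i, f i

/-- A line is the zero set of a polynomial of degree exactly `1`. -/
def IsLine (L : Set Pt) : Prop :=
  ∃ f : BPoly, f.totalDegree = 1 ∧ L = {x : Pt | eval x f = 0}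

/-- A `k`-node line of `X`: a line passing through exactly `k` nodes of `X`. -/
def IsNodeLine (k : ℕ) (X : Set Pt) (L : Set Pt) : Prop :=
  IsLine L ∧ (X ∩ L).ncard = k

/-- A maximal line of an `n`-poised set `X`: an `(n+1)`-node line. -/
def IsMaxLine (n : ℕ) (X : Set Pt) (L : Set Pt) : Prop :=
  IsNodeLine (n + 1) X L

/-- The node `A` uses the line `L`: a degree-1 polynomial whose zero set is `L`
divides the `n`-fundamental polynomial of `A` with respect to `X`. -/
def Uses (n : ℕ) (X : Set Pt) (L : Set Pt) (A : Pt) : Prop :=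
  ∃ p f : BPoly, IsFund n X A p ∧ f.totalDegree = 1 ∧ L = {x : Pt | eval x f = 0} ∧ f ∣ p

/-- `X_ℓ`: the set of nodes of `X` that use the line `L`. -/
def UseSet (n : ℕ) (X : Set Pt) (L : Set Pt) : Set Pt :=
  {A ∈ X | Uses n X L A}

/-! ### Node sets and covers in a linear space -/

section LinearSpace

open scoped Classical
open Configuration

variable {P L : Type*} [Membership P L]

/-- The nodes of `X` on the line `l`. -/
noncomputable def nodesOn (X : Finset P) (l : L) : Finset P := X.filter (· ∈ l)

/-- The nodes of `X` outside the line `l`. -/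
noncomputable def nodesOff (X : Finset P) (l : L) : Finset P := X.filter (· ∉ l)

/-- `C` is a family of at most `n` lines avoiding `A` and covering all other points of `X`. -/
structure IsCover (n : ℕ) (X : Finset P) (A : P) (C : Finset L) : Prop where
  card_le : C.card ≤ n
  notMem : ∀ l ∈ C, A ∉ l
  exists_mem : ∀ B ∈ X, B ≠ A → ∃ l ∈ C, B ∈ l

variable (L) in
/-- Every point `A` of `X` has at most `n` lines avoiding `A` and covering the rest of `X`. -/
def HasCovers (n : ℕ) (X : Finset P) : Prop :=
  ∀ A ∈ X, ∃ C : Finset L, IsCover n X A C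

@[simp] lemma mem_nodesOn {X : Finset P} {l : L} {p : P} :
    p ∈ nodesOn X l ↔ p ∈ X ∧ p ∈ l := by simp [nodesOn]

@[simp] lemma mem_nodesOff {X : Finset P} {l : L} {p : P} :
    p ∈ nodesOff X l ↔ p ∈ X ∧ p ∉ l := by simp [nodesOff]

lemma card_nodesOn_add_card_nodesOff (X : Finset P) (l : L) :
    (nodesOn X l).card + (nodesOff X l).card = X.card :=
  Finset.card_filter_add_card_filter_not _

lemma IsCover.covers {n : ℕ} {X : Finset P} {A : P} {C : Finset L} (h : IsCover n X A C)
    {S : Finset P} (hS : S ⊆ X) (hA : A ∉ S) : ∀ p ∈ S, ∃ l ∈ C, p ∈ l :=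
  fun p hp => h.exists_mem p (hS hp) fun e => hA (e ▸ hp)

variable [HasLines P L]

lemma line_unique {p q : P} {l m : L} (h : p ≠ q) (hpl : p ∈ l) (hql : q ∈ l) (hpm : p ∈ m)
    (hqm : q ∈ m) : l = m :=
  (Nondegenerate.eq_or_eq hpl hql hpm hqm).resolve_left h

variable (L) in
lemma exists_line_through {p q : P} (h : p ≠ q) : ∃ l : L, p ∈ l ∧ q ∈ l :=
  ⟨HasLines.mkLine h, HasLines.mkLine_ax h⟩

/-- Points on a line `m` are covered at most once each by lines different from `m`. -/
lemma card_le_card_of_covered {S : Finset P} {m : L} {C : Finset L} (hS : ∀ p ∈ S, p ∈ m)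
    (hm : m ∉ C) (hC : ∀ p ∈ S, ∃ l ∈ C, p ∈ l) : S.card ≤ C.card := by
  rcases S.eq_empty_or_nonempty with rfl | ⟨p₀, hp₀⟩
  · simp
  have : Nonempty L := ⟨(hC p₀ hp₀).choose⟩
  choose! f hf using hC
  refine Finset.card_le_card_of_injOn f (fun p hp => (hf p hp).1) fun p hp q hq hpq => ?_
  by_contra hne
  have := line_unique hne (hf p hp).2 (hpq ▸ (hf q hq).2) (hS p hp) (hS q hq)
  exact hm (this ▸ (hf p hp).1)

lemma mem_of_covered {S : Finset P} {m : L} {C : Finset L} (hS : ∀ p ∈ S, p ∈ m)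
    (hC : ∀ p ∈ S, ∃ l ∈ C, p ∈ l) (h : C.card < S.card) : m ∈ C := by
  by_contra hm
  exact absurd (card_le_card_of_covered hS hm hC) (by omega)

lemma exists_mem_of_card_le {S : Finset P} {m : L} {C : Finset L} (hS : ∀ p ∈ S, p ∈ m)
    (hm : m ∉ C) (hC : ∀ p ∈ S, ∃ l ∈ C, p ∈ l) (h : C.card ≤ S.card) {l : L} (hl : l ∈ C) :
    ∃ p ∈ S, p ∈ l := by
  by_contra! hcon
  have : S.card ≤ (C.erase l).card :=
    card_le_card_of_covered hS (fun h => hm (Finset.mem_of_mem_erase h)) fun p hp => by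
      obtain ⟨k, hk, hpk⟩ := hC p hp
      exact ⟨k, Finset.mem_erase.2 ⟨fun e => hcon p hp (e ▸ hpk), hk⟩, hpk⟩
  have := Finset.card_erase_lt_of_mem hl
  omega

lemma eq_of_card_le {S : Finset P} {m : L} {C : Finset L} (hS : ∀ p ∈ S, p ∈ m)
    (hm : m ∉ C) (hC : ∀ p ∈ S, ∃ l ∈ C, p ∈ l) (h : C.card ≤ S.card) {p : P} (hp : p ∈ S)
    {l k : L} (hl : l ∈ C) (hk : k ∈ C) (hpl : p ∈ l) (hpk : p ∈ k) : l = k := by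
  by_contra hne
  have : (S.erase p).card ≤ ((C.erase l).erase k).card := by
    refine card_le_card_of_covered (m := m) (fun q hq => hS q (Finset.mem_of_mem_erase hq))
      (by simp [hm]) fun q hq => ?_
    obtain ⟨hqp, hq⟩ := Finset.mem_erase.1 hq
    obtain ⟨j, hj, hqj⟩ := hC q hq
    refine ⟨j, ?_, hqj⟩
    have hjm : j ≠ m := fun e => hm (e ▸ hj)
    have key : p ∉ j := fun h => hjm (line_unique hqp hqj h (hS q hq) (hS p hp))
    simp only [Finset.mem_erase]
    exact ⟨fun e => key (e ▸ hpk), fun e => key (e ▸ hpl), hj⟩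
  have h1 := Finset.card_erase_of_mem hp
  have h2 := Finset.card_erase_of_mem hl
  have h3 := Finset.card_erase_of_mem (Finset.mem_erase.2 ⟨Ne.symm hne, hk⟩)
  have h4 := Finset.card_pos.2 ⟨p, hp⟩
  have h5 : 1 < C.card := Finset.one_lt_card.2 ⟨l, hl, k, hk, hne⟩
  omega

section Cover

variable {n : ℕ} {X : Finset P} {A : P} {C : Finset L}

lemma IsCover.maximal_mem (h : IsCover n X A C) {m : L} (hm : n < (nodesOn X m).card)
    (hA : A ∉ m) : m ∈ C :=
  mem_of_covered (S := nodesOn X m) (by simp) (h.covers (Finset.filter_subset _ _) (by simp [hA]))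
    (h.card_le.trans_lt hm)

lemma IsCover.erase (h : IsCover (n + 1) X A C) {m : L} (hm : m ∈ C) :
    IsCover n (nodesOff X m) A (C.erase m) where
  card_le := by
    have := Finset.card_erase_of_mem hm
    have := h.card_le
    omega
  notMem l hl := h.notMem l (Finset.mem_of_mem_erase hl)
  exists_mem B hB hBA := by
    rw [mem_nodesOff] at hB
    obtain ⟨l, hl, hBl⟩ := h.exists_mem B hB.1 hBA
    exact ⟨l, Finset.mem_erase.2 ⟨fun e => hB.2 (e ▸ hBl), hl⟩, hBl⟩

lemma HasCovers.card_nodesOn_le (h : HasCovers L n X) (m : L) : (nodesOn X m).card ≤ n + 1 := by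
  rcases (nodesOn X m).eq_empty_or_nonempty with h0 | ⟨A, hA⟩
  · simp [h0]
  · obtain ⟨C, hC⟩ := h A (by simp_all)
    have h1 : ((nodesOn X m).erase A).card ≤ C.card :=
      card_le_card_of_covered (m := m) (by simp)
        (fun hm => hC.notMem m hm (by simp_all))
        (hC.covers ((Finset.erase_subset _ _).trans (Finset.filter_subset _ _)) (by simp))
    have := Finset.card_erase_of_mem hA
    have := hC.card_le
    omega

lemma HasCovers.remove (h : HasCovers L (n + 1) X) {m : L} (hm : (nodesOn X m).card = n + 2) :
    HasCovers L n (nodesOff X m) := by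
  intro A hA
  rw [mem_nodesOff] at hA
  obtain ⟨C, hC⟩ := h A hA.1
  exact ⟨_, hC.erase (hC.maximal_mem (by omega) hA.2)⟩

end Cover

lemma nodesOn_nodesOff_of_disjoint {X : Finset P} {l m : L} (h : ∀ p ∈ X, p ∈ m → p ∉ l) :
    nodesOn (nodesOff X m) l = nodesOn X l := by
  ext p; simp only [mem_nodesOn, mem_nodesOff]; specialize h p; tauto

lemma card_nodesOn_nodesOff_of_mem {X : Finset P} {l m : L} (hlm : l ≠ m) {p : P} (hp : p ∈ X)
    (hl : p ∈ l) (hm : p ∈ m) : (nodesOn (nodesOff X m) l).card + 1 = (nodesOn X l).card := by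
  have : nodesOn (nodesOff X m) l = (nodesOn X l).erase p := by
    ext q
    simp only [mem_nodesOn, mem_nodesOff, Finset.mem_erase]
    constructor
    · rintro ⟨⟨h1, h2⟩, h3⟩
      exact ⟨fun e => h2 (e ▸ hm), h1, h3⟩
    · rintro ⟨h1, h2, h3⟩
      exact ⟨⟨h2, fun h => hlm (line_unique h1 h3 hl h hm)⟩, h3⟩
  rw [this, Finset.card_erase_add_one (by simp [hp, hl])]

/-- Two maximal lines meet at a node. -/
lemma HasCovers.exists_mem_inter {n : ℕ} {X : Finset P} (h : HasCovers L (n + 1) X) {l m : L}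
    (hl : (nodesOn X l).card = n + 2) (hm : (nodesOn X m).card = n + 2) :
    ∃ p ∈ X, p ∈ l ∧ p ∈ m := by
  by_contra! hcon
  have h1 := nodesOn_nodesOff_of_disjoint (X := X) (l := l) (m := m)
    fun p hp hpm hpl => hcon p hp hpl hpm
  have h2 := (h.remove hm).card_nodesOn_le l
  rw [h1] at h2
  omega

/-- Three maximal lines are not concurrent at a node. -/
lemma HasCovers.not_concurrent {n : ℕ} {X : Finset P} (h : HasCovers L (n + 2) X) {l m k : L}
    (hlm : l ≠ m) (hlk : l ≠ k) (hmk : m ≠ k) (hl : (nodesOn X l).card = n + 3)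
    (hm : (nodesOn X m).card = n + 3) (hk : (nodesOn X k).card = n + 3) {p : P} (hp : p ∈ X)
    (hpl : p ∈ l) (hpm : p ∈ m) : p ∉ k := by
  intro hpk
  have h1 := card_nodesOn_nodesOff_of_mem hlk hp hpl hpk
  have h2 := card_nodesOn_nodesOff_of_mem hmk hp hpm hpk
  have h3 : nodesOn (nodesOff (nodesOff X k) m) l = nodesOn (nodesOff X k) l :=
    nodesOn_nodesOff_of_disjoint fun q hq hqm hql =>
      hlm (line_unique (p := q) (q := p) (fun e => (mem_nodesOff.1 hq).2 (e ▸ hpk)) hql hpl hqm hpm)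
  have h4 := ((h.remove hk).remove (m := m) (by omega)).card_nodesOn_le l
  rw [h3] at h4
  omega

lemma card_le_of_two_covers {W : Finset P} {a b : Finset L} {k : ℕ}
    (ha : ∀ p ∈ W, ∃ l ∈ a, p ∈ l) (hb : ∀ p ∈ W, ∃ l ∈ b, p ∈ l)
    (hk : ∀ l ∈ a ∩ b, (nodesOn W l).card ≤ k) :
    W.card ≤ (a ∩ b).card * k + (a \ b).card * (b \ a).card := by
  set R := W.filter fun p => ∀ l ∈ a ∩ b, p ∉ l with hR
  have h1 : W ⊆ (a ∩ b).biUnion (nodesOn W) ∪ R := by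
    intro p hp
    by_cases h : ∀ l ∈ a ∩ b, p ∉ l
    · exact Finset.mem_union_right _ (Finset.mem_filter.2 ⟨hp, h⟩)
    · push Not at h
      obtain ⟨l, hl, hpl⟩ := h
      exact Finset.mem_union_left _ (Finset.mem_biUnion.2 ⟨l, hl, by simp [hp, hpl]⟩)
  have h2 : R ⊆ ((a \ b) ×ˢ (b \ a)).biUnion fun c => W.filter fun p => p ∈ c.1 ∧ p ∈ c.2 := by
    intro p hp
    obtain ⟨hp, hn⟩ := Finset.mem_filter.1 hp
    obtain ⟨l, hl, hpl⟩ := ha p hp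
    obtain ⟨m, hm, hpm⟩ := hb p hp
    simp only [Finset.mem_biUnion, Finset.mem_product, Finset.mem_sdiff, Finset.mem_filter]
    exact ⟨(l, m), ⟨⟨hl, fun h => hn l (Finset.mem_inter.2 ⟨hl, h⟩) hpl⟩,
      hm, fun h => hn m (Finset.mem_inter.2 ⟨h, hm⟩) hpm⟩, hp, hpl, hpm⟩
  have h6 : (((a \ b) ×ˢ (b \ a)).biUnion fun c => W.filter fun p => p ∈ c.1 ∧ p ∈ c.2).card ≤
      ((a \ b) ×ˢ (b \ a)).card * 1 :=
    Finset.card_biUnion_le_card_mul _ _ _ fun c hc => by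
      rw [Finset.card_le_one]
      intro p hp q hq
      by_contra hne
      simp only [Finset.mem_filter, Finset.mem_product, Finset.mem_sdiff] at hp hq hc
      have e := line_unique hne hp.2.1 hq.2.1 hp.2.2 hq.2.2
      exact hc.1.2 (e ▸ hc.2.1)
  have h3 := Finset.card_le_card h1
  have h4 := Finset.card_union_le ((a ∩ b).biUnion (nodesOn W)) R
  have h5 := Finset.card_biUnion_le_card_mul _ _ _ hk
  have h7 := Finset.card_le_card h2
  rw [Finset.card_product] at h6
  omega

section Shared

variable {n : ℕ} {X : Finset P} {A B : P} {C D : Finset L}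

lemma IsCover.inter_card_lt (hC : IsCover n X A C) (hD : IsCover n X B D) (hB : B ∈ X)
    (hAB : A ≠ B) : (C ∩ D).card < n := by
  by_contra! hn
  have h1 := hC.card_le
  have h2 : C ∩ D = C := Finset.eq_of_subset_of_card_le Finset.inter_subset_left (by omega)
  obtain ⟨l, hl, hBl⟩ := hC.exists_mem B hB hAB.symm
  exact hD.notMem l (Finset.inter_eq_left.1 h2 hl) hBl

/-- The covers of two nodes sharing a line `l` both cover `X \ l \ {A, B}`. -/
lemma IsCover.shared (hC : IsCover n X A C) (hD : IsCover n X B D) (l : L) :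
    (∀ p ∈ ((nodesOff X l).erase A).erase B, ∃ k ∈ C.erase l, p ∈ k) ∧
      ∀ p ∈ ((nodesOff X l).erase A).erase B, ∃ k ∈ D.erase l, p ∈ k := by
  refine ⟨fun p hp => ?_, fun p hp => ?_⟩ <;>
    simp only [Finset.mem_erase, mem_nodesOff] at hp
  · obtain ⟨k, hk, hpk⟩ := hC.exists_mem p hp.2.2.1 hp.2.1
    exact ⟨k, Finset.mem_erase.2 ⟨fun e => hp.2.2.2 (e ▸ hpk), hk⟩, hpk⟩
  · obtain ⟨k, hk, hpk⟩ := hD.exists_mem p hp.2.2.1 hp.1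
    exact ⟨k, Finset.mem_erase.2 ⟨fun e => hp.2.2.2 (e ▸ hpk), hk⟩, hpk⟩

lemma IsCover.card_shared (hC : IsCover n X A C) (hD : IsCover n X B D) {l : L}
    (hl : l ∈ C ∩ D) (hA : A ∈ X) (hB : B ∈ X) (hAB : A ≠ B) :
    (((nodesOff X l).erase A).erase B).card + 2 + (nodesOn X l).card = X.card := by
  have hAl := hC.notMem l (Finset.mem_inter.1 hl).1
  have hBl := hD.notMem l (Finset.mem_inter.1 hl).2
  have h1 := Finset.card_erase_add_one (s := nodesOff X l) (a := A) (by simp [hA, hAl])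
  have h2 := Finset.card_erase_add_one (s := (nodesOff X l).erase A) (a := B)
    (by simp [hB, hBl, hAB.symm])
  have := card_nodesOn_add_card_nodesOff X l
  omega

lemma IsCover.card_le_of_shared (hC : IsCover n X A C) (hD : IsCover n X B D) {l : L}
    (hl : l ∈ C ∩ D) (hA : A ∈ X) (hB : B ∈ X) (hAB : A ≠ B) {k : ℕ}
    (hk : ∀ m : L, (nodesOn X m).card ≤ k) :
    X.card ≤ (nodesOn X l).card + 2 + ((C ∩ D).card - 1) * k +
      (n - (C ∩ D).card) * (n - (C ∩ D).card) := by
  have h1 := card_le_of_two_covers (hC.shared hD l).1 (hC.shared hD l).2 (k := k) fun m _ =>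
    (Finset.card_le_card fun p => by simp; tauto).trans (hk m)
  have h2 := hC.card_shared hD hl hA hB hAB
  have h3 : C.erase l ∩ D.erase l = (C ∩ D).erase l := by ext; simp; tauto
  have h4 : C.erase l \ D.erase l ⊆ C \ D := by intro x; simp; tauto
  have h5 : D.erase l \ C.erase l ⊆ D \ C := by intro x; simp; tauto
  have h6 := Finset.card_sdiff_add_card_inter C D
  have h7 := Finset.card_sdiff_add_card_inter D C
  rw [Finset.inter_comm D C] at h7
  have h8 := Finset.card_le_card h4
  have h9 := Finset.card_le_card h5
  have h10 := hC.card_le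
  have h11 := hD.card_le
  rw [h3, Finset.card_erase_of_mem hl] at h1
  have h12 := Nat.mul_le_mul
    (show (C.erase l \ D.erase l).card ≤ n - (C ∩ D).card by omega)
    (show (D.erase l \ C.erase l).card ≤ n - (C ∩ D).card by omega)
  omega

end Shared

/-- A cover with as many lines as there are nodes on a line `m` outside the cover meets `m`
bijectively. -/
lemma IsCover.tight {n : ℕ} {X : Finset P} {A : P} {C : Finset L} (h : IsCover n X A C)
    {S : Finset P} {m : L} (hSX : S ⊆ X) (hA : A ∉ S) (hS : ∀ p ∈ S, p ∈ m) (hm : m ∉ C)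
    (hcard : n ≤ S.card) :
    (∀ l ∈ C, ∃ p ∈ S, p ∈ l) ∧ ∀ p ∈ S, ∀ l ∈ C, ∀ k ∈ C, p ∈ l → p ∈ k → l = k :=
  ⟨fun _ hl => exists_mem_of_card_le hS hm (h.covers hSX hA) (h.card_le.trans hcard) hl,
    fun _ hp _ hl _ hk => eq_of_card_le hS hm (h.covers hSX hA) (h.card_le.trans hcard) hp hl hk⟩

/-- The cover of a node on a maximal line `m` meets the other nodes of `m` bijectively. -/
lemma IsCover.tight_maximal {n : ℕ} {X : Finset P} {A : P} {C : Finset L} (h : IsCover n X A C)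
    {m : L} (hA : A ∈ X) (hAm : A ∈ m) (hm : (nodesOn X m).card = n + 1) :
    (∀ l ∈ C, ∃ p ∈ X, p ≠ A ∧ p ∈ m ∧ p ∈ l) ∧
      ∀ p ∈ X, p ≠ A → p ∈ m → ∀ l ∈ C, ∀ k ∈ C, p ∈ l → p ∈ k → l = k := by
  have hcard : n ≤ ((nodesOn X m).erase A).card := by
    rw [Finset.card_erase_of_mem (by simp [hA, hAm])]; omega
  obtain ⟨h1, h2⟩ := h.tight (S := (nodesOn X m).erase A) (m := m)
    ((Finset.erase_subset _ _).trans (Finset.filter_subset _ _)) (by simp) (by simp)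
    (fun hmC => h.notMem m hmC hAm) hcard
  refine ⟨fun l hl => ?_, fun p hp hpA hpm => h2 p (by simp [hp, hpA, hpm])⟩
  obtain ⟨p, hp, hpl⟩ := h1 l hl
  simp only [Finset.mem_erase, mem_nodesOn] at hp
  exact ⟨p, hp.2.1, hp.1, hp.2.2, hpl⟩

/-- A node on a maximal line `m` does not use a line `l` that meets `m` in no node; if `l` has
`n` nodes, then the cover meets `l` bijectively. -/
lemma IsCover.tight_disjoint {n : ℕ} {X : Finset P} {A : P} {C : Finset L} (h : IsCover n X A C)
    {l m : L} (hA : A ∈ X) (hAm : A ∈ m) (hm : (nodesOn X m).card = n + 1)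
    (hdisj : ∀ p ∈ X, p ∈ m → p ∉ l) (hl : (nodesOn X l).card = n) :
    l ∉ C ∧ (∀ k ∈ C, ∃ p ∈ X, p ∈ l ∧ p ∈ k) ∧
      ∀ p ∈ X, p ∈ l → ∀ j ∈ C, ∀ k ∈ C, p ∈ j → p ∈ k → j = k := by
  have hlC : l ∉ C := fun hlC => by
    obtain ⟨p, hp, -, hpm, hpl⟩ := (h.tight_maximal hA hAm hm).1 l hlC
    exact hdisj p hp hpm hpl
  obtain ⟨h1, h2⟩ := h.tight (S := nodesOn X l) (m := l) (Finset.filter_subset _ _)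
    (by simp [hdisj A hA hAm]) (by simp) hlC hl.ge
  refine ⟨hlC, fun k hk => ?_, fun p hp hpl => h2 p (by simp [hp, hpl])⟩
  obtain ⟨p, hp, hpk⟩ := h1 k hk
  simp only [mem_nodesOn] at hp
  exact ⟨p, hp.1, hp.2, hpk⟩

lemma disjoint_or_card_eq {X : Finset P} {l m : L} {k : ℕ}
    (h : (nodesOn (nodesOff X m) l).card = k + 1) :
    l ≠ m ∧ ((∀ p ∈ X, p ∈ m → p ∉ l) ∧ (nodesOn X l).card = k + 1 ∨
      (nodesOn X l).card = k + 2) := by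
  have hlm : l ≠ m := by
    rintro rfl
    have : nodesOn (nodesOff X l) l = ∅ := by ext; simp
    rw [this] at h
    simp at h
  refine ⟨hlm, ?_⟩
  by_cases hd : ∀ p ∈ X, p ∈ m → p ∉ l
  · exact .inl ⟨hd, by rw [← nodesOn_nodesOff_of_disjoint hd, h]⟩
  · push Not at hd
    obtain ⟨p, hp, hpm, hpl⟩ := hd
    right
    rw [← card_nodesOn_nodesOff_of_mem hlm hp hpl hpm, h]

lemma card_nodesOff_of_card_nodesOn {X : Finset P} {l : L} {a b : ℕ}
    (hX : X.card = a + b) (hl : (nodesOn X l).card = a) : (nodesOff X l).card = b := by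
  have := card_nodesOn_add_card_nodesOff X l
  omega

variable (L) in
/-- There are three lines, each containing exactly `k` nodes of `X`. -/
def HasThreeLines (k : ℕ) (X : Finset P) : Prop :=
  ∃ l₁ l₂ l₃ : L, l₁ ≠ l₂ ∧ l₁ ≠ l₃ ∧ l₂ ≠ l₃ ∧
    (nodesOn X l₁).card = k ∧ (nodesOn X l₂).card = k ∧ (nodesOn X l₃).card = k

lemma HasCovers.hasThreeLines_two {X : Finset P} (h : HasCovers L 2 X) (hX : X.card = 6) :
    HasThreeLines L 3 X := by
  have key : ∀ A ∈ X, ∃ l : L, A ∉ l ∧ (nodesOn X l).card = 3 := by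
    intro A hA
    obtain ⟨C, hC⟩ := h A hA
    by_contra! hcon
    have h1 : X.erase A ⊆ C.biUnion (nodesOn X) := by
      intro B hB
      obtain ⟨hBA, hB⟩ := Finset.mem_erase.1 hB
      obtain ⟨l, hl, hBl⟩ := hC.exists_mem B hB hBA
      exact Finset.mem_biUnion.2 ⟨l, hl, by simp [hB, hBl]⟩
    have h2 := Finset.card_le_card h1
    have h3 : (C.biUnion (nodesOn X)).card ≤ C.card * 2 :=
      Finset.card_biUnion_le_card_mul _ _ _ fun l hl => by
        have := hcon l (hC.notMem l hl)
        have := h.card_nodesOn_le l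
        omega
    have := hC.card_le
    rw [Finset.card_erase_of_mem hA] at h2
    omega
  obtain ⟨A, hA⟩ : X.Nonempty := Finset.card_pos.1 (by omega)
  obtain ⟨l, -, hl⟩ := key A hA
  obtain ⟨B, hB⟩ : (nodesOn X l).Nonempty := Finset.card_pos.1 (by omega)
  rw [mem_nodesOn] at hB
  obtain ⟨m, hBm, hm⟩ := key B hB.1
  obtain ⟨V, hV, hVl, hVm⟩ := HasCovers.exists_mem_inter (n := 1) h hl hm
  obtain ⟨k, hVk, hk⟩ := key V hV
  exact ⟨l, m, k, by grind, by grind, by grind, hl, hm, hk⟩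

lemma HasCovers.exists_line_three {X : Finset P} (h : HasCovers L 3 X) (hX : X.card = 10) :
    ∃ l : L, (nodesOn X l).card = 4 := by
  by_contra! hcon
  have h3 : ∀ l : L, (nodesOn X l).card ≤ 3 := fun l => by
    have := h.card_nodesOn_le l
    have := hcon l
    omega
  have hcov : ∀ (A : P) (C : Finset L), A ∈ X → IsCover 3 X A C →
      C.card = 3 ∧ ∀ l ∈ C, (nodesOn X l).card = 3 := by
    intro A C hA hC
    have h1 : X.erase A ⊆ C.biUnion (nodesOn X) := by
      intro B hB
      obtain ⟨hBA, hB⟩ := Finset.mem_erase.1 hB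
      obtain ⟨l, hl, hBl⟩ := hC.exists_mem B hB hBA
      exact Finset.mem_biUnion.2 ⟨l, hl, by simp [hB, hBl]⟩
    have h2 := (Finset.card_le_card h1).trans Finset.card_biUnion_le
    rw [Finset.card_erase_of_mem hA] at h2
    have h4 : ∑ l ∈ C, (nodesOn X l).card ≤ C.card * 3 := Finset.sum_le_card_nsmul _ _ _ fun l _ => h3 l
    have := hC.card_le
    refine ⟨by omega, fun l hl => ?_⟩
    by_contra hne
    have : ∑ l ∈ C, (nodesOn X l).card < ∑ l ∈ C, 3 :=
      Finset.sum_lt_sum (fun l _ => h3 l) ⟨l, hl, by have := h3 l; omega⟩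
    simp at this
    omega
  have huniq : ∀ (A B : P) (C D : Finset L) (l : L), A ∈ X → B ∈ X → IsCover 3 X A C →
      IsCover 3 X B D → l ∈ C → l ∈ D → A = B := by
    intro A B C D l hA hB hC hD hlC hlD
    by_contra hne
    have h1 := hC.inter_card_lt hD hB hne
    have h2 := hC.card_le_of_shared hD (Finset.mem_inter.2 ⟨hlC, hlD⟩) hA hB hne h3
    have h4 := Finset.card_pos.2 ⟨l, Finset.mem_inter.2 ⟨hlC, hlD⟩⟩
    have h5 := h3 l
    rw [hX] at h2
    interval_cases (C ∩ D).card <;> omega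
  obtain ⟨A, hA⟩ : X.Nonempty := Finset.card_pos.1 (by omega)
  choose! C hC using h
  have hl : ∀ B ∈ X.erase A, ∃ l ∈ C B, A ∈ l := fun B hB =>
    (hC B (by simp_all)).exists_mem A hA (by grind)
  have : Nonempty L := ⟨(Nondegenerate.exists_line (L := L) A).choose⟩
  choose! f hf using hl
  have hd : ((X.erase A).biUnion fun B => (nodesOn X (f B)).erase A).card = ∑ B ∈ X.erase A, 2 := by
    rw [Finset.card_biUnion]
    · refine Finset.sum_congr rfl fun B hB => ?_
      have hB' := (Finset.mem_erase.1 hB).2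
      rw [Finset.card_erase_of_mem (by simp [hA, (hf B hB).2]),
        (hcov B _ hB' (hC B hB')).2 _ (hf B hB).1]
    · intro B hB D hD hBD
      rw [Function.onFun, Finset.disjoint_left]
      intro Q hQ hQ'
      simp only [Finset.mem_erase, mem_nodesOn] at hQ hQ'
      refine hBD (huniq B D _ _ (f B) (Finset.mem_of_mem_erase hB) (Finset.mem_of_mem_erase hD)
        (hC _ (Finset.mem_of_mem_erase hB)) (hC _ (Finset.mem_of_mem_erase hD)) (hf B hB).1 ?_)
      rw [line_unique hQ.1 hQ.2.2 (hf B hB).2 hQ'.2.2 (hf D hD).2]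
      exact (hf D hD).1
  have hsub : ((X.erase A).biUnion fun B => (nodesOn X (f B)).erase A) ⊆ X.erase A :=
    Finset.biUnion_subset.2 fun B _ => Finset.erase_subset_erase _ (Finset.filter_subset _ _)
  have := Finset.card_le_card hsub
  rw [hd] at this
  simp [Finset.card_erase_of_mem hA, hX] at this

/-- In a set of type `GC₂`, two `2`-node lines that meet no node of a maximal line do not meet each
other at a node. -/
lemma HasCovers.false_of_two_disjoint_two {X : Finset P} (h : HasCovers L 2 X) {m l₁ l₂ : L}
    {V : P} (h12 : l₁ ≠ l₂) (hm : (nodesOn X m).card = 3)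
    (hl₁ : (nodesOn X l₁).card = 2) (hl₂ : (nodesOn X l₂).card = 2)
    (hd₁ : ∀ p ∈ X, p ∈ m → p ∉ l₁) (hd₂ : ∀ p ∈ X, p ∈ m → p ∉ l₂)
    (hV : V ∈ X) (hV₁ : V ∈ l₁) (hV₂ : V ∈ l₂) : False := by
  have third : ∀ l : L, (nodesOn X l).card = 2 → V ∈ l →
      ∃ a ∈ X, a ∈ l ∧ a ≠ V ∧ ∀ p ∈ X, p ∈ l → p = V ∨ p = a := by
    intro l hl hVl
    obtain ⟨a, ha⟩ : ∃ a, (nodesOn X l).erase V = {a} := by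
      rw [← Finset.card_eq_one, Finset.card_erase_of_mem (by simp [hV, hVl]), hl]
    have h1 : ∀ p, p ∈ (nodesOn X l).erase V ↔ p = a := by simp [ha]
    simp only [Finset.mem_erase, mem_nodesOn] at h1
    have := (h1 a).2 rfl
    exact ⟨a, this.2.1, this.2.2, this.1, fun p hp hpl => by
      by_cases e : p = V
      · exact .inl e
      · exact .inr ((h1 p).1 ⟨e, hp, hpl⟩)⟩
  obtain ⟨a, ha, hal, haV, ha'⟩ := third l₁ hl₁ hV₁
  obtain ⟨b, hb, hbl, hbV, hb'⟩ := third l₂ hl₂ hV₂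
  have key : ∀ A ∈ X, A ∈ m → ∀ C : Finset L, IsCover 2 X A C → ∃ k ∈ C, a ∈ k ∧ b ∈ k := by
    intro A hA hAm C hC
    obtain ⟨h1, h2, h3⟩ := hC.tight_disjoint hA hAm hm hd₁ hl₁
    obtain ⟨h4, h5, h6⟩ := hC.tight_disjoint hA hAm hm hd₂ hl₂
    obtain ⟨k, hk, hak⟩ := hC.exists_mem a ha (fun e => hd₁ A hA hAm (e ▸ hal))
    obtain ⟨p, hp, hpl, hpk⟩ := h5 k hk
    rcases hb' p hp hpl with rfl | rfl
    · exact absurd (line_unique haV hak hpk hal hV₁ ▸ hk) h1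
    · exact ⟨k, hk, hak, hpk⟩
  obtain ⟨A, hA⟩ : (nodesOn X m).Nonempty := Finset.card_pos.1 (by omega)
  rw [mem_nodesOn] at hA
  obtain ⟨C, hC⟩ := h A hA.1
  obtain ⟨k, hk, hak, hbk⟩ := key A hA.1 hA.2 C hC
  obtain ⟨B, hB, -, hBm, hBk⟩ := (hC.tight_maximal hA.1 hA.2 hm).1 k hk
  obtain ⟨D, hD⟩ := h B hB
  obtain ⟨j, hj, haj, hbj⟩ := key B hB hBm D hD
  have hab : a ≠ b := fun e => h12 (line_unique haV hal hV₁ (e ▸ hbl) hV₂)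
  exact hD.notMem j hj (line_unique hab hak hbk haj hbj ▸ hBk)

/-- In a set of type `GC₃`, three `3`-node lines that are the sides of a triangle of nodes cannot
all avoid the nodes of a maximal line. -/
lemma HasCovers.false_of_three_disjoint_three {X : Finset P} (h : HasCovers L 3 X)
    {m l₁ l₂ l₃ : L} {V₁₂ V₁₃ V₂₃ : P} (h12 : l₁ ≠ l₂)
    (hm : (nodesOn X m).card = 4) (hl₁ : (nodesOn X l₁).card = 3) (hl₂ : (nodesOn X l₂).card = 3)
    (hl₃ : (nodesOn X l₃).card = 3)
    (hd₁ : ∀ p ∈ X, p ∈ m → p ∉ l₁) (hd₂ : ∀ p ∈ X, p ∈ m → p ∉ l₂) (hd₃ : ∀ p ∈ X, p ∈ m → p ∉ l₃)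
    (hV : V₁₂ ∈ X) (hV₁ : V₁₂ ∈ l₁) (hV₂ : V₁₂ ∈ l₂) (hV₃ : V₁₂ ∉ l₃)
    (hU : V₁₃ ∈ X) (hU₁ : V₁₃ ∈ l₁) (hU₃ : V₁₃ ∈ l₃)
    (hW : V₂₃ ∈ X) (hW₂ : V₂₃ ∈ l₂) (hW₃ : V₂₃ ∈ l₃) : False := by
  have hUW : V₁₃ ≠ V₂₃ := by
    rintro rfl
    exact h12 (line_unique (fun h : V₁₂ = V₁₃ => hV₃ (h ▸ hU₃)) hV₁ hU₁ hV₂ hW₂)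
  obtain ⟨e, he⟩ : ∃ e, ((nodesOn X l₃).erase V₁₃).erase V₂₃ = {e} := by
    rw [← Finset.card_eq_one, Finset.card_erase_of_mem, Finset.card_erase_of_mem, hl₃] <;>
      simp [hU, hU₃, hW, hW₃, hUW.symm]
  have h1 : ∀ p, p ∈ ((nodesOn X l₃).erase V₁₃).erase V₂₃ ↔ p = e := by simp [he]
  simp only [Finset.mem_erase, mem_nodesOn] at h1
  have he' := (h1 e).2 rfl
  have key : ∀ A ∈ X, A ∈ m → ∀ C : Finset L, IsCover 3 X A C → ∃ k ∈ C, V₁₂ ∈ k ∧ e ∈ k := by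
    intro A hA hAm C hC
    obtain ⟨h1', -, -⟩ := hC.tight_disjoint hA hAm hm hd₁ hl₁
    obtain ⟨h2', -, -⟩ := hC.tight_disjoint hA hAm hm hd₂ hl₂
    obtain ⟨-, h5, -⟩ := hC.tight_disjoint hA hAm hm hd₃ hl₃
    obtain ⟨k, hk, hak⟩ := hC.exists_mem V₁₂ hV (fun h => hd₁ A hA hAm (h ▸ hV₁))
    obtain ⟨p, hp, hpl, hpk⟩ := h5 k hk
    have hpV : V₁₂ ≠ p := fun h => hV₃ (h ▸ hpl)
    refine ⟨k, hk, hak, ?_⟩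
    rw [← (h1 p).1 ⟨?_, ?_, hp, hpl⟩]
    · exact hpk
    · rintro rfl
      exact h2' (line_unique hpV hak hpk hV₂ hW₂ ▸ hk)
    · rintro rfl
      exact h1' (line_unique hpV hak hpk hV₁ hU₁ ▸ hk)
  obtain ⟨A, hA⟩ : (nodesOn X m).Nonempty := Finset.card_pos.1 (by omega)
  rw [mem_nodesOn] at hA
  obtain ⟨C, hC⟩ := h A hA.1
  obtain ⟨k, hk, hak, hbk⟩ := key A hA.1 hA.2 C hC
  obtain ⟨B, hB, -, hBm, hBk⟩ := (hC.tight_maximal hA.1 hA.2 hm).1 k hk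
  obtain ⟨D, hD⟩ := h B hB
  obtain ⟨j, hj, haj, hbj⟩ := key B hB hBm D hD
  exact hD.notMem j hj (line_unique (fun h : V₁₂ = e => hV₃ (h ▸ he'.2.2.2)) hak hbk haj hbj ▸ hBk)

/-- If `m, k` are maximal and `l₁, l₂` are maximal in `nodesOff X m` but miss the nodes of `m`, then
in `nodesOff X k` the lines `l₁, l₂` lose one node each and still meet in a node. -/
lemma HasCovers.reduce_two_disjoint {n : ℕ} {X : Finset P} (h : HasCovers L (n + 3) X)
    {m k l₁ l₂ : L} (hmk : k ≠ m) (h12 : l₁ ≠ l₂) (h1k : l₁ ≠ k) (h2k : l₂ ≠ k)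
    (hm : (nodesOn X m).card = n + 4) (hk : (nodesOn X k).card = n + 4)
    (hl₁ : (nodesOn X l₁).card = n + 3) (hl₂ : (nodesOn X l₂).card = n + 3)
    (hd₁ : ∀ p ∈ X, p ∈ m → p ∉ l₁) (hd₂ : ∀ p ∈ X, p ∈ m → p ∉ l₂) :
    (nodesOn (nodesOff X k) m).card = n + 3 ∧ (nodesOn (nodesOff X k) l₁).card = n + 2 ∧
      (nodesOn (nodesOff X k) l₂).card = n + 2 ∧ ∃ V ∈ nodesOff X k, V ∈ l₁ ∧ V ∈ l₂ := by
  have h' := h.remove hm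
  obtain ⟨Q, hQ, hQm, hQk⟩ := h.exists_mem_inter hm hk
  have hk' := card_nodesOn_nodesOff_of_mem hmk hQ hQk hQm
  have hm' := card_nodesOn_nodesOff_of_mem hmk.symm hQ hQm hQk
  have e₁ := congrArg Finset.card (nodesOn_nodesOff_of_disjoint hd₁)
  have e₂ := congrArg Finset.card (nodesOn_nodesOff_of_disjoint hd₂)
  obtain ⟨V, hV, hV₁, hV₂⟩ := h'.exists_mem_inter (l := l₁) (m := l₂) (by omega) (by omega)
  obtain ⟨a, ha, ha₁, hak⟩ := h'.exists_mem_inter (l := l₁) (m := k) (by omega) (by omega)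
  obtain ⟨b, hb, hb₂, hbk⟩ := h'.exists_mem_inter (l := l₂) (m := k) (by omega) (by omega)
  have hVk := h'.not_concurrent h12 h1k h2k (by omega) (by omega) (by omega) hV hV₁ hV₂
  rw [mem_nodesOff] at hV ha hb
  have := card_nodesOn_nodesOff_of_mem h1k ha.1 ha₁ hak
  have := card_nodesOn_nodesOff_of_mem h2k hb.1 hb₂ hbk
  exact ⟨by omega, by omega, by omega, V, by simp [hV.1, hVk], hV₁, hV₂⟩

/-- Reduction of the existence of three maximal lines to two forbidden configurations. -/
lemma HasCovers.hasThreeLines_succ {n : ℕ} {X : Finset P} (h : HasCovers L (n + 3) X) {m : L}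
    (hm : (nodesOn X m).card = n + 4) (h3 : HasThreeLines L (n + 3) (nodesOff X m))
    (H₂ : ∀ (k l₁ l₂ : L) (V : P), (nodesOn X k).card = n + 4 → l₁ ≠ l₂ →
      (nodesOn (nodesOff X k) m).card = n + 3 → (nodesOn (nodesOff X k) l₁).card = n + 2 →
      (nodesOn (nodesOff X k) l₂).card = n + 2 → (∀ p ∈ nodesOff X k, p ∈ m → p ∉ l₁) →
      (∀ p ∈ nodesOff X k, p ∈ m → p ∉ l₂) → V ∈ nodesOff X k → V ∈ l₁ → V ∈ l₂ → False)
    (H₃ : ∀ (l₁ l₂ l₃ : L) (V₁₂ V₁₃ V₂₃ : P), l₁ ≠ l₂ → l₁ ≠ l₃ → l₂ ≠ l₃ →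
      (nodesOn X l₁).card = n + 3 → (nodesOn X l₂).card = n + 3 → (nodesOn X l₃).card = n + 3 →
      (∀ p ∈ X, p ∈ m → p ∉ l₁) → (∀ p ∈ X, p ∈ m → p ∉ l₂) → (∀ p ∈ X, p ∈ m → p ∉ l₃) →
      V₁₂ ∈ X → V₁₂ ∈ l₁ → V₁₂ ∈ l₂ → V₁₂ ∉ l₃ → V₁₃ ∈ X → V₁₃ ∈ l₁ → V₁₃ ∈ l₃ →
      V₂₃ ∈ X → V₂₃ ∈ l₂ → V₂₃ ∈ l₃ → False) :
    HasThreeLines L (n + 4) X := by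
  have h' := h.remove hm
  obtain ⟨l₁, l₂, l₃, h12, h13, h23, hl₁, hl₂, hl₃⟩ := h3
  obtain ⟨n₁, c₁⟩ := disjoint_or_card_eq hl₁
  obtain ⟨n₂, c₂⟩ := disjoint_or_card_eq hl₂
  obtain ⟨n₃, c₃⟩ := disjoint_or_card_eq hl₃
  have two : ∀ {k l₁ l₂ : L}, k ≠ m → l₁ ≠ l₂ → l₁ ≠ k → l₂ ≠ k → (nodesOn X k).card = n + 4 →
      (∀ p ∈ X, p ∈ m → p ∉ l₁) ∧ (nodesOn X l₁).card = n + 3 →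
      (∀ p ∈ X, p ∈ m → p ∉ l₂) ∧ (nodesOn X l₂).card = n + 3 → False := by
    intro k l₁ l₂ hkm h12 h1k h2k hk h1 h2
    obtain ⟨a1, a2, a3, V, hV, hV₁, hV₂⟩ :=
      h.reduce_two_disjoint hkm h12 h1k h2k hm hk h1.2 h2.2 h1.1 h2.1
    refine H₂ k l₁ l₂ V hk h12 a1 a2 a3 ?_ ?_ hV hV₁ hV₂
    · exact fun p hp => h1.1 p (mem_nodesOff.1 hp).1
    · exact fun p hp => h2.1 p (mem_nodesOff.1 hp).1
  rcases c₁ with d₁ | c₁ <;> rcases c₂ with d₂ | c₂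
  · rcases c₃ with d₃ | c₃
    · obtain ⟨V, hV, hV₁, hV₂⟩ := h'.exists_mem_inter hl₁ hl₂
      obtain ⟨U, hU, hU₁, hU₃⟩ := h'.exists_mem_inter hl₁ hl₃
      obtain ⟨W, hW, hW₂, hW₃⟩ := h'.exists_mem_inter hl₂ hl₃
      have := h'.not_concurrent h12 h13 h23 hl₁ hl₂ hl₃ hV hV₁ hV₂
      rw [mem_nodesOff] at hV hU hW
      exact (H₃ l₁ l₂ l₃ V U W h12 h13 h23 d₁.2 d₂.2 d₃.2 d₁.1 d₂.1 d₃.1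
        hV.1 hV₁ hV₂ this hU.1 hU₁ hU₃ hW.1 hW₂ hW₃).elim
    · exact (two n₃ h12 h13 h23 c₃ d₁ d₂).elim
  · rcases c₃ with d₃ | c₃
    · exact (two n₂ h13 h12 h23.symm c₂ d₁ d₃).elim
    · exact ⟨l₂, l₃, m, h23, n₂, n₃, c₂, c₃, hm⟩
  · rcases c₃ with d₃ | c₃
    · exact (two n₁ h23 h12.symm h13.symm c₁ d₂ d₃).elim
    · exact ⟨l₁, l₃, m, h13, n₁, n₃, c₁, c₃, hm⟩
  · exact ⟨l₁, l₂, m, h12, n₁, n₂, c₁, c₂, hm⟩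

lemma HasCovers.hasThreeLines_three {X : Finset P} (h : HasCovers L 3 X) (hX : X.card = 10) :
    HasThreeLines L 4 X := by
  obtain ⟨m, hm⟩ := h.exists_line_three hX
  refine HasCovers.hasThreeLines_succ (n := 0) h hm
    ((h.remove hm).hasThreeLines_two (card_nodesOff_of_card_nodesOn (by omega) hm)) ?_ ?_
  · intro k l₁ l₂ V hk
    exact (h.remove hk).false_of_two_disjoint_two
  · intro l₁ l₂ l₃ V₁₂ V₁₃ V₂₃ h12 h13 h23
    exact h.false_of_three_disjoint_three h12 hm

lemma eq_of_card_le_three {α : Type*} {S : Finset α} (hS : S.card ≤ 3) {x y z w : α} (hx : x ∈ S)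
    (hy : y ∈ S) (hz : z ∈ S) (hw : w ∈ S) (hxy : x ≠ y) (hzx : z ≠ x) (hzy : z ≠ y) (hwx : w ≠ x)
    (hwy : w ≠ y) : z = w := by
  by_contra hzw
  have h1 : ({x, y, z, w} : Finset α) ⊆ S := by
    simp [Finset.insert_subset_iff, *]
  have h2 := Finset.card_le_card h1
  have h3 : ({x, y, z, w} : Finset α).card = 4 := by
    rw [Finset.card_insert_of_notMem, Finset.card_insert_of_notMem, Finset.card_pair hzw] <;>
      simp [hxy, hzx.symm, hzy.symm, hwx.symm, hwy.symm]
  omega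

/-- The two nodes of a `3`-node line other than a given one. -/
lemma exists_two_of_card_nodesOn {X : Finset P} {l : L} {V : P} (hV : V ∈ X) (hVl : V ∈ l)
    (hl : (nodesOn X l).card = 3) :
    ∃ a a', a ≠ a' ∧ a ∈ X ∧ a' ∈ X ∧ a ∈ l ∧ a' ∈ l ∧ a ≠ V ∧ a' ≠ V ∧
      ∀ p ∈ X, p ∈ l → p = V ∨ p = a ∨ p = a' := by
  obtain ⟨a, a', haa, ha⟩ : ∃ a a', a ≠ a' ∧ (nodesOn X l).erase V = {a, a'} := by
    rw [← Finset.card_eq_two, Finset.card_erase_of_mem (by simp [hV, hVl]), hl]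
  have h1 : ∀ p, p ∈ (nodesOn X l).erase V ↔ p = a ∨ p = a' := by simp [ha]
  simp only [Finset.mem_erase, mem_nodesOn] at h1
  have h2 := (h1 a).2 (.inl rfl)
  have h3 := (h1 a').2 (.inr rfl)
  refine ⟨a, a', haa, h2.2.1, h3.2.1, h2.2.2, h3.2.2, h2.1, h3.1, fun p hp hpl => ?_⟩
  by_cases e : p = V
  · exact .inl e
  · exact .inr ((h1 p).1 ⟨e, hp, hpl⟩)

/-- Some cover of `A` contains the lines `ab` and `a'b'`. -/
def PairedBy (L : Type*) [Membership P L] (X : Finset P) (A a b a' b' : P) : Prop :=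
  ∃ C : Finset L, IsCover 3 X A C ∧ ∃ j ∈ C, ∃ k ∈ C, a ∈ j ∧ b ∈ j ∧ a' ∈ k ∧ b' ∈ k

lemma PairedBy.step {X : Finset P} {m l₁ l₂ : L} {V A a a' b b' O : P} (h12 : l₁ ≠ l₂)
    (hm : (nodesOn X m).card = 4) (hl₁ : (nodesOn X l₁).card = 3) (hd₁ : ∀ p ∈ X, p ∈ m → p ∉ l₁)
    (hV : V ∈ X) (hV₁ : V ∈ l₁) (hV₂ : V ∈ l₂) (ha : a ∈ l₁) (ha' : a' ∈ l₁) (haV : a ≠ V)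
    (haV' : a' ≠ V) (haa : a ≠ a') (hb : b ∈ l₂) (hb' : b' ∈ l₂)
    (hO : O ∈ X) (hOm : O ∉ m) (hOV : O ≠ V)
    (key : ∀ A ∈ X, A ∈ m → PairedBy L X A a b a' b' ∨ PairedBy L X A a b' a' b)
    (hA : A ∈ X) (hAm : A ∈ m) (hT : PairedBy L X A a b a' b') :
    (∃ j : L, O ∈ j ∧ (a ∈ j ∧ b' ∈ j ∨ a' ∈ j ∧ b ∈ j)) ∧
      ∃ B ∈ X, B ∈ m ∧ PairedBy L X B a b' a' b := by
  obtain ⟨C, hC, j, hj, k, hk, haj, hbj, hak, hbk⟩ := hT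
  have line₁ : ∀ D : Finset L, ∀ B ∈ X, B ∈ m → IsCover 3 X B D → l₁ ∉ D :=
    fun D B hB hBm hD => (hD.tight_disjoint hB hBm hm hd₁ hl₁).1
  have inter : ∀ p, p ∈ l₁ → p ∈ l₂ → p = V := fun p h₁ h₂ => by
    by_contra hp
    exact h12 (line_unique hp h₁ hV₁ h₂ hV₂)
  have hab : a ≠ b := fun h => haV (inter a ha (h ▸ hb))
  have hab' : a ≠ b' := fun h => haV (inter a ha (h ▸ hb'))
  have hba : a' ≠ b := fun h => haV' (inter a' ha' (h ▸ hb))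
  have hba' : a' ≠ b' := fun h => haV' (inter a' ha' (h ▸ hb'))
  have hjk : j ≠ k := by
    rintro rfl
    exact line₁ C A hA hAm hC (line_unique haa haj hak ha ha' ▸ hj)
  obtain ⟨t1, t2⟩ := hC.tight_maximal hA hAm hm
  obtain ⟨B, hB, hBA, hBm, hBj⟩ := t1 j hj
  obtain ⟨B', hB', hBA', hBm', hBk⟩ := t1 k hk
  have hBB : B ≠ B' := fun h => hjk (t2 B hB hBA hBm j hj k hk hBj (h ▸ hBk))
  have hTB : PairedBy L X B a b' a' b := by
    refine (key B hB hBm).resolve_left ?_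
    rintro ⟨D, hD, x, hx, -, -, hax, hbx, -, -⟩
    exact hD.notMem x hx (line_unique hab haj hbj hax hbx ▸ hBj)
  have hTB' : PairedBy L X B' a b' a' b := by
    refine (key B' hB' hBm').resolve_left ?_
    rintro ⟨D, hD, -, -, x, hx, -, -, hax, hbx⟩
    exact hD.notMem x hx (line_unique hba' hak hbk hax hbx ▸ hBk)
  refine ⟨?_, B, hB, hBm, hTB⟩
  obtain ⟨D, hD, x, hx, y, hy, hax, hbx, hay, hby⟩ := hTB
  obtain ⟨D', hD', x', hx', y', hy', hax', hbx', hay', hby'⟩ := hTB'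
  obtain rfl := line_unique hab' hax hbx hax' hbx'
  obtain rfl := line_unique hba hay hby hay' hby'
  have hxy : x ≠ y := by
    rintro rfl
    exact line₁ D B hB hBm hD (line_unique haa hax hay ha ha' ▸ hx)
  by_contra! hcon
  have hOx : O ∉ x := fun h => (hcon x h).1 hax hbx
  have hOy : O ∉ y := fun h => (hcon y h).2 hay hby
  have hVx : V ∉ x := fun h => line₁ D B hB hBm hD (line_unique haV hax h ha hV₁ ▸ hx)
  have hVy : V ∉ y := fun h => line₁ D B hB hBm hD (line_unique haV' hay h ha' hV₁ ▸ hy)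
  have third : ∀ D : Finset L, ∀ B ∈ X, B ∈ m → IsCover 3 X B D → x ∈ D → y ∈ D →
      ∃ z ∈ D, O ∈ z ∧ V ∈ z ∧ ∀ w ∈ D, w = x ∨ w = y ∨ w = z := by
    intro D B hB hBm hD hx hy
    obtain ⟨z, hz, hOz⟩ := hD.exists_mem O hO fun h => hOm (h ▸ hBm)
    obtain ⟨w, hw, hVw⟩ := hD.exists_mem V hV fun h => hd₁ B hB hBm (h ▸ hV₁)
    have u : ∀ w ∈ D, w ≠ x → w ≠ y → w = z := fun w hw hwx hwy =>
      eq_of_card_le_three hD.card_le hx hy hw hz hxy hwx hwy (fun h => hOx (h ▸ hOz))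
        fun h => hOy (h ▸ hOz)
    obtain rfl := u w hw (fun h => hVx (h ▸ hVw)) (fun h => hVy (h ▸ hVw))
    exact ⟨w, hw, hOz, hVw, fun v hv => by have := u v hv; tauto⟩
  obtain ⟨z, hz, hOz, hVz, hall⟩ := third D B hB hBm hD hx hy
  obtain ⟨z', hz', hOz', hVz', -⟩ := third D' B' hB' hBm' hD' hx' hy'
  obtain rfl := line_unique hOV hOz hVz hOz' hVz'
  obtain ⟨w, hw, hBw⟩ := hD.exists_mem B' hB' hBB.symm
  rcases hall w hw with rfl | rfl | rfl
  · exact hD'.notMem _ hx' hBw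
  · exact hD'.notMem _ hy' hBw
  · exact hD'.notMem _ hz' hBw

/-- In a set of type `GC₃`, two `3`-node lines that meet no node of a maximal line do not meet each
other at a node. -/
lemma HasCovers.false_of_two_disjoint_three {X : Finset P} (h : HasCovers L 3 X)
    (hX : X.card = 10) {m l₁ l₂ : L} {V : P} (h12 : l₁ ≠ l₂) (hm : (nodesOn X m).card = 4)
    (hl₁ : (nodesOn X l₁).card = 3) (hl₂ : (nodesOn X l₂).card = 3)
    (hd₁ : ∀ p ∈ X, p ∈ m → p ∉ l₁) (hd₂ : ∀ p ∈ X, p ∈ m → p ∉ l₂)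
    (hV : V ∈ X) (hV₁ : V ∈ l₁) (hV₂ : V ∈ l₂) : False := by
  obtain ⟨a, a', haa, haX, haX', ha, ha', haV, haV', hal⟩ := exists_two_of_card_nodesOn hV hV₁ hl₁
  obtain ⟨b, b', hbb, hbX, hbX', hb, hb', hbV, hbV', hbl⟩ := exists_two_of_card_nodesOn hV hV₂ hl₂
  obtain ⟨O, hO⟩ : (nodesOff (nodesOff (nodesOff X m) l₁) l₂).Nonempty := by
    have e1 := card_nodesOn_add_card_nodesOff X m
    have e2 := card_nodesOn_add_card_nodesOff (nodesOff X m) l₁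
    have e3 := card_nodesOn_add_card_nodesOff (nodesOff (nodesOff X m) l₁) l₂
    have e4 := congrArg Finset.card (nodesOn_nodesOff_of_disjoint hd₁)
    have e5 := congrArg Finset.card (nodesOn_nodesOff_of_disjoint hd₂)
    have hVm : V ∉ m := fun h => hd₁ V hV h hV₁
    have e6 := card_nodesOn_nodesOff_of_mem (X := nodesOff X m) h12.symm (by simp [hV, hVm]) hV₂ hV₁
    exact Finset.card_pos.1 (by omega)
  simp only [mem_nodesOff] at hO
  obtain ⟨⟨⟨hO, hOm⟩, hO₁⟩, hO₂⟩ := hO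
  have hOV : O ≠ V := fun h => hO₁ (h ▸ hV₁)
  have key : ∀ A ∈ X, A ∈ m → PairedBy L X A a b a' b' ∨ PairedBy L X A a b' a' b := by
    intro A hA hAm
    obtain ⟨C, hC⟩ := h A hA
    obtain ⟨h1, h2, h3⟩ := hC.tight_disjoint hA hAm hm hd₁ hl₁
    obtain ⟨h4, h5, h6⟩ := hC.tight_disjoint hA hAm hm hd₂ hl₂
    obtain ⟨j, hj, haj⟩ := hC.exists_mem a haX fun e => hd₁ A hA hAm (e ▸ ha)
    obtain ⟨k, hk, hak⟩ := hC.exists_mem a' haX' fun e => hd₁ A hA hAm (e ▸ ha')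
    have hjk : j ≠ k := by
      rintro rfl
      exact h1 (line_unique haa haj hak ha ha' ▸ hj)
    obtain ⟨p, hp, hpl, hpj⟩ := h5 j hj
    obtain ⟨q, hq, hql, hqk⟩ := h5 k hk
    rcases hbl p hp hpl with rfl | rfl | rfl
    · exact absurd (line_unique haV haj hpj ha hV₁ ▸ hj) h1
    · rcases hbl q hq hql with rfl | rfl | rfl
      · exact absurd (line_unique haV' hak hqk ha' hV₁ ▸ hk) h1
      · exact absurd (h6 _ hp hpl j hj k hk hpj hqk) hjk
      · exact .inl ⟨C, hC, j, hj, k, hk, haj, hpj, hak, hqk⟩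
    · rcases hbl q hq hql with rfl | rfl | rfl
      · exact absurd (line_unique haV' hak hqk ha' hV₁ ▸ hk) h1
      · exact .inr ⟨C, hC, j, hj, k, hk, haj, hpj, hak, hqk⟩
      · exact absurd (h6 _ hp hpl j hj k hk hpj hqk) hjk
  have key' : ∀ A ∈ X, A ∈ m → PairedBy L X A a b' a' b ∨ PairedBy L X A a b a' b' :=
    fun A hA hAm => (key A hA hAm).symm
  have step := fun A => PairedBy.step (A := A) h12 hm hl₁ hd₁ hV hV₁ hV₂ ha ha' haV haV' haa hb hb'
    hO hOm hOV key
  have step' := fun A => PairedBy.step (A := A) h12 hm hl₁ hd₁ hV hV₁ hV₂ ha ha' haV haV' haa hb'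
    hb hO hOm hOV key'
  obtain ⟨A, hA⟩ : (nodesOn X m).Nonempty := Finset.card_pos.1 (by omega)
  rw [mem_nodesOn] at hA
  obtain ⟨⟨j, hOj, hj⟩, k, hOk, hk⟩ : (∃ j : L, O ∈ j ∧ (a ∈ j ∧ b' ∈ j ∨ a' ∈ j ∧ b ∈ j)) ∧
      ∃ j : L, O ∈ j ∧ (a ∈ j ∧ b ∈ j ∨ a' ∈ j ∧ b' ∈ j) := by
    rcases key A hA.1 hA.2 with hT | hT
    · obtain ⟨h1, B, hB, hBm, hT'⟩ := step A hA.1 hA.2 hT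
      exact ⟨h1, (step' B hB hBm hT').1⟩
    · obtain ⟨h1, B, hB, hBm, hT'⟩ := step' A hA.1 hA.2 hT
      exact ⟨(step B hB hBm hT').1, h1⟩
  have ne₁ : ∀ p, p ∈ l₁ → O ≠ p := fun p hp e => hO₁ (e ▸ hp)
  have ne₂ : ∀ p, p ∈ l₂ → O ≠ p := fun p hp e => hO₂ (e ▸ hp)
  rcases hj with ⟨h1, h2⟩ | ⟨h1, h2⟩ <;> rcases hk with ⟨h3, h4⟩ | ⟨h3, h4⟩
  · obtain rfl := line_unique (ne₁ a ha) hOj h1 hOk h3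
    exact hO₂ (line_unique hbb h4 h2 hb hb' ▸ hOj)
  · obtain rfl := line_unique (ne₂ b' hb') hOj h2 hOk h4
    exact hO₁ (line_unique haa h1 h3 ha ha' ▸ hOj)
  · obtain rfl := line_unique (ne₂ b hb) hOj h2 hOk h4
    exact hO₁ (line_unique haa h3 h1 ha ha' ▸ hOj)
  · obtain rfl := line_unique (ne₁ a' ha') hOj h1 hOk h3
    exact hO₂ (line_unique hbb h2 h4 hb hb' ▸ hOj)

/-- The two nodes of a `4`-node line other than two given ones. -/
lemma exists_two_of_card_nodesOn_four {X : Finset P} {l : L} {U V : P} (hU : U ∈ X) (hUl : U ∈ l)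
    (hV : V ∈ X) (hVl : V ∈ l) (hUV : U ≠ V) (hl : (nodesOn X l).card = 4) :
    ∃ e e', e ≠ e' ∧ e ∈ X ∧ e' ∈ X ∧ e ∈ l ∧ e' ∈ l ∧ e ≠ U ∧ e' ≠ U ∧ e ≠ V ∧ e' ≠ V ∧
      ∀ p ∈ X, p ∈ l → p = U ∨ p = V ∨ p = e ∨ p = e' := by
  obtain ⟨a, a', haa, ha⟩ : ∃ a a', a ≠ a' ∧ ((nodesOn X l).erase U).erase V = {a, a'} := by
    rw [← Finset.card_eq_two, Finset.card_erase_of_mem (by simp [hV, hVl, hUV.symm]),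
      Finset.card_erase_of_mem (by simp [hU, hUl]), hl]
  have h1 : ∀ p, p ∈ ((nodesOn X l).erase U).erase V ↔ p = a ∨ p = a' := by simp [ha]
  simp only [Finset.mem_erase, mem_nodesOn] at h1
  have h2 := (h1 a).2 (.inl rfl)
  have h3 := (h1 a').2 (.inr rfl)
  refine ⟨a, a', haa, h2.2.2.1, h3.2.2.1, h2.2.2.2, h3.2.2.2, h2.2.1, h3.2.1, h2.1, h3.1,
    fun p hp hpl => ?_⟩
  by_cases e : p = U
  · exact .inl e
  by_cases e' : p = V
  · exact .inr (.inl e')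
  · exact .inr (.inr ((h1 p).1 ⟨e', e, hp, hpl⟩))

/-- In a set of type `GC₄`, three `4`-node lines that are the sides of a triangle of nodes cannot
all avoid the nodes of a maximal line. -/
lemma HasCovers.false_of_three_disjoint_four {X : Finset P} (h : HasCovers L 4 X)
    {m l₁ l₂ l₃ : L} {V₁₂ V₁₃ V₂₃ : P} (h12 : l₁ ≠ l₂)
    (hm : (nodesOn X m).card = 5) (hl₁ : (nodesOn X l₁).card = 4) (hl₂ : (nodesOn X l₂).card = 4)
    (hl₃ : (nodesOn X l₃).card = 4)
    (hd₁ : ∀ p ∈ X, p ∈ m → p ∉ l₁) (hd₂ : ∀ p ∈ X, p ∈ m → p ∉ l₂) (hd₃ : ∀ p ∈ X, p ∈ m → p ∉ l₃)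
    (hV : V₁₂ ∈ X) (hV₁ : V₁₂ ∈ l₁) (hV₂ : V₁₂ ∈ l₂) (hV₃ : V₁₂ ∉ l₃)
    (hU : V₁₃ ∈ X) (hU₁ : V₁₃ ∈ l₁) (hU₃ : V₁₃ ∈ l₃)
    (hW : V₂₃ ∈ X) (hW₂ : V₂₃ ∈ l₂) (hW₃ : V₂₃ ∈ l₃) : False := by
  have hVU : V₁₂ ≠ V₁₃ := fun h => hV₃ (h ▸ hU₃)
  have hVW : V₁₂ ≠ V₂₃ := fun h => hV₃ (h ▸ hW₃)
  have hUW : V₁₃ ≠ V₂₃ := by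
    rintro rfl
    exact h12 (line_unique hVU hV₁ hU₁ hV₂ hW₂)
  have hU₂ : V₁₃ ∉ l₂ := fun h => h12 (line_unique hVU hV₁ hU₁ hV₂ h)
  have hW₁ : V₂₃ ∉ l₁ := fun h => h12 (line_unique hVW hV₁ h hV₂ hW₂)
  obtain ⟨a, a', haa, haX, haX', ha, ha', haV, haV', haU, haU', hal⟩ :=
    exists_two_of_card_nodesOn_four hV hV₁ hU hU₁ hVU hl₁
  obtain ⟨b, b', hbb, hbX, hbX', hb, hb', hbV, hbV', hbW, hbW', hbl⟩ :=
    exists_two_of_card_nodesOn_four hV hV₂ hW hW₂ hVW hl₂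
  obtain ⟨c, c', hcc, hcX, hcX', hc, hc', hcU, hcU', hcW, hcW', hcl⟩ :=
    exists_two_of_card_nodesOn_four hU hU₃ hW hW₃ hUW hl₃
  have key : ∀ A ∈ nodesOn X m, ∃ x₁ x₂ y₁ y₂ y₃ : P, ∃ x₃ : P, ∃ C : Finset L, IsCover 4 X A C ∧
      ∃ g ∈ C, ∃ k₁ ∈ C, ∃ k₂ ∈ C, ∃ k₃ ∈ C, (∀ k ∈ C, k = g ∨ k = k₁ ∨ k = k₂ ∨ k = k₃) ∧
        x₁ ∈ g ∧ x₂ ∈ g ∧ x₃ ∈ g ∧ V₂₃ ∈ k₁ ∧ y₁ ∈ k₁ ∧ V₁₃ ∈ k₂ ∧ y₂ ∈ k₂ ∧ V₁₂ ∈ k₃ ∧ y₃ ∈ k₃ ∧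
        (x₁ = a ∧ y₁ = a' ∨ x₁ = a' ∧ y₁ = a) ∧ (x₂ = b ∧ y₂ = b' ∨ x₂ = b' ∧ y₂ = b) ∧
        (x₃ = c ∧ y₃ = c' ∨ x₃ = c' ∧ y₃ = c) ∧ l₃ ∉ C := by
    intro A hA
    rw [mem_nodesOn] at hA
    obtain ⟨hA, hAm⟩ := hA
    obtain ⟨C, hC⟩ := h A hA
    obtain ⟨a1, a2, a3⟩ := hC.tight_disjoint hA hAm hm hd₁ hl₁
    obtain ⟨b1, b2, b3⟩ := hC.tight_disjoint hA hAm hm hd₂ hl₂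
    obtain ⟨c1, c2, c3⟩ := hC.tight_disjoint hA hAm hm hd₃ hl₃
    have hAne : ∀ p, (p ∈ l₁ ∨ p ∈ l₂ ∨ p ∈ l₃) → p ≠ A := by
      rintro p hp rfl
      exact hp.elim (hd₁ p hA hAm) fun hp => hp.elim (hd₂ p hA hAm) (hd₃ p hA hAm)
    obtain ⟨k₁, hk₁, hWk⟩ := hC.exists_mem V₂₃ hW (hAne _ (.inr (.inl hW₂)))
    obtain ⟨k₂, hk₂, hUk⟩ := hC.exists_mem V₁₃ hU (hAne _ (.inl hU₁))
    obtain ⟨k₃, hk₃, hVk⟩ := hC.exists_mem V₁₂ hV (hAne _ (.inl hV₁))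
    have n₁ : ∀ {p q : P} {k : L}, p ≠ q → p ∈ l₁ → q ∈ l₁ → k ∈ C → p ∈ k → q ∉ k :=
      fun hpq hp hq hk hpk hqk => a1 (line_unique hpq hp hq hpk hqk ▸ hk)
    have n₂ : ∀ {p q : P} {k : L}, p ≠ q → p ∈ l₂ → q ∈ l₂ → k ∈ C → p ∈ k → q ∉ k :=
      fun hpq hp hq hk hpk hqk => b1 (line_unique hpq hp hq hpk hqk ▸ hk)
    have n₃ : ∀ {p q : P} {k : L}, p ≠ q → p ∈ l₃ → q ∈ l₃ → k ∈ C → p ∈ k → q ∉ k :=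
      fun hpq hp hq hk hpk hqk => c1 (line_unique hpq hp hq hpk hqk ▸ hk)
    have hy₁ : ∃ x₁ y₁, y₁ ∈ k₁ ∧ x₁ ∈ X ∧ x₁ ∈ l₁ ∧ x₁ ≠ V₁₂ ∧ x₁ ≠ V₁₃ ∧ x₁ ∉ k₁ ∧
        (x₁ = a ∧ y₁ = a' ∨ x₁ = a' ∧ y₁ = a) := by
      obtain ⟨p, hp, hpl, hpk⟩ := a2 k₁ hk₁
      rcases hal p hp hpl with rfl | rfl | rfl | rfl
      · exact absurd hWk (n₂ hVW hV₂ hW₂ hk₁ hpk)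
      · exact absurd hWk (n₃ hUW hU₃ hW₃ hk₁ hpk)
      · exact ⟨a', p, hpk, haX', ha', haV', haU', n₁ haa ha ha' hk₁ hpk, .inr ⟨rfl, rfl⟩⟩
      · exact ⟨a, p, hpk, haX, ha, haV, haU, n₁ haa.symm ha' ha hk₁ hpk, .inl ⟨rfl, rfl⟩⟩
    have hy₂ : ∃ x₂ y₂, y₂ ∈ k₂ ∧ x₂ ∈ X ∧ x₂ ∈ l₂ ∧ x₂ ≠ V₁₂ ∧ x₂ ≠ V₂₃ ∧ x₂ ∉ k₂ ∧
        (x₂ = b ∧ y₂ = b' ∨ x₂ = b' ∧ y₂ = b) := by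
      obtain ⟨p, hp, hpl, hpk⟩ := b2 k₂ hk₂
      rcases hbl p hp hpl with rfl | rfl | rfl | rfl
      · exact absurd hUk (n₁ hVU hV₁ hU₁ hk₂ hpk)
      · exact absurd hpk (n₃ hUW hU₃ hW₃ hk₂ hUk)
      · exact ⟨b', p, hpk, hbX', hb', hbV', hbW', n₂ hbb hb hb' hk₂ hpk, .inr ⟨rfl, rfl⟩⟩
      · exact ⟨b, p, hpk, hbX, hb, hbV, hbW, n₂ hbb.symm hb' hb hk₂ hpk, .inl ⟨rfl, rfl⟩⟩
    have hy₃ : ∃ x₃ y₃, y₃ ∈ k₃ ∧ x₃ ∈ X ∧ x₃ ∈ l₃ ∧ x₃ ≠ V₁₃ ∧ x₃ ≠ V₂₃ ∧ x₃ ∉ k₃ ∧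
        (x₃ = c ∧ y₃ = c' ∨ x₃ = c' ∧ y₃ = c) := by
      obtain ⟨p, hp, hpl, hpk⟩ := c2 k₃ hk₃
      rcases hcl p hp hpl with rfl | rfl | rfl | rfl
      · exact absurd hpk (n₁ hVU hV₁ hU₁ hk₃ hVk)
      · exact absurd hpk (n₂ hVW hV₂ hW₂ hk₃ hVk)
      · exact ⟨c', p, hpk, hcX', hc', hcU', hcW', n₃ hcc hc hc' hk₃ hpk, .inr ⟨rfl, rfl⟩⟩
      · exact ⟨c, p, hpk, hcX, hc, hcU, hcW, n₃ hcc.symm hc' hc hk₃ hpk, .inl ⟨rfl, rfl⟩⟩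
    obtain ⟨x₁, y₁, hy₁, hx₁, hx₁l, hx₁V, hx₁U, hx₁k, e₁⟩ := hy₁
    obtain ⟨x₂, y₂, hy₂, hx₂, hx₂l, hx₂V, hx₂W, hx₂k, e₂⟩ := hy₂
    obtain ⟨x₃, y₃, hy₃, hx₃, hx₃l, hx₃U, hx₃W, hx₃k, e₃⟩ := hy₃
    obtain ⟨g, hg, hg₁⟩ := hC.exists_mem x₁ hx₁ (hAne _ (.inl hx₁l))
    obtain ⟨g₂, hg₂, hgx₂⟩ := hC.exists_mem x₂ hx₂ (hAne _ (.inr (.inl hx₂l)))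
    obtain ⟨g₃, hg₃, hgx₃⟩ := hC.exists_mem x₃ hx₃ (hAne _ (.inr (.inr hx₃l)))
    have m12 : k₁ ≠ k₂ := fun e => n₃ hUW hU₃ hW₃ hk₁ (e ▸ hUk) hWk
    have m13 : k₁ ≠ k₃ := fun e => n₂ hVW hV₂ hW₂ hk₁ (e ▸ hVk) hWk
    have m23 : k₂ ≠ k₃ := fun e => n₁ hVU hV₁ hU₁ hk₂ (e ▸ hVk) hUk
    have g1 : g ≠ k₁ := fun e => hx₁k (e ▸ hg₁)
    have g2 : g ≠ k₂ := fun e => n₁ hx₁U hx₁l hU₁ hg hg₁ (e ▸ hUk)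
    have g3 : g ≠ k₃ := fun e => n₁ hx₁V hx₁l hV₁ hg hg₁ (e ▸ hVk)
    have all : ∀ k ∈ C, k = g ∨ k = k₁ ∨ k = k₂ ∨ k = k₃ := by
      have hsub : ({g, k₁, k₂, k₃} : Finset L) ⊆ C := by simp [Finset.insert_subset_iff, *]
      have hcard : ({g, k₁, k₂, k₃} : Finset L).card = 4 := by
        rw [Finset.card_insert_of_notMem, Finset.card_insert_of_notMem, Finset.card_pair m23] <;>
          simp [m12, m13, g1, g2, g3]
      have := Finset.eq_of_subset_of_card_le hsub (by rw [hcard]; exact hC.card_le)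
      intro k hk
      simpa [← this] using hk
    have e2 : g₂ = g := by
      rcases all g₂ hg₂ with e | e | e | e
      · exact e
      · exact absurd (e ▸ hWk) (n₂ hx₂W hx₂l hW₂ hg₂ hgx₂)
      · exact absurd (e ▸ hgx₂) hx₂k
      · exact absurd (e ▸ hVk) (n₂ hx₂V hx₂l hV₂ hg₂ hgx₂)
    have e3 : g₃ = g := by
      rcases all g₃ hg₃ with e | e | e | e
      · exact e
      · exact absurd (e ▸ hWk) (n₃ hx₃W hx₃l hW₃ hg₃ hgx₃)
      · exact absurd (e ▸ hUk) (n₃ hx₃U hx₃l hU₃ hg₃ hgx₃)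
      · exact absurd (e ▸ hgx₃) hx₃k
    exact ⟨x₁, x₂, y₁, y₂, y₃, x₃, C, hC, g, hg, k₁, hk₁, k₂, hk₂, k₃, hk₃, all, hg₁, e2 ▸ hgx₂,
      e3 ▸ hgx₃, hWk, hy₁, hUk, hy₂, hVk, hy₃, e₁, e₂, e₃, c1⟩
  have : Nonempty P := ⟨a⟩
  choose! f₁ f₂ key using key
  have hcard : (({a, a'} : Finset P) ×ˢ ({b, b'} : Finset P)).card < (nodesOn X m).card := by
    rw [Finset.card_product, Finset.card_pair haa, Finset.card_pair hbb, hm]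
    norm_num
  obtain ⟨A, hA, B, hB, hAB, hf⟩ := Finset.exists_ne_map_eq_of_card_lt_of_maps_to
    (s := nodesOn X m) (t := ({a, a'} : Finset P) ×ˢ ({b, b'} : Finset P))
    (f := fun A => (f₁ A, f₂ A)) hcard (by
      intro A hA
      obtain ⟨_, _, _, _, _, _, _, _, _, _, _, _, _, _, _, _, _, _, _, _, _, _, _, _, _, h1, h2, -⟩ :=
        key A hA
      simp only [Finset.coe_product, Set.mem_prod]
      simp only [Finset.mem_coe, Finset.mem_insert, Finset.mem_singleton]
      tauto)
  obtain ⟨y₁, y₂, y₃, x₃, C, hC, g, hg, k₁, hk₁, k₂, hk₂, k₃, hk₃, all, g1, g2, g3, i1, j1, i2, j2,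
    i3, j3, e1, e2, e3, hlC⟩ := key A hA
  obtain ⟨y₁', y₂', y₃', x₃', C', hC', g', hg', k₁', hk₁', k₂', hk₂', k₃', hk₃', all', g1', g2',
    g3', i1', j1', i2', j2', i3', j3', e1', e2', e3', hlC'⟩ := key B hB
  simp only [Prod.mk.injEq] at hf
  rw [← hf.1] at g1' e1'
  rw [← hf.2] at g2' e2'
  have ab : ∀ p q, p ∈ l₁ → q ∈ l₂ → q ≠ V₁₂ → p ≠ q := by
    rintro p q h1 h2 h3 rfl
    exact h12 (line_unique h3 h1 hV₁ h2 hV₂)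
  obtain rfl : g = g' := by
    refine line_unique (ab (f₁ A) (f₂ A) ?_ ?_ ?_) g1 g2 g1' g2'
    · rcases e1 with e | e <;> simp [e, ha, ha']
    · rcases e2 with e | e <;> simp [e, hb, hb']
    · rcases e2 with e | e <;> simp [e, hbV, hbV']
  obtain rfl : x₃ = x₃' := by
    by_contra hx
    have : l₃ = g := by
      refine line_unique hx ?_ ?_ g3 g3'
      · rcases e3 with e | e <;> simp [e, hc, hc']
      · rcases e3' with e | e <;> simp [e, hc, hc']
    exact hlC (this ▸ hg)
  obtain rfl : y₁ = y₁' := by grind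
  obtain rfl : y₂ = y₂' := by grind
  obtain rfl : y₃ = y₃' := by grind
  obtain rfl : k₁ = k₁' := line_unique (by rintro rfl; grind) i1 j1 i1' j1'
  obtain rfl : k₂ = k₂' := line_unique (by rintro rfl; grind) i2 j2 i2' j2'
  obtain rfl : k₃ = k₃' := line_unique (by rintro rfl; grind) i3 j3 i3' j3'
  simp only [mem_nodesOn] at hA hB
  obtain ⟨k, hk, hBk⟩ := hC.exists_mem B hB.1 hAB.symm
  rcases all k hk with rfl | rfl | rfl | rfl
  · exact hC'.notMem _ hg' hBk
  · exact hC'.notMem _ hk₁' hBk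
  · exact hC'.notMem _ hk₂' hBk
  · exact hC'.notMem _ hk₃' hBk

lemma HasCovers.hasThreeLines_four {X : Finset P} (h : HasCovers L 4 X) (hX : X.card = 15) {m : L}
    (hm : (nodesOn X m).card = 5) : HasThreeLines L 5 X := by
  refine HasCovers.hasThreeLines_succ (n := 1) h hm
    ((h.remove hm).hasThreeLines_three (card_nodesOff_of_card_nodesOn (by omega) hm)) ?_ ?_
  · intro k l₁ l₂ V hk
    exact (h.remove hk).false_of_two_disjoint_three (card_nodesOff_of_card_nodesOn (by omega) hk)
  · intro l₁ l₂ l₃ V₁₂ V₁₃ V₂₃ h12 h13 h23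
    exact h.false_of_three_disjoint_four h12 hm

/-! ### Covers when no line is maximal -/

section NoMaximal

variable {X : Finset P} {A B : P} {C D : Finset L} {l : L}

lemma IsCover.shared_card (hX : X.card = 15) (h4 : ∀ m : L, (nodesOn X m).card ≤ 4)
    (hC : IsCover 4 X A C) (hD : IsCover 4 X B D) (hA : A ∈ X) (hB : B ∈ X) (hAB : A ≠ B)
    (hlC : l ∈ C) (hlD : l ∈ D) :
    (nodesOn X l).card = 4 ∧ ((C ∩ D).card = 1 ∨ (C ∩ D).card = 3) := by
  have hl : l ∈ C ∩ D := Finset.mem_inter.2 ⟨hlC, hlD⟩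
  have h1 := hC.card_le_of_shared hD hl hA hB hAB h4
  have h2 := hC.inter_card_lt hD hB hAB
  have h3 := h4 l
  have h5 := Finset.card_pos.2 ⟨l, hl⟩
  interval_cases (C ∩ D).card <;> omega

lemma IsCover.of_three_shared (hX : X.card = 15) (h4 : ∀ m : L, (nodesOn X m).card ≤ 4)
    (hC : IsCover 4 X A C) (hD : IsCover 4 X B D) (hA : A ∈ X) (hB : B ∈ X) (hAB : A ≠ B)
    (hlC : l ∈ C) (hlD : l ∈ D) (h3 : (C ∩ D).card = 3) :
    ∃ s t : L, (nodesOn X s).card = 4 ∧ (nodesOn X t).card = 4 ∧ (∀ p ∈ X, p ∈ s → p ∉ l) ∧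
      (∀ p ∈ X, p ∈ t → p ∉ l) ∧ (∀ p ∈ X, p ∈ s → p ∉ t) ∧
      ∀ p ∈ X, ∀ q ∈ X, p ≠ A → p ≠ B → q ≠ A → q ≠ B → p ∉ l → q ∉ l → p ∉ s → q ∉ s →
        p ∉ t → q ∉ t → p = q := by
  have hl : l ∈ C ∩ D := Finset.mem_inter.2 ⟨hlC, hlD⟩
  obtain ⟨s, t, hst, hs⟩ : ∃ s t, s ≠ t ∧ (C ∩ D).erase l = {s, t} := by
    rw [← Finset.card_eq_two, Finset.card_erase_of_mem hl, h3]
  have hmem : ∀ k, k ∈ C → k ∈ D → k = l ∨ k = s ∨ k = t := by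
    intro k h1 h2
    by_cases hk : k = l
    · exact .inl hk
    · have : k ∈ (C ∩ D).erase l := by simp [hk, h1, h2]
      rw [hs] at this
      simpa using Or.inr (by simpa using this)
  have hCD : (C \ D).card ≤ 1 := by
    have := Finset.card_sdiff_add_card_inter C D
    have := hC.card_le
    omega
  have hDC : (D \ C).card ≤ 1 := by
    have := Finset.card_sdiff_add_card_inter D C
    have := hD.card_le
    rw [Finset.inter_comm] at h3
    omega
  have hrest : ∀ p ∈ X, ∀ q ∈ X, p ≠ A → p ≠ B → q ≠ A → q ≠ B → p ∉ l → q ∉ l → p ∉ s → q ∉ s →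
        p ∉ t → q ∉ t → p = q := by
    intro p hp q hq hpA hpB hqA hqB hpl hql hps hqs hpt hqt
    obtain ⟨x, hx, hpx⟩ := hC.exists_mem p hp hpA
    obtain ⟨x', hx', hqx⟩ := hC.exists_mem q hq hqA
    obtain ⟨y, hy, hpy⟩ := hD.exists_mem p hp hpB
    obtain ⟨y', hy', hqy⟩ := hD.exists_mem q hq hqB
    have n1 : ∀ k : L, p ∈ k → ¬(k = l ∨ k = s ∨ k = t) := by
      rintro k hk (rfl | rfl | rfl) <;> contradiction
    have n2 : ∀ k : L, q ∈ k → ¬(k = l ∨ k = s ∨ k = t) := by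
      rintro k hk (rfl | rfl | rfl) <;> contradiction
    have hxD : x ∉ D := fun h => n1 x hpx (hmem x hx h)
    have hxD' : x' ∉ D := fun h => n2 x' hqx (hmem x' hx' h)
    have hyC : y ∉ C := fun h => n1 y hpy (hmem y h hy)
    have hyC' : y' ∉ C := fun h => n2 y' hqy (hmem y' h hy')
    obtain rfl := Finset.card_le_one.1 hCD x (by simp [*]) x' (by simp [*])
    obtain rfl := Finset.card_le_one.1 hDC y (by simp [*]) y' (by simp [*])
    by_contra hpq
    exact hxD (line_unique hpq hpx hqx hpy hqy ▸ hy)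
  set Y := ((nodesOff X l).erase A).erase B with hYdef
  have hY : Y.card + 2 + (nodesOn X l).card = X.card := hC.card_shared hD hl hA hB hAB
  have hYX : ∀ k : L, nodesOn Y k ⊆ nodesOn X k := by
    intro k p hp
    simp only [hYdef, mem_nodesOn, Finset.mem_erase, mem_nodesOff] at hp ⊢
    tauto
  have h15 : Y.card ≤ (nodesOn Y s ∪ nodesOn Y t).card + 1 := by
    have h1 : Y ⊆ (nodesOn Y s ∪ nodesOn Y t) ∪ Y.filter (fun p => p ∉ s ∧ p ∉ t) := by
      intro p hp
      simp only [Finset.mem_union, mem_nodesOn, Finset.mem_filter]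
      tauto
    have h2 : (Y.filter (fun p => p ∉ s ∧ p ∉ t)).card ≤ 1 := by
      rw [Finset.card_le_one]
      intro p hp q hq
      simp only [hYdef, Finset.mem_filter, Finset.mem_erase, mem_nodesOff] at hp hq
      obtain ⟨⟨p1, p2, p3, p4⟩, p5, p6⟩ := hp
      obtain ⟨⟨q1, q2, q3, q4⟩, q5, q6⟩ := hq
      exact hrest p p3 q q3 p2 p1 q2 q1 p4 q4 p5 q5 p6 q6
    have := (Finset.card_le_card h1).trans (Finset.card_union_le _ _)
    omega
  have e1 := Finset.card_union_add_card_inter (nodesOn Y s) (nodesOn Y t)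
  have e2 := Finset.card_le_card (hYX s)
  have e3 := Finset.card_le_card (hYX t)
  have e4 := h4 s
  have e5 := h4 t
  have e6 := h4 l
  have i1 : nodesOn Y s = nodesOn X s := Finset.eq_of_subset_of_card_le (hYX s) (by omega)
  have i2 : nodesOn Y t = nodesOn X t := Finset.eq_of_subset_of_card_le (hYX t) (by omega)
  have i3 : nodesOn Y s ∩ nodesOn Y t = ∅ := Finset.card_eq_zero.1 (by omega)
  refine ⟨s, t, by omega, by omega, fun p hp hps => ?_, fun p hp hpt => ?_, fun p hp hps hpt => ?_,
    hrest⟩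
  · have : p ∈ nodesOn Y s := by rw [i1]; simp [hp, hps]
    simp only [hYdef, mem_nodesOn, Finset.mem_erase, mem_nodesOff] at this
    exact this.1.2.2.2
  · have : p ∈ nodesOn Y t := by rw [i2]; simp [hp, hpt]
    simp only [hYdef, mem_nodesOn, Finset.mem_erase, mem_nodesOff] at this
    exact this.1.2.2.2
  · have : p ∈ nodesOn Y s ∩ nodesOn Y t := by rw [i1, i2]; simp [hp, hps, hpt]
    simp [i3] at this

lemma IsCover.notMem_of_disjoint {s t : L} (hC : IsCover 4 X A C) (hA : A ∈ X) (hlC : l ∈ C)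
    (hs : (nodesOn X s).card = 4) (ht : (nodesOn X t).card = 4) (hsl : ∀ p ∈ X, p ∈ s → p ∉ l)
    (htl : ∀ p ∈ X, p ∈ t → p ∉ l) (hst : ∀ p ∈ X, p ∈ s → p ∉ t) : A ∉ s := by
  intro hAs
  have hAt := hst A hA hAs
  have c1 := Finset.card_erase_add_one hlC
  have h1 : t ∈ C.erase l := by
    refine mem_of_covered (S := nodesOn X t) (by simp) (fun p hp => ?_) (by have := hC.card_le; omega)
    rw [mem_nodesOn] at hp
    obtain ⟨k, hk, hpk⟩ := hC.exists_mem p hp.1 (by rintro rfl; exact hAt hp.2)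
    exact ⟨k, Finset.mem_erase.2 ⟨by rintro rfl; exact htl p hp.1 hp.2 hpk, hk⟩, hpk⟩
  have c2 := Finset.card_erase_add_one h1
  have c3 := Finset.card_erase_add_one (s := nodesOn X s) (a := A) (by simp [hA, hAs])
  have h2 : s ∈ (C.erase l).erase t := by
    refine mem_of_covered (S := (nodesOn X s).erase A) (by simp) (fun p hp => ?_)
      (by have := hC.card_le; omega)
    rw [Finset.mem_erase, mem_nodesOn] at hp
    obtain ⟨k, hk, hpk⟩ := hC.exists_mem p hp.2.1 hp.1
    exact ⟨k, Finset.mem_erase.2 ⟨by rintro rfl; exact hst p hp.2.1 hp.2.2 hpk,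
      Finset.mem_erase.2 ⟨by rintro rfl; exact hsl p hp.2.1 hp.2.2 hpk, hk⟩⟩, hpk⟩
  simp only [Finset.mem_erase] at h2
  exact hC.notMem s h2.2.2 hAs

lemma IsCover.of_one_shared (hX : X.card = 15) (h4 : ∀ m : L, (nodesOn X m).card ≤ 4)
    (hC : IsCover 4 X A C) (hD : IsCover 4 X B D) (hA : A ∈ X) (hB : B ∈ X) (hAB : A ≠ B)
    (hlC : l ∈ C) (hlD : l ∈ D) (h1 : (C ∩ D).card = 1) {a : L} (ha : a ∈ C) (hal : a ≠ l) :
    (nodesOn (nodesOff X l) a).card = if B ∈ a then 4 else 3 := by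
  have hl : l ∈ C ∩ D := Finset.mem_inter.2 ⟨hlC, hlD⟩
  set Y := ((nodesOff X l).erase A).erase B with hYdef
  have hY : Y.card + 2 + (nodesOn X l).card = X.card := hC.card_shared hD hl hA hB hAB
  have e6 := h4 l
  have hCY := (hC.shared hD l).1
  have hDY := (hC.shared hD l).2
  have hle : ∀ k ∈ C.erase l, (nodesOn Y k).card ≤ 3 := by
    intro k hk
    have hkD : k ∉ D := fun h => (Finset.mem_erase.1 hk).1 <|
      Finset.card_le_one.1 h1.le k (Finset.mem_inter.2 ⟨(Finset.mem_erase.1 hk).2, h⟩) l hl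
    have c1 := Finset.card_erase_add_one hlD
    have c2 := card_le_card_of_covered (S := nodesOn Y k) (m := k) (C := D.erase l) (by simp)
      (fun h => hkD (Finset.mem_of_mem_erase h)) fun p hp => hDY p (mem_nodesOn.1 hp).1
    have := hD.card_le
    omega
  have ha' : a ∈ C.erase l := Finset.mem_erase.2 ⟨hal, ha⟩
  have hsub : Y ⊆ nodesOn Y a ∪ ((C.erase l).erase a).biUnion (nodesOn Y) := by
    intro p hp
    obtain ⟨k, hk, hpk⟩ := hCY p hp
    by_cases hka : k = a
    · exact Finset.mem_union_left _ (mem_nodesOn.2 ⟨hp, hka ▸ hpk⟩)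
    · exact Finset.mem_union_right _
        (Finset.mem_biUnion.2 ⟨k, Finset.mem_erase.2 ⟨hka, hk⟩, mem_nodesOn.2 ⟨hp, hpk⟩⟩)
  have h2 := (Finset.card_le_card hsub).trans (Finset.card_union_le _ _)
  have h3 := Finset.card_biUnion_le_card_mul ((C.erase l).erase a) (nodesOn Y) 3
    fun k hk => hle k (Finset.mem_of_mem_erase hk)
  have c1 := Finset.card_erase_add_one hlC
  have c2 := Finset.card_erase_add_one ha'
  have c3 := hC.card_le
  have c4 := hle a ha'
  have hYa : (nodesOn Y a).card = 3 := by omega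
  have hAa := hC.notMem a ha
  have hBl := hD.notMem l hlD
  split_ifs with hBa
  · have : nodesOn Y a = (nodesOn (nodesOff X l) a).erase B := by
      ext p
      simp only [hYdef, mem_nodesOn, Finset.mem_erase, mem_nodesOff]
      have : p ∈ a → p ≠ A := by rintro h rfl; exact hAa h
      tauto
    have c5 := Finset.card_erase_add_one (s := nodesOn (nodesOff X l) a) (a := B)
      (by simp [hB, hBl, hBa])
    rw [← this] at c5
    omega
  · have : nodesOn Y a = nodesOn (nodesOff X l) a := by
      ext p
      simp only [hYdef, mem_nodesOn, Finset.mem_erase, mem_nodesOff]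
      have : p ∈ a → p ≠ A := by rintro h rfl; exact hAa h
      have : p ∈ a → p ≠ B := by rintro h rfl; exact hBa h
      tauto
    rw [← this, hYa]

/-- The points of `X` having some cover that contains `l`. -/
noncomputable def users (X : Finset P) (l : L) : Finset P :=
  X.filter fun B => ∃ C, IsCover 4 X B C ∧ l ∈ C

lemma mem_users : B ∈ users X l ↔ B ∈ X ∧ ∃ C, IsCover 4 X B C ∧ l ∈ C := by simp [users]

lemma card_users_le_three (hX : X.card = 15) (h4 : ∀ m : L, (nodesOn X m).card ≤ 4) :
    (users X l).card ≤ 3 := by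
  by_contra! hcon
  obtain ⟨A₁, h1⟩ : (users X l).Nonempty := Finset.card_pos.1 (by omega)
  have := Finset.card_erase_add_one h1
  obtain ⟨A₂, h2, A₃, h3, A₄, h5, h23, h24, h34⟩ := Finset.two_lt_card.1
    (show 2 < ((users X l).erase A₁).card by omega)
  simp only [Finset.mem_erase, mem_users] at h1 h2 h3 h5
  obtain ⟨hX₁, C₁, hC₁, hl₁⟩ := h1
  obtain ⟨h12, hX₂, C₂, hC₂, hl₂⟩ := h2
  obtain ⟨h13, hX₃, C₃, hC₃, hl₃⟩ := h3
  obtain ⟨h14, hX₄, C₄, hC₄, hl₄⟩ := h5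
  have no3 : ∀ {A B E F : P} {C D G H : Finset L}, IsCover 4 X A C → IsCover 4 X B D →
      IsCover 4 X E G → IsCover 4 X F H → A ∈ X → B ∈ X → E ∈ X → F ∈ X → l ∈ C → l ∈ D →
      l ∈ G → l ∈ H → A ≠ B → E ≠ A → E ≠ B → F ≠ A → F ≠ B → E ≠ F → (C ∩ D).card = 1 := by
    intro A B E F C D G H hC hD hG hH hA hB hE hF lC lD lG lH hAB hEA hEB hFA hFB hEF
    refine (hC.shared_card hX h4 hD hA hB hAB lC lD).2.resolve_right fun h3 => ?_
    obtain ⟨s, t, hs, ht, hsl, htl, hst, hrest⟩ := hC.of_three_shared hX h4 hD hA hB hAB lC lD h3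
    have hts : ∀ p ∈ X, p ∈ t → p ∉ s := fun p hp h h' => hst p hp h' h
    exact hEF (hrest E hE F hF hEA hEB hFA hFB (hG.notMem l lG) (hH.notMem l lH)
      (hG.notMem_of_disjoint hE lG hs ht hsl htl hst)
      (hH.notMem_of_disjoint hF lH hs ht hsl htl hst)
      (hG.notMem_of_disjoint hE lG ht hs htl hsl hts)
      (hH.notMem_of_disjoint hF lH ht hs htl hsl hts))
  have line : ∀ {A B E F : P} {C D G H : Finset L}, IsCover 4 X A C → IsCover 4 X B D →
      IsCover 4 X E G → IsCover 4 X F H → A ∈ X → B ∈ X → E ∈ X → F ∈ X → l ∈ C → l ∈ D →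
      l ∈ G → l ∈ H → A ≠ B → E ≠ A → E ≠ B → F ≠ A → F ≠ B → E ≠ F →
      ∃ a ∈ C, E ∈ a ∧ F ∈ a ∧ B ∈ a := by
    intro A B E F C D G H hC hD hG hH hA hB hE hF lC lD lG lH hAB hEA hEB hFA hFB hEF
    have n1 := no3 hC hD hG hH hA hB hE hF lC lD lG lH hAB hEA hEB hFA hFB hEF
    have n2 := no3 hC hG hD hH hA hE hB hF lC lG lD lH hEA.symm hAB.symm hEB.symm hFA hEF.symm
      hFB.symm
    have n3 := no3 hC hH hD hG hA hF hB hE lC lH lD lG hFA.symm hAB.symm hFB.symm hEA hEF hEB.symm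
    obtain ⟨a, ha, hBa⟩ := hC.exists_mem B hB hAB.symm
    have hal : a ≠ l := by rintro rfl; exact hD.notMem a lD hBa
    have m1 := hC.of_one_shared hX h4 hD hA hB hAB lC lD n1 ha hal
    have m2 := hC.of_one_shared hX h4 hG hA hE hEA.symm lC lG n2 ha hal
    have m3 := hC.of_one_shared hX h4 hH hA hF hFA.symm lC lH n3 ha hal
    rw [m1, if_pos hBa] at m2 m3
    refine ⟨a, ha, ?_, ?_, hBa⟩
    · by_contra h; rw [if_neg h] at m2; omega
    · by_contra h; rw [if_neg h] at m3; omega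
  obtain ⟨a, ha, h3a, h4a, -⟩ := line hC₁ hC₂ hC₃ hC₄ hX₁ hX₂ hX₃ hX₄ hl₁ hl₂ hl₃ hl₄ h12.symm h13
    h23.symm h14 h24.symm h34
  obtain ⟨b, -, h3b, h4b, h1b⟩ := line hC₂ hC₁ hC₃ hC₄ hX₂ hX₁ hX₃ hX₄ hl₂ hl₁ hl₃ hl₄ h12 h23.symm
    h13 h24.symm h14 h34
  exact hC₁.notMem a ha (line_unique h34 h3b h4b h3a h4a ▸ h1b)

lemma card_users_le_one (hX : X.card = 15) (h4 : ∀ m : L, (nodesOn X m).card ≤ 4)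
    (hl : (nodesOn X l).card < 4) : (users X l).card ≤ 1 := by
  rw [Finset.card_le_one]
  intro A hA B hB
  rw [mem_users] at hA hB
  obtain ⟨hA, C, hC, lC⟩ := hA
  obtain ⟨hB, D, hD, lD⟩ := hB
  by_contra hAB
  have := (hC.shared_card hX h4 hD hA hB hAB lC lD).1
  omega

lemma IsCover.two_le_card_nodesOn (hX : X.card = 15) (h4 : ∀ m : L, (nodesOn X m).card ≤ 4)
    (hC : IsCover 4 X A C) (hl : l ∈ C) : 2 ≤ (nodesOn X l).card := by
  have hsub : X.erase A ⊆ nodesOn X l ∪ (C.erase l).biUnion (nodesOn X) := by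
    intro p hp
    rw [Finset.mem_erase] at hp
    obtain ⟨k, hk, hpk⟩ := hC.exists_mem p hp.2 hp.1
    by_cases hkl : k = l
    · exact Finset.mem_union_left _ (mem_nodesOn.2 ⟨hp.2, hkl ▸ hpk⟩)
    · exact Finset.mem_union_right _
        (Finset.mem_biUnion.2 ⟨k, Finset.mem_erase.2 ⟨hkl, hk⟩, mem_nodesOn.2 ⟨hp.2, hpk⟩⟩)
  have h2 := (Finset.card_le_card hsub).trans (Finset.card_union_le _ _)
  have h3 := Finset.card_biUnion_le_card_mul (C.erase l) (nodesOn X) 4 fun k _ => h4 k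
  have c1 := Finset.card_erase_add_one hl
  have c3 := hC.card_le
  have c4 := Finset.pred_card_le_card_erase (s := X) (a := A)
  omega

end NoMaximal

section Counting

variable {X : Finset P} {A B : P} {C D : Finset L} {l : L}

lemma card_users_add_one_le (hX : X.card = 15) (h4 : ∀ m : L, (nodesOn X m).card ≤ 4)
    (hl : 2 ≤ (nodesOn X l).card) : (users X l).card + 1 ≤ (nodesOn X l).card := by
  have h1 := card_users_le_three (l := l) hX h4
  have h2 := h4 l
  by_cases h : (nodesOn X l).card < 4
  · have := card_users_le_one hX h4 h
    omega
  · omega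

lemma HasCovers.users_through (h : HasCovers L 4 X) (hX : X.card = 15)
    (h4 : ∀ m : L, (nodesOn X m).card ≤ 4) {p : P} (hp : p ∈ X) :
    (∀ l : L, p ∈ l → 2 ≤ (nodesOn X l).card → (users X l).card + 1 = (nodesOn X l).card) ∧
      ∀ l m : L, p ∈ l → p ∈ m → B ∈ users X l → B ∈ users X m → l = m := by
  have hg : ∀ q ∈ X.erase p, ∃ l : L, p ∈ l ∧ q ∈ users X l := by
    intro q hq
    rw [Finset.mem_erase] at hq
    obtain ⟨C, hC⟩ := h q hq.2
    obtain ⟨l, hl, hpl⟩ := hC.exists_mem p hp hq.1.symm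
    exact ⟨l, hpl, mem_users.2 ⟨hq.2, C, hC, hl⟩⟩
  have hf : ∀ q ∈ X.erase p, ∃ l : L, p ∈ l ∧ q ∈ l := fun q hq =>
    exists_line_through L (Finset.ne_of_mem_erase hq).symm
  obtain ⟨q₀, hq₀⟩ : (X.erase p).Nonempty := by
    apply Finset.card_pos.1
    rw [Finset.card_erase_of_mem hp]
    omega
  have : Nonempty L := ⟨(hf q₀ hq₀).choose⟩
  choose! f hf₁ hf₂ using hf
  choose! g hg₁ hg₂ using hg
  have hne : ∀ {l : L} {q : P}, q ∈ users X l → p ∈ l → q ∈ X.erase p := by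
    intro l q hq hpl
    rw [mem_users] at hq
    obtain ⟨hq, C, hC, hl⟩ := hq
    exact Finset.mem_erase.2 ⟨by rintro rfl; exact hC.notMem l hl hpl, hq⟩
  have hfl : ∀ {l : L} {q : P}, p ∈ l → q ∈ X.erase p → q ∈ l → f q = l := fun hpl hq hql =>
    line_unique (Finset.ne_of_mem_erase hq).symm (hf₁ _ hq) (hf₂ _ hq) hpl hql
  set S := (X.erase p).image f with hS
  have hS₂ : ∀ l : L, p ∈ l → 2 ≤ (nodesOn X l).card → l ∈ S := by
    intro l hpl hl
    obtain ⟨q, hq⟩ : ((nodesOn X l).erase p).Nonempty := by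
      apply Finset.card_pos.1
      rw [Finset.card_erase_of_mem (by simp [hp, hpl])]
      omega
    simp only [Finset.mem_erase, mem_nodesOn] at hq
    have hq' : q ∈ X.erase p := Finset.mem_erase.2 ⟨hq.1, hq.2.1⟩
    exact Finset.mem_image.2 ⟨q, hq', hfl hpl hq' hq.2.2⟩
  have hSp : ∀ l ∈ S, p ∈ l ∧ 2 ≤ (nodesOn X l).card := by
    intro l hl
    obtain ⟨q, hq, rfl⟩ := Finset.mem_image.1 hl
    refine ⟨hf₁ q hq, Finset.one_lt_card.2 ⟨p, ?_, q, ?_, (Finset.ne_of_mem_erase hq).symm⟩⟩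
    · simp [hp, hf₁ q hq]
    · simp [Finset.mem_of_mem_erase hq, hf₂ q hq]
  have hgS : ∀ q ∈ X.erase p, g q ∈ S := by
    intro q hq
    obtain ⟨-, C, hC, hl⟩ := mem_users.1 (hg₂ q hq)
    exact hS₂ _ (hg₁ q hq) (hC.two_le_card_nodesOn hX h4 hl)
  have s1 := Finset.card_eq_sum_card_fiberwise (s := X.erase p) (t := S) (f := f)
    fun q hq => Finset.mem_image_of_mem f hq
  have s2 := Finset.card_eq_sum_card_fiberwise (s := X.erase p) (t := S) (f := g) hgS
  have hsub : ∀ l ∈ S, (X.erase p).filter (fun q => g q = l) ⊆ users X l := by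
    intro l _ q hq
    rw [Finset.mem_filter] at hq
    exact hq.2 ▸ hg₂ q hq.1
  have hfib : ∀ l ∈ S, ((X.erase p).filter (fun q => f q = l)).card + 1 = (nodesOn X l).card := by
    intro l hl
    rw [← Finset.card_erase_add_one (s := nodesOn X l) (a := p) (by simp [hp, (hSp l hl).1])]
    congr 2
    ext q
    simp only [Finset.mem_filter, Finset.mem_erase, mem_nodesOn]
    constructor
    · rintro ⟨hq, rfl⟩
      exact ⟨hq.1, hq.2, hf₂ q (Finset.mem_erase.2 hq)⟩
    · rintro ⟨h1, h2, h3⟩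
      exact ⟨⟨h1, h2⟩, hfl (hSp l hl).1 (Finset.mem_erase.2 ⟨h1, h2⟩) h3⟩
  have hle : ∀ l ∈ S, ((X.erase p).filter (fun q => g q = l)).card ≤
      ((X.erase p).filter (fun q => f q = l)).card := by
    intro l hl
    have h1 := Finset.card_le_card (hsub l hl)
    have h2 := card_users_add_one_le hX h4 (hSp l hl).2
    have h3 := hfib l hl
    omega
  have heq := (Finset.sum_eq_sum_iff_of_le hle).1 (s2.symm.trans s1)
  have husers : ∀ l ∈ S, (X.erase p).filter (fun q => g q = l) = users X l ∧
      (users X l).card + 1 = (nodesOn X l).card := by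
    intro l hl
    have h1 := Finset.card_le_card (hsub l hl)
    have h2 := card_users_add_one_le hX h4 (hSp l hl).2
    have h3 := hfib l hl
    have h5 := heq l hl
    exact ⟨Finset.eq_of_subset_of_card_le (hsub l hl) (by omega), by omega⟩
  have hgl : ∀ l : L, p ∈ l → B ∈ users X l → g B = l := by
    intro l hpl hB
    obtain ⟨-, C, hC, hl⟩ := mem_users.1 hB
    rw [← (husers l (hS₂ l hpl (hC.two_le_card_nodesOn hX h4 hl))).1, Finset.mem_filter] at hB
    exact hB.2
  exact ⟨fun l hpl hl => (husers l (hS₂ l hpl hl)).2, fun l m hpl hpm hl hm =>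
    (hgl l hpl hl).symm.trans (hgl m hpm hm)⟩

lemma HasCovers.card_nodesOn_eq (h : HasCovers L 4 X) (hX : X.card = 15)
    (h4 : ∀ m : L, (nodesOn X m).card ≤ 4) (hl : 2 ≤ (nodesOn X l).card) :
    (nodesOn X l).card = 2 ∨ (nodesOn X l).card = 4 := by
  obtain ⟨p, hp⟩ : (nodesOn X l).Nonempty := Finset.card_pos.1 (by omega)
  rw [mem_nodesOn] at hp
  have h1 := (h.users_through (B := p) hX h4 hp.1).1 l hp.2 hl
  have h2 := h4 l
  by_contra! hcon
  have := card_users_le_one hX h4 (l := l) (by omega)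
  omega

lemma HasCovers.sum_card_nodesOn (h : HasCovers L 4 X) (hX : X.card = 15)
    (h4 : ∀ m : L, (nodesOn X m).card ≤ 4) (hA : A ∈ X) (hC : IsCover 4 X A C) :
    ∑ l ∈ C, (nodesOn X l).card = 14 := by
  rw [← Finset.card_biUnion]
  · have : C.biUnion (nodesOn X) = X.erase A := by
      ext q
      simp only [Finset.mem_biUnion, mem_nodesOn, Finset.mem_erase]
      constructor
      · rintro ⟨l, hl, hq, hql⟩
        exact ⟨by rintro rfl; exact hC.notMem l hl hql, hq⟩
      · rintro ⟨h1, h2⟩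
        obtain ⟨l, hl, hql⟩ := hC.exists_mem q h2 h1
        exact ⟨l, hl, h2, hql⟩
    rw [this, Finset.card_erase_of_mem hA, hX]
  · intro l hl m hm hlm
    refine Finset.disjoint_left.2 fun q hq hq' => ?_
    rw [mem_nodesOn] at hq hq'
    exact hlm ((h.users_through hX h4 hq.1).2 l m hq.2 hq'.2 (mem_users.2 ⟨hA, C, hC, hl⟩)
      (mem_users.2 ⟨hA, C, hC, hm⟩))

/-- Three `4`-node lines cover all nodes but the vertices of a triangle. -/
structure IsTriCover (X : Finset P) (A B C : P) (S : Finset L) : Prop where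
  mem : A ∈ X ∧ B ∈ X ∧ C ∈ X
  ne : A ≠ B ∧ A ≠ C ∧ B ≠ C
  card : S.card = 3
  card_nodesOn : ∀ l ∈ S, (nodesOn X l).card = 4
  notMem : ∀ l ∈ S, A ∉ l ∧ B ∉ l ∧ C ∉ l
  exists_mem : ∀ Q ∈ X, Q ≠ A → Q ≠ B → Q ≠ C → ∃ l ∈ S, Q ∈ l
  not_collinear : ∀ l : L, A ∈ l → B ∈ l → C ∉ l

namespace IsTriCover

variable {E F : P} {S : Finset L}

lemma rotate (h : IsTriCover X A E F S) : IsTriCover X E F A S where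
  mem := by have := h.mem; tauto
  ne := ⟨h.ne.2.2, h.ne.1.symm, h.ne.2.1.symm⟩
  card := h.card
  card_nodesOn := h.card_nodesOn
  notMem l hl := by have := h.notMem l hl; tauto
  exists_mem Q hQ h1 h2 h3 := h.exists_mem Q hQ h3 h1 h2
  not_collinear l hE hF hA := h.not_collinear l hA hE hF

lemma isCover (h : IsTriCover X A E F S) {y : L} (hE : E ∈ y) (hF : F ∈ y) :
    IsCover 4 X A (insert y S) where
  card_le := (Finset.card_insert_le _ _).trans (by rw [h.card])
  notMem l hl := by
    rcases Finset.mem_insert.1 hl with rfl | hl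
    · exact fun hA => h.not_collinear _ hA hE hF
    · exact (h.notMem l hl).1
  exists_mem Q hQ hQA := by
    by_cases h1 : Q = E
    · exact ⟨y, by simp, h1 ▸ hE⟩
    by_cases h2 : Q = F
    · exact ⟨y, by simp, h2 ▸ hF⟩
    obtain ⟨l, hl, hQl⟩ := h.exists_mem Q hQ hQA h1 h2
    exact ⟨l, by simp [hl], hQl⟩

lemma card_eq_two (h : IsTriCover X A E F S) (hc : HasCovers L 4 X) (hX : X.card = 15)
    (h4 : ∀ m : L, (nodesOn X m).card ≤ 4) {y : L} (hE : E ∈ y) (hF : F ∈ y) :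
    (nodesOn X y).card = 2 := by
  have h1 := hc.sum_card_nodesOn hX h4 h.mem.1 (h.isCover hE hF)
  rw [Finset.sum_insert fun hy => (h.notMem y hy).2.1 hE, Finset.sum_congr rfl h.card_nodesOn,
    Finset.sum_const, h.card] at h1
  simpa using h1

end IsTriCover

lemma IsCover.exists_isTriCover (hC : IsCover 4 X A C) (h : HasCovers L 4 X) (hX : X.card = 15)
    (h4 : ∀ m : L, (nodesOn X m).card ≤ 4) (hA : A ∈ X) :
    ∃ (E F : P) (S : Finset L) (x : L), IsTriCover X A E F S ∧ x ∈ C ∧ E ∈ x ∧ F ∈ x ∧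
      (∀ p ∈ X, p ∈ x → p = E ∨ p = F) ∧ ∀ l ∈ C, (nodesOn X l).card = 2 → l = x := by
  have h2 : ∀ l ∈ C, (nodesOn X l).card = 2 ∨ (nodesOn X l).card = 4 := fun l hl =>
    h.card_nodesOn_eq hX h4 (hC.two_le_card_nodesOn hX h4 hl)
  have hsum := h.sum_card_nodesOn hX h4 hA hC
  have huniq : ∀ l ∈ C, ∀ m ∈ C, ∀ p ∈ X, p ∈ l → p ∈ m → l = m := fun l hl m hm p hp hpl hpm =>
    (h.users_through hX h4 hp).2 l m hpl hpm (mem_users.2 ⟨hA, C, hC, hl⟩)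
      (mem_users.2 ⟨hA, C, hC, hm⟩)
  rw [← Finset.sum_filter_add_sum_filter_not C (fun l => (nodesOn X l).card = 2),
    Finset.sum_congr rfl (g := fun _ => 2) (fun l hl => (Finset.mem_filter.1 hl).2),
    Finset.sum_congr (s₁ := C.filter fun l => ¬ (nodesOn X l).card = 2) rfl (g := fun _ => 4)
      (fun l hl => (h2 l (Finset.mem_filter.1 hl).1).resolve_left (Finset.mem_filter.1 hl).2),
    Finset.sum_const, Finset.sum_const, smul_eq_mul, smul_eq_mul] at hsum
  have hcard := Finset.card_filter_add_card_filter_not (s := C) (fun l => (nodesOn X l).card = 2)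
  have hC4 := hC.card_le
  set C₂ := C.filter fun l => (nodesOn X l).card = 2 with hC₂
  set S := C.filter fun l => ¬ (nodesOn X l).card = 2 with hS
  obtain ⟨x, hx⟩ := Finset.card_eq_one.1 (show C₂.card = 1 by omega)
  have hxC : x ∈ C₂ := by simp [hx]
  rw [hC₂, Finset.mem_filter] at hxC
  obtain ⟨E, F, hEF, hxX⟩ := Finset.card_eq_two.1 hxC.2
  have hxX' : ∀ p, p ∈ X ∧ p ∈ x ↔ p = E ∨ p = F := fun p => by
    rw [← mem_nodesOn, hxX]; simp
  have hE := (hxX' E).2 (.inl rfl)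
  have hF := (hxX' F).2 (.inr rfl)
  have hAx := hC.notMem x hxC.1
  have hall : ∀ l ∈ C, (nodesOn X l).card = 2 → l = x := fun l hl hl2 => by
    have : l ∈ C₂ := by rw [hC₂, Finset.mem_filter]; exact ⟨hl, hl2⟩
    simpa [hx] using this
  have hSx : ∀ l ∈ S, l ∈ C ∧ l ≠ x := fun l hl => by
    rw [hS, Finset.mem_filter] at hl
    exact ⟨hl.1, by rintro rfl; exact hl.2 hxC.2⟩
  refine ⟨E, F, S, x, ⟨⟨hA, hE.1, hF.1⟩, ⟨?_, ?_, hEF⟩, by omega, fun l hl => ?_, fun l hl => ?_, ?_,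
    ?_⟩, hxC.1, hE.2, hF.2, fun p hp hpx => (hxX' p).1 ⟨hp, hpx⟩, hall⟩
  · rintro rfl; exact hAx hE.2
  · rintro rfl; exact hAx hF.2
  · rw [hS, Finset.mem_filter] at hl
    exact (h2 l hl.1).resolve_left hl.2
  · obtain ⟨hlC, hlx⟩ := hSx l hl
    exact ⟨hC.notMem l hlC, fun hEl => hlx (huniq l hlC x hxC.1 E hE.1 hEl hE.2),
      fun hFl => hlx (huniq l hlC x hxC.1 F hF.1 hFl hF.2)⟩
  · intro Q hQ hQA hQE hQF
    obtain ⟨l, hl, hQl⟩ := hC.exists_mem Q hQ hQA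
    refine ⟨l, ?_, hQl⟩
    rw [hS, Finset.mem_filter]
    refine ⟨hl, fun hl2 => ?_⟩
    obtain rfl := hall l hl hl2
    exact ((hxX' Q).1 ⟨hQ, hQl⟩).elim hQE hQF
  · intro l hAl hEl hFl
    exact hAx (line_unique hEF hEl hFl hE.2 hF.2 ▸ hAl)

lemma IsTriCover.card_eq_four {E F : P} {S : Finset L} (hT : IsTriCover X A E F S)
    (h : HasCovers L 4 X) (hX : X.card = 15) (h4 : ∀ m : L, (nodesOn X m).card ≤ 4) {Q : P}
    (hQ : Q ∈ X) (hQA : Q ≠ A) (hQE : Q ≠ E) (hQF : Q ≠ F) (hAl : A ∈ l) (hQl : Q ∈ l) :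
    (nodesOn X l).card = 4 := by
  have hl2 : 2 ≤ (nodesOn X l).card := Finset.one_lt_card.2
    ⟨A, by simp [hT.mem.1, hAl], Q, by simp [hQ, hQl], hQA.symm⟩
  refine (h.card_nodesOn_eq hX h4 hl2).resolve_left fun hl => ?_
  have h1 := (h.users_through (B := A) hX h4 hQ).1 l hQl hl2
  obtain ⟨D, hD⟩ : (users X l).Nonempty := Finset.card_pos.1 (by omega)
  obtain ⟨hDX, C, hC, hlC⟩ := mem_users.1 hD
  obtain ⟨E', F', S', x, hT', hxC, hE', hF', hx, hall⟩ := hC.exists_isTriCover h hX h4 hDX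
  obtain rfl := hall l hlC hl
  obtain ⟨y, hEy, hFy⟩ := exists_line_through L hT.ne.2.2
  obtain ⟨s, hs, hQs⟩ := hT.exists_mem Q hQ hQA hQE hQF
  have hAs : A ∈ users X s := mem_users.2
    ⟨hT.mem.1, _, hT.isCover hEy hFy, Finset.mem_insert_of_mem hs⟩
  have fin : ∀ {U V : P}, IsTriCover X A U V S' → Q = U ∨ Q = V → False := by
    intro U V hT' hQUV
    obtain ⟨w, hUw, hVw⟩ := exists_line_through L hT'.ne.2.2
    have hQw : Q ∈ w := by rcases hQUV with rfl | rfl <;> assumption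
    have hw := hT'.card_eq_two h hX h4 hUw hVw
    have hAw : A ∈ users X w := mem_users.2
      ⟨hT.mem.1, _, hT'.isCover hUw hVw, Finset.mem_insert_self _ _⟩
    obtain rfl := (h.users_through hX h4 hQ).2 w s hQw hQs hAw hAs
    have := hT.card_nodesOn w hs
    omega
  rcases hx A hT.mem.1 hAl with rfl | rfl <;> rcases hx Q hQ hQl with rfl | rfl
  · exact hQA rfl
  · exact fin hT'.rotate (.inl rfl)
  · exact fin hT'.rotate.rotate (.inr rfl)
  · exact hQA rfl

end Counting

lemma HasCovers.exists_triangle {X : Finset P} (h : HasCovers L 4 X) (hX : X.card = 15)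
    (h4 : ∀ m : L, (nodesOn X m).card ≤ 4) :
    ∃ A B C : P, (A ∈ X ∧ B ∈ X ∧ C ∈ X) ∧ (A ≠ B ∧ A ≠ C ∧ B ≠ C) ∧
      (∀ l : L, A ∈ l → B ∈ l → C ∉ l) ∧
      ∀ Q ∈ X, Q ≠ A → Q ≠ B → Q ≠ C → ∀ l : L, Q ∈ l →
        ((A ∈ l → B ∉ l) ∧ (B ∈ l → C ∉ l) ∧ (C ∈ l → A ∉ l)) ∧
        ((A ∈ l ∨ B ∈ l ∨ C ∈ l) → (nodesOn X l).card = 4) := by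
  obtain ⟨A, hA⟩ : X.Nonempty := Finset.card_pos.1 (by omega)
  obtain ⟨C₀, hC₀⟩ := h A hA
  obtain ⟨B, C, S, -, hT, -⟩ := hC₀.exists_isTriCover h hX h4 hA
  have two : ∀ {A B C Q : P} {l : L}, IsTriCover X A B C S → Q ∈ X → Q ≠ A → Q ≠ B → Q ≠ C →
      Q ∈ l → B ∈ l → C ∉ l := by
    intro A B C Q l hT hQ hQA hQB hQC hQl hBl hCl
    have h1 := hT.card_eq_two h hX h4 hBl hCl
    have h2 : 2 < (nodesOn X l).card := Finset.two_lt_card.2 ⟨Q, by simp [*], B,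
      by simp [hT.mem, hBl], C, by simp [hT.mem, hCl], hQB, hQC, hT.ne.2.2⟩
    omega
  refine ⟨A, B, C, hT.mem, hT.ne, hT.not_collinear, fun Q hQ hQA hQB hQC l hQl => ⟨⟨?_, ?_, ?_⟩,
    ?_⟩⟩
  · exact two hT.rotate.rotate hQ hQC hQA hQB hQl
  · exact two hT hQ hQA hQB hQC hQl
  · exact two hT.rotate hQ hQB hQC hQA hQl
  · rintro (hl | hl | hl)
    · exact hT.card_eq_four h hX h4 hQ hQA hQB hQC hl hQl
    · exact hT.rotate.card_eq_four h hX h4 hQ hQB hQC hQA hl hQl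
    · exact hT.rotate.rotate.card_eq_four h hX h4 hQ hQC hQA hQB hl hQl

/-! ### Maximal lines and a four-node line -/

section Extra

variable {ι : Type*} {X : Finset P} {M : ι → L} {l : L} {i j : ι} {p : P}

/-- The points of `X` that lie on `M i` and on no other line of the family `M`. -/
noncomputable def extra (X : Finset P) (M : ι → L) (i : ι) : Finset P :=
  (nodesOn X (M i)).filter fun p => ∀ j ≠ i, p ∉ M j

lemma mem_extra : p ∈ extra X M i ↔ (p ∈ X ∧ p ∈ M i) ∧ ∀ j ≠ i, p ∉ M j := by
  simp [extra]

lemma HasCovers.card_extra [Fintype ι] (h : HasCovers L 4 X) (hM : M.Injective)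
    (h5 : ∀ i, (nodesOn X (M i)).card = 5) (i : ι) :
    (extra X M i).card + Fintype.card ι = 6 := by
  have hV : ∀ j, ∃ p, p ∈ X ∧ p ∈ M i ∧ p ∈ M j := fun j => by
    obtain ⟨p, hp⟩ := HasCovers.exists_mem_inter (n := 3) h (h5 i) (h5 j)
    exact ⟨p, hp⟩
  choose V hVX hVi hVj using hV
  have hinj : Set.InjOn V (Finset.univ.erase i : Finset ι) := by
    intro j hj k hk hjk
    have hj' : j ≠ i := by simpa using hj
    have hk' : k ≠ i := by simpa using hk
    by_contra hne
    exact HasCovers.not_concurrent (n := 2) h (hM.ne hj'.symm) (hM.ne hk'.symm) (hM.ne hne) (h5 i)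
      (h5 j) (h5 k) (hVX j) (hVi j) (hVj j) (hjk ▸ hVj k)
  have h1 : (nodesOn X (M i)).filter (fun p => ¬ ∀ j ≠ i, p ∉ M j) =
      (Finset.univ.erase i).image V := by
    ext p
    simp only [Finset.mem_filter, mem_nodesOn, Finset.mem_image, Finset.mem_erase,
      Finset.mem_univ, and_true]
    constructor
    · rintro ⟨⟨hp, hpi⟩, h⟩
      push Not at h
      obtain ⟨j, hji, hpj⟩ := h
      refine ⟨j, hji, ?_⟩
      by_contra hne
      exact hM.ne hji (line_unique hne (hVj j) hpj (hVi j) hpi)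
    · rintro ⟨j, hji, rfl⟩
      exact ⟨⟨hVX j, hVi j⟩, fun h => h j hji (hVj j)⟩
  have h2 := Finset.card_filter_add_card_filter_not (s := nodesOn X (M i))
    (fun p => ∀ j ≠ i, p ∉ M j)
  rw [h1, Finset.card_image_of_injOn hinj, Finset.card_erase_of_mem (Finset.mem_univ i),
    Finset.card_univ, h5] at h2
  have := Fintype.card_pos_iff.2 ⟨i⟩
  have h3 : extra X M i = (nodesOn X (M i)).filter fun p => ∀ j ≠ i, p ∉ M j := by
    ext p; simp [extra]
  rw [h3]
  omega

lemma HasCovers.remove_three {X : Finset P} (h : HasCovers L 4 X) (hX : X.card = 15)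
    {a b c : L} (hab : a ≠ b) (hac : a ≠ c) (hbc : b ≠ c) (ha : (nodesOn X a).card = 5)
    (hb : (nodesOn X b).card = 5) (hc : (nodesOn X c).card = 5) :
    HasCovers L 1 (nodesOff (nodesOff (nodesOff X a) b) c) ∧
      (nodesOff (nodesOff (nodesOff X a) b) c).card = 3 := by
  obtain ⟨p, hp, hpa, hpb⟩ := HasCovers.exists_mem_inter (n := 3) h ha hb
  obtain ⟨q, hq, hqa, hqc⟩ := HasCovers.exists_mem_inter (n := 3) h ha hc
  obtain ⟨r, hr, hrb, hrc⟩ := HasCovers.exists_mem_inter (n := 3) h hb hc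
  have hra : r ∉ a := fun hra =>
    HasCovers.not_concurrent (n := 2) h hab hac hbc ha hb hc hr hra hrb hrc
  have e1 := card_nodesOn_nodesOff_of_mem hab.symm hp hpb hpa
  have e2 := card_nodesOn_nodesOff_of_mem hac.symm hq hqc hqa
  have e3 := card_nodesOn_nodesOff_of_mem (X := nodesOff X a) hbc.symm (by simp [hr, hra]) hrc hrb
  have c1 := card_nodesOn_add_card_nodesOff X a
  have c2 := card_nodesOn_add_card_nodesOff (nodesOff X a) b
  have c3 := card_nodesOn_add_card_nodesOff (nodesOff (nodesOff X a) b) c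
  have h1 := HasCovers.remove (n := 3) h ha
  have h2 := HasCovers.remove (n := 2) h1 (m := b) (by omega)
  exact ⟨HasCovers.remove (n := 1) h2 (m := c) (by omega), by omega⟩

lemma false_of_pairs {α : Type*} (a b : Fin 4 → α) (ha : a.Injective)
    (hpair : ∀ i j, i ≠ j → a i = b j ∨ b i = a j ∨ b i = b j)
    (hno : ∀ x, ∃ i, x ≠ a i ∧ x ≠ b i) : False := by
  have h01 := hpair 0 1 (by decide)
  have h02 := hpair 0 2 (by decide)
  have h03 := hpair 0 3 (by decide)
  have h12 := hpair 1 2 (by decide)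
  have h13 := hpair 1 3 (by decide)
  have h23 := hpair 2 3 (by decide)
  have n01 := ha.ne (show (0 : Fin 4) ≠ 1 by decide)
  have n02 := ha.ne (show (0 : Fin 4) ≠ 2 by decide)
  have n03 := ha.ne (show (0 : Fin 4) ≠ 3 by decide)
  have n12 := ha.ne (show (1 : Fin 4) ≠ 2 by decide)
  have n13 := ha.ne (show (1 : Fin 4) ≠ 3 by decide)
  have n23 := ha.ne (show (2 : Fin 4) ≠ 3 by decide)
  have hex : ∀ x, (x ≠ a 0 ∧ x ≠ b 0) ∨ (x ≠ a 1 ∧ x ≠ b 1) ∨ (x ≠ a 2 ∧ x ≠ b 2) ∨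
      (x ≠ a 3 ∧ x ≠ b 3) := fun x => by
    obtain ⟨i, hi⟩ := hno x
    fin_cases i
    · exact Or.inl hi
    · exact Or.inr (Or.inl hi)
    · exact Or.inr (Or.inr (Or.inl hi))
    · exact Or.inr (Or.inr (Or.inr hi))
  have x0 := hex (b 0)
  have x1 := hex (a 0)
  have x2 := hex (b 1)
  clear hex hno hpair ha
  generalize a 0 = a0 at *
  generalize a 1 = a1 at *
  generalize a 2 = a2 at *
  generalize a 3 = a3 at *
  generalize b 0 = b0 at *
  generalize b 1 = b1 at *
  generalize b 2 = b2 at *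
  generalize b 3 = b3 at *
  grind

end Extra

section FourLines

variable {X : Finset P}

lemma extra_pairwise {ι : Type*} {M : ι → L} {e : ι → P} (he : ∀ i, e i ∈ extra X M i) :
    e.Injective := by
  intro i j hij
  by_contra hne
  exact (mem_extra.1 (he j)).2 i hne (hij ▸ (mem_extra.1 (he i)).1.2)

lemma exists_fin_four_compl : ∀ i j : Fin 4, i ≠ j →
    ∃ k k', k ≠ i ∧ k ≠ j ∧ k' ≠ i ∧ k' ≠ j ∧ k ≠ k' := by decide

lemma HasCovers.exists_mem_notMem (h : HasCovers L 4 X) (hX : X.card = 15) {M : Fin 4 → L}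
    (hM : M.Injective) (h5 : ∀ i, (nodesOn X (M i)).card = 5) : ∃ O ∈ X, ∀ i, O ∉ M i := by
  obtain ⟨h1, h3⟩ := h.remove_three hX (hM.ne (show (0 : Fin 4) ≠ 1 by decide))
    (hM.ne (show (0 : Fin 4) ≠ 2 by decide)) (hM.ne (show (1 : Fin 4) ≠ 2 by decide))
    (h5 0) (h5 1) (h5 2)
  have h2 := h1.card_nodesOn_le (M 3)
  have h4 := card_nodesOn_add_card_nodesOff (nodesOff (nodesOff (nodesOff X (M 0)) (M 1)) (M 2))
    (M 3)
  obtain ⟨O, hO⟩ : (nodesOff (nodesOff (nodesOff (nodesOff X (M 0)) (M 1)) (M 2)) (M 3)).Nonempty :=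
    Finset.card_pos.1 (by omega)
  simp only [mem_nodesOff] at hO
  refine ⟨O, hO.1.1.1.1, fun i => ?_⟩
  fin_cases i
  · exact hO.1.1.1.2
  · exact hO.1.1.2
  · exact hO.1.2
  · exact hO.2

/-- Two of four maximal lines: some line through a given point off all four lines meets both
at nodes that lie on no other of the four lines. -/
lemma HasCovers.exists_line_of_four (h : HasCovers L 4 X) {M : Fin 4 → L} (hM : M.Injective)
    (h5 : ∀ i, (nodesOn X (M i)).card = 5) {O : P} (hO : O ∈ X) (hOM : ∀ i, O ∉ M i)
    {i j : Fin 4} (hij : i ≠ j) :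
    ∃ d : L, O ∈ d ∧ (∃ p ∈ extra X M i, p ∈ d) ∧ ∃ p ∈ extra X M j, p ∈ d := by
  have hcard : ∀ i, (extra X M i).card = 2 := fun i => by
    have := h.card_extra hM h5 i
    simp only [Fintype.card_fin] at this
    omega
  obtain ⟨k, k', hki, hkj, hki', hkj', hkk⟩ := exists_fin_four_compl i j hij
  obtain ⟨V, hV, hVi, hVj⟩ := HasCovers.exists_mem_inter (n := 3) h (h5 i) (h5 j)
  obtain ⟨C, hC⟩ := h V hV
  have hmem : ∀ k, k ≠ i → k ≠ j → M k ∈ C := fun k hki hkj =>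
    hC.maximal_mem (by rw [h5]; omega) (HasCovers.not_concurrent (n := 2) h (hM.ne hij)
      (hM.ne hki.symm) (hM.ne hkj.symm) (h5 i) (h5 j) (h5 k) hV hVi hVj)
  set D := (C.erase (M k)).erase (M k') with hD
  have hDcard : D.card ≤ 2 := by
    have h1 := hC.card_le
    rw [hD, Finset.card_erase_of_mem (by
      simp [hmem k' hki' hkj', hM.ne hkk.symm]), Finset.card_erase_of_mem (hmem k hki hkj)]
    omega
  have hD' : ∀ p ∈ X, p ≠ V → p ∉ M k → p ∉ M k' → ∃ d ∈ D, p ∈ d := fun p hp hpV hpk hpk' => by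
    obtain ⟨d, hd, hpd⟩ := hC.exists_mem p hp hpV
    refine ⟨d, ?_, hpd⟩
    simp only [hD, Finset.mem_erase]
    exact ⟨fun e => hpk' (e ▸ hpd), fun e => hpk (e ▸ hpd), hd⟩
  have hDC : ∀ d ∈ D, d ∈ C := fun d hd => Finset.mem_of_mem_erase (Finset.mem_of_mem_erase hd)
  obtain ⟨d, hd, hOd⟩ := hD' O hO (fun e => hOM i (e ▸ hVi)) (hOM k) (hOM k')
  have key : ∀ i' j', i' ≠ j' → V ∈ M i' → V ∈ M j' → k ≠ i' → k' ≠ i' →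
      ∃ p ∈ extra X M i', p ∈ d := fun i' j' hne hVi hVj hki hki' => by
    refine exists_mem_of_card_le (m := M i') (fun p hp => (mem_extra.1 hp).1.2)
      (fun hm => hC.notMem _ (hDC _ hm) hVi) (fun p hp => ?_) (hDcard.trans (hcard i').ge) hd
    have := mem_extra.1 hp
    exact hD' p this.1.1 (fun e => this.2 j' hne.symm (e ▸ hVj)) (this.2 k hki) (this.2 k' hki')
  exact ⟨d, hOd, key i j hij hVi hVj hki hki', key j i hij.symm hVj hVi hkj hkj'⟩

lemma HasCovers.false_of_four_lines (h : HasCovers L 4 X) (hX : X.card = 15) {M : Fin 4 → L}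
    (hM : M.Injective) (h5 : ∀ i, (nodesOn X (M i)).card = 5) {l : L} (hl : (nodesOn X l).card = 4)
    (hmeet : ∀ m : L, (nodesOn X m).card = 5 → ∃ p ∈ X, p ∈ m ∧ p ∈ l)
    (hsep : ∀ m m' : L, (nodesOn X m).card = 5 → (nodesOn X m').card = 5 → m ≠ m' →
      ∀ p ∈ X, p ∈ l → p ∈ m → p ∉ m') : False := by
  have hcard : ∀ i, (extra X M i).card = 2 := fun i => by
    have := h.card_extra hM h5 i
    simp only [Fintype.card_fin] at this
    omega
  have he : ∀ i, ∃ p, p ∈ extra X M i ∧ p ∈ l := fun i => by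
    obtain ⟨p, hp, hpm, hpl⟩ := hmeet _ (h5 i)
    exact ⟨p, mem_extra.2 ⟨⟨hp, hpm⟩, fun j hj => hsep _ _ (h5 i) (h5 j) (hM.ne hj.symm) p hp hpl hpm⟩,
      hpl⟩
  choose e he hel using he
  have he' : ∀ i, ∃ q, q ∈ extra X M i ∧ ∀ p ∈ extra X M i, p = e i ∨ p = q := fun i => by
    obtain ⟨x, y, hxy, hs⟩ := Finset.card_eq_two.1 (hcard i)
    have := he i
    rw [hs] at this ⊢
    simp only [Finset.mem_insert, Finset.mem_singleton] at this ⊢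
    rcases this with h | h
    · exact ⟨y, Or.inr rfl, by simp [h]⟩
    · exact ⟨x, Or.inl rfl, by rw [h]; tauto⟩
  choose e' he' hee' using he'
  have heinj := extra_pairwise he
  obtain ⟨O, hO, hOM⟩ := h.exists_mem_notMem hX hM h5
  have hlnodes : ∀ p ∈ X, p ∈ l → ∃ i, p = e i := by
    have himg : Finset.univ.image e = nodesOn X l := by
      refine Finset.eq_of_subset_of_card_le (fun p hp => ?_) ?_
      · obtain ⟨i, -, rfl⟩ := Finset.mem_image.1 hp
        exact mem_nodesOn.2 ⟨(mem_extra.1 (he i)).1.1, hel i⟩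
      · rw [Finset.card_image_of_injective _ heinj, hl]
        simp
    intro p hp hpl
    have : p ∈ Finset.univ.image e := himg ▸ mem_nodesOn.2 ⟨hp, hpl⟩
    obtain ⟨i, -, hi⟩ := Finset.mem_image.1 this
    exact ⟨i, hi.symm⟩
  have hOl : O ∉ l := fun hOl => by
    obtain ⟨i, rfl⟩ := hlnodes O hO hOl
    exact hOM i (mem_extra.1 (he i)).1.2
  have hne : ∀ i, ∀ p ∈ extra X M i, O ≠ p := fun i p hp e =>
    hOM i (e ▸ (mem_extra.1 hp).1.2)
  choose a haO hae using fun i => exists_line_through L (hne i _ (he i))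
  choose b hbO hbe using fun i => exists_line_through L (hne i _ (he' i))
  have hab : ∀ i d, O ∈ d → (∃ p ∈ extra X M i, p ∈ d) → d = a i ∨ d = b i := by
    rintro i d hOd ⟨p, hp, hpd⟩
    rcases hee' i p hp with rfl | rfl
    · exact Or.inl (line_unique (hne i _ hp) hOd hpd (haO i) (hae i))
    · exact Or.inr (line_unique (hne i _ hp) hOd hpd (hbO i) (hbe i))
  have hainj : a.Injective := fun i j hij => by
    by_contra hne
    have : a i = l := line_unique (heinj.ne hne) (hae i) (hij ▸ hae j) (hel i) (hel j)
    exact hOl (this ▸ haO i)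
  refine false_of_pairs a b hainj (fun i j hij => ?_) fun x => ?_
  · obtain ⟨d, hOd, hi, hj⟩ := h.exists_line_of_four hM h5 hO hOM hij
    have h1 := hab i d hOd hi
    have h2 := hab j d hOd hj
    have h3 := hainj.ne hij
    grind
  · by_contra! hcon
    have hcon : ∀ i, O ∈ x ∧ ∃ p ∈ extra X M i, p ∈ x := fun i => by
      by_cases hx : x = a i
      · exact ⟨hx ▸ haO i, e i, he i, hx ▸ hae i⟩
      · have := hcon i hx
        exact ⟨this ▸ hbO i, e' i, he' i, this ▸ hbe i⟩
    choose hOx q hq hqx using hcon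
    have hx5 : (nodesOn X x).card = 5 := by
      refine le_antisymm (h.card_nodesOn_le x) ?_
      have hsub : insert O (Finset.univ.image q) ⊆ nodesOn X x := by
        intro p hp
        rcases Finset.mem_insert.1 hp with rfl | hp
        · exact mem_nodesOn.2 ⟨hO, hOx 0⟩
        · obtain ⟨i, -, rfl⟩ := Finset.mem_image.1 hp
          exact mem_nodesOn.2 ⟨(mem_extra.1 (hq i)).1.1, hqx i⟩
      have := Finset.card_le_card hsub
      rwa [Finset.card_insert_of_notMem, Finset.card_image_of_injective _ (extra_pairwise hq)] at this
      intro hmem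
      obtain ⟨i, -, hi⟩ := Finset.mem_image.1 hmem
      exact hne i _ (hq i) hi.symm
    obtain ⟨p, hp, hpx, hpl⟩ := hmeet x hx5
    obtain ⟨j, rfl⟩ := hlnodes p hp hpl
    exact hsep x (M j) hx5 (h5 j) (fun e => hOM j (e ▸ hOx 0)) _ hp hpl hpx (mem_extra.1 (he j)).1.2

end FourLines

section ThreeLines

variable {X : Finset P}

lemma HasCovers.exists_residual_cover {ι : Type*} {n : ℕ} (h : HasCovers L n X) {M : ι → L}
    (hM : M.Injective) (hn : ∀ i, n < (nodesOn X (M i)).card) {V : P} (hV : V ∈ X) (J : Finset ι)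
    (hJ : ∀ j ∈ J, V ∉ M j) :
    ∃ D : Finset L, D.card + J.card ≤ n ∧ (∀ d ∈ D, V ∉ d) ∧
      ∀ p ∈ X, p ≠ V → (∀ j ∈ J, p ∉ M j) → ∃ d ∈ D, p ∈ d := by
  obtain ⟨C, hC⟩ := h V hV
  have hsub : J.image M ⊆ C := fun m hm => by
    obtain ⟨j, hj, rfl⟩ := Finset.mem_image.1 hm
    exact hC.maximal_mem (hn j) (hJ j hj)
  refine ⟨C \ J.image M, ?_, fun d hd => hC.notMem d (Finset.mem_sdiff.1 hd).1,
    fun p hp hpV hpJ => ?_⟩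
  · have := Finset.card_sdiff_add_card_eq_card hsub
    rw [Finset.card_image_of_injective _ hM] at this
    exact this.trans_le hC.card_le
  · obtain ⟨d, hd, hpd⟩ := hC.exists_mem p hp hpV
    refine ⟨d, Finset.mem_sdiff.2 ⟨hd, fun hmem => ?_⟩, hpd⟩
    obtain ⟨j, hj, rfl⟩ := Finset.mem_image.1 hmem
    exact hpJ j hj hpd

lemma exists_third : ∀ x y : Fin 3, x ≠ y → ∃ z, z ≠ x ∧ z ≠ y := by decide

lemma exists_others : ∀ x : Fin 3, ∃ y z, y ≠ x ∧ z ≠ x ∧ y ≠ z := by decide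

lemma fin_three_cases : ∀ x y z w : Fin 3, x ≠ y → x ≠ z → y ≠ z → w = x ∨ w = y ∨ w = z := by
  decide

/-- A set with exactly three maximal lines `M i`, together with the three nodes `Q x` off these
lines, and the sides `s x` of the triangle that the nodes `Q x` form. -/
structure IsThreeLineConfig (X : Finset P) (M : Fin 3 → L) (Q : Fin 3 → P) (s : Fin 3 → L) :
    Prop where
  hasCovers : HasCovers L 4 X
  line_inj : M.Injective
  card_line : ∀ i, (nodesOn X (M i)).card = 5
  eq_line : ∀ m : L, (nodesOn X m).card = 5 → ∃ i, m = M i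
  inner_mem : ∀ x, Q x ∈ X
  inner_notMem : ∀ x i, Q x ∉ M i
  inner_inj : Q.Injective
  eq_inner : ∀ p ∈ X, (∀ i, p ∉ M i) → ∃ x, p = Q x
  mem_side : ∀ x y, y ≠ x → Q y ∈ s x
  notMem_side : ∀ x, Q x ∉ s x

namespace IsThreeLineConfig

variable {M : Fin 3 → L} {Q : Fin 3 → P} {s : Fin 3 → L}

lemma side_inj (T : IsThreeLineConfig X M Q s) : s.Injective := fun x y hxy => by
  by_contra hne
  exact T.notMem_side x (hxy ▸ T.mem_side y x hne)

lemma eq_side (T : IsThreeLineConfig X M Q s) {x y z : Fin 3} (hy : y ≠ x) (hz : z ≠ x)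
    (hyz : y ≠ z) {m : L} (hym : Q y ∈ m) (hzm : Q z ∈ m) : m = s x :=
  line_unique (T.inner_inj.ne hyz) hym hzm (T.mem_side x y hy) (T.mem_side x z hz)

lemma side_ne (T : IsThreeLineConfig X M Q s) (x i : Fin 3) : s x ≠ M i := fun e => by
  obtain ⟨y, z, hy, -, -⟩ := exists_others x
  exact T.inner_notMem y i (e ▸ T.mem_side x y hy)

lemma card_extra (T : IsThreeLineConfig X M Q s) (i : Fin 3) : (extra X M i).card = 3 := by
  have := T.hasCovers.card_extra T.line_inj T.card_line i
  simp only [Fintype.card_fin] at this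
  omega

lemma inner_ne (T : IsThreeLineConfig X M Q s) {x i : Fin 3} {p : P} (hp : p ∈ extra X M i) :
    p ≠ Q x := fun e => T.inner_notMem x i (e ▸ (mem_extra.1 hp).1.2)

/-- A line through an inner node that meets a side in a second node is that side. -/
lemma eq_side_of_extra (T : IsThreeLineConfig X M Q s) {x y i : Fin 3} (hxy : x ≠ y) {p : P}
    (hp : p ∈ extra X M i) {m : L} (hQ : Q x ∈ m) (hpm : p ∈ m) (hps : p ∈ s y) : m = s y :=
  line_unique (T.inner_ne hp) hpm hQ hps (T.mem_side y x hxy)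

lemma eq_of_side (T : IsThreeLineConfig X M Q s) {x i : Fin 3} {p q : P}
    (hp : p ∈ extra X M i) (hq : q ∈ extra X M i) (hps : p ∈ s x) (hqs : q ∈ s x) : p = q := by
  by_contra hne
  exact T.side_ne x i
    (line_unique hne hps hqs (mem_extra.1 hp).1.2 (mem_extra.1 hq).1.2)

lemma exists_side_hits (T : IsThreeLineConfig X M Q s) {i : Fin 3} {p : P}
    (hp : p ∈ extra X M i) : ∃ x, ∃ e ∈ extra X M i, e ≠ p ∧ e ∈ s x := by
  have hp' := mem_extra.1 hp
  obtain ⟨D, hDc, hDp, hD⟩ := T.hasCovers.exists_residual_cover T.line_inj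
    (fun i => by rw [T.card_line]; omega) hp'.1.1 (Finset.univ.erase i)
    (fun j hj => hp'.2 j (Finset.ne_of_mem_erase hj))
  have hc : (Finset.univ.erase i : Finset (Fin 3)).card = 2 := by
    rw [Finset.card_erase_of_mem (Finset.mem_univ i)]; simp
  have hQ : ∀ x, ∃ d ∈ D, Q x ∈ d := fun x =>
    hD _ (T.inner_mem x) (T.inner_ne hp).symm fun j _ => T.inner_notMem x j
  choose d hdD hQd using hQ
  obtain ⟨y, -, z, -, hyz, hd⟩ := Finset.exists_ne_map_eq_of_card_lt_of_maps_to
    (s := (Finset.univ : Finset (Fin 3))) (t := D) (f := d) (by simp; omega) fun x _ => hdD x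
  obtain ⟨x, hxy, hxz⟩ := exists_third y z hyz
  have hs : d y = s x := T.eq_side hxy.symm hxz.symm hyz (hQd y) (hd ▸ hQd z)
  obtain ⟨e, he, hed⟩ := exists_mem_of_card_le (S := (extra X M i).erase p) (m := M i) (C := D)
    (fun q hq => (mem_extra.1 (Finset.mem_of_mem_erase hq)).1.2) (fun hm => hDp _ hm hp'.1.2)
    (fun q hq => by
      have hq' := mem_extra.1 (Finset.mem_of_mem_erase hq)
      exact hD q hq'.1.1 (Finset.ne_of_mem_erase hq)
        fun j hj => hq'.2 j (Finset.ne_of_mem_erase hj))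
    (by rw [Finset.card_erase_of_mem hp, T.card_extra]; omega) (hdD y)
  exact ⟨x, e, Finset.mem_of_mem_erase he, Finset.ne_of_mem_erase he, hs ▸ hed⟩

lemma exists_two_sides (T : IsThreeLineConfig X M Q s) (i : Fin 3) :
    ∃ x y, x ≠ y ∧ (∃ e ∈ extra X M i, e ∈ s x) ∧ ∃ e ∈ extra X M i, e ∈ s y := by
  obtain ⟨p, hp⟩ : (extra X M i).Nonempty := Finset.card_pos.1 (by rw [T.card_extra]; omega)
  obtain ⟨x, e, he, -, hex⟩ := T.exists_side_hits hp
  obtain ⟨y, e', he', hne, hey⟩ := T.exists_side_hits he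
  refine ⟨x, y, ?_, ⟨e, he, hex⟩, e', he', hey⟩
  rintro rfl
  exact hne (T.eq_of_side he' he hey hex)

lemma exists_missed (T : IsThreeLineConfig X M Q s) (x : Fin 3) :
    ∃ i, ∀ p ∈ extra X M i, p ∉ s x := by
  by_contra! hcon
  choose q hq hqs using hcon
  obtain ⟨y, z, hy, hz, hyz⟩ := exists_others x
  have h5 : (nodesOn X (s x)).card = 5 := by
    refine le_antisymm (T.hasCovers.card_nodesOn_le _) ?_
    have hsub : insert (Q y) (insert (Q z) (Finset.univ.image q)) ⊆ nodesOn X (s x) := by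
      intro p hp
      simp only [Finset.mem_insert, Finset.mem_image, Finset.mem_univ, true_and] at hp
      rcases hp with rfl | rfl | ⟨i, rfl⟩
      · exact mem_nodesOn.2 ⟨T.inner_mem y, T.mem_side x y hy⟩
      · exact mem_nodesOn.2 ⟨T.inner_mem z, T.mem_side x z hz⟩
      · exact mem_nodesOn.2 ⟨(mem_extra.1 (hq i)).1.1, hqs i⟩
    have hq' : ∀ w, Q w ∉ Finset.univ.image q := fun w hmem => by
      obtain ⟨i, -, hi⟩ := Finset.mem_image.1 hmem
      exact T.inner_ne (hq i) hi
    have := Finset.card_le_card hsub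
    rwa [Finset.card_insert_of_notMem, Finset.card_insert_of_notMem (hq' z),
      Finset.card_image_of_injective _ (extra_pairwise hq)] at this
    simp [T.inner_inj.ne hyz, hq' y, - Finset.mem_image]
  obtain ⟨i, hi⟩ := T.eq_line _ h5
  exact T.side_ne x i hi

lemma comp (T : IsThreeLineConfig X M Q s) {σ : Fin 3 → Fin 3} (hσ : σ.Bijective) :
    IsThreeLineConfig X (M ∘ σ) Q s where
  hasCovers := T.hasCovers
  line_inj := T.line_inj.comp hσ.1
  card_line i := T.card_line (σ i)
  eq_line m hm := by
    obtain ⟨i, hi⟩ := T.eq_line m hm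
    obtain ⟨j, rfl⟩ := hσ.2 i
    exact ⟨j, hi⟩
  inner_mem := T.inner_mem
  inner_notMem x i := T.inner_notMem x (σ i)
  inner_inj := T.inner_inj
  eq_inner p hp h := T.eq_inner p hp fun i => by
    obtain ⟨j, rfl⟩ := hσ.2 i
    exact h j
  mem_side := T.mem_side
  notMem_side := T.notMem_side

/-- After renumbering the maximal lines, each side misses the line with its own index. -/
lemma exists_comp (T : IsThreeLineConfig X M Q s) : ∃ σ : Fin 3 → Fin 3,
    IsThreeLineConfig X (M ∘ σ) Q s ∧ ∀ x, ∀ p ∈ extra X (M ∘ σ) x, p ∉ s x := by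
  choose σ hσ using T.exists_missed
  have hinj : σ.Injective := fun x y hxy => by
    by_contra hne
    obtain ⟨u, v, huv, ⟨e, he, heu⟩, e', he', hev⟩ := T.exists_two_sides (σ x)
    have h1 : u ≠ x := fun h => hσ x e he (h ▸ heu)
    have h2 : v ≠ x := fun h => hσ x e' he' (h ▸ hev)
    have h3 : u ≠ y := fun h => hσ y e (hxy ▸ he) (h ▸ heu)
    have h4 : v ≠ y := fun h => hσ y e' (hxy ▸ he') (h ▸ hev)
    omega
  have hbij := Finite.injective_iff_bijective.1 hinj
  refine ⟨σ, T.comp hbij, fun x p hp => hσ x p ?_⟩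
  rw [mem_extra] at hp ⊢
  refine ⟨hp.1, fun j hj => ?_⟩
  obtain ⟨k, rfl⟩ := hbij.2 j
  exact hp.2 k fun e => hj (by rw [e])


end IsThreeLineConfig

end ThreeLines

section ThreeLines

variable {X : Finset P} {M : Fin 3 → L} {Q : Fin 3 → P} {s : Fin 3 → L}

namespace IsThreeLineConfig

lemma exists_hit (T : IsThreeLineConfig X M Q s) (hmiss : ∀ x, ∀ p ∈ extra X M x, p ∉ s x)
    {i x : Fin 3} (hix : i ≠ x) : ∃ r ∈ extra X M i, r ∈ s x := by
  obtain ⟨u, v, huv, ⟨e, he, heu⟩, e', he', hev⟩ := T.exists_two_sides i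
  have h1 : u ≠ i := fun h => hmiss i e he (h ▸ heu)
  have h2 : v ≠ i := fun h => hmiss i e' he' (h ▸ hev)
  rcases fin_three_cases u v i x huv h1 h2 with rfl | rfl | rfl
  · exact ⟨e, he, heu⟩
  · exact ⟨e', he', hev⟩
  · exact absurd rfl hix

/-- On each maximal line exactly one node lies on no other maximal line and on no side. -/
lemma exists_free_node (T : IsThreeLineConfig X M Q s)
    (hmiss : ∀ x, ∀ p ∈ extra X M x, p ∉ s x) (i : Fin 3) :
    ∃ m ∈ extra X M i, (∀ x, m ∉ s x) ∧ ∀ p ∈ extra X M i, p ≠ m → ∃ x, x ≠ i ∧ p ∈ s x := by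
  obtain ⟨y, z, hy, hz, hyz⟩ := exists_others i
  obtain ⟨r, hr, hry⟩ := T.exists_hit hmiss hy.symm
  obtain ⟨t, ht, htz⟩ := T.exists_hit hmiss hz.symm
  have hrt : r ≠ t := by
    rintro rfl
    exact T.side_inj.ne hyz (T.eq_side_of_extra hz.symm hr (T.mem_side y i hy.symm) hry htz)
  obtain ⟨m, hm⟩ : (((extra X M i).erase r).erase t).Nonempty := by
    refine Finset.card_pos.1 ?_
    rw [Finset.card_erase_of_mem (Finset.mem_erase.2 ⟨hrt.symm, ht⟩), Finset.card_erase_of_mem hr,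
      T.card_extra]
    omega
  simp only [Finset.mem_erase] at hm
  obtain ⟨hmt, hmr, hm⟩ := hm
  have hall : ({r, t, m} : Finset P) = extra X M i := by
    refine Finset.eq_of_subset_of_card_le ?_ ?_
    · simp [Finset.insert_subset_iff, hr, ht, hm]
    · rw [T.card_extra, Finset.card_eq_three.2 ⟨r, t, m, hrt, hmr.symm, hmt.symm, rfl⟩]
  refine ⟨m, hm, fun x hmx => ?_, fun p hp hpm => ?_⟩
  · rcases fin_three_cases y z i x hyz hy hz with rfl | rfl | rfl
    · exact hmr (T.eq_of_side hm hr hmx hry)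
    · exact hmt (T.eq_of_side hm ht hmx htz)
    · exact hmiss _ m hm hmx
  · rw [← hall] at hp
    simp only [Finset.mem_insert, Finset.mem_singleton] at hp
    rcases hp with rfl | rfl | rfl
    · exact ⟨y, hy, hry⟩
    · exact ⟨z, hz, htz⟩
    · exact absurd rfl hpm

lemma exists_line_free_nodes (T : IsThreeLineConfig X M Q s)
    (hmiss : ∀ x, ∀ p ∈ extra X M x, p ∉ s x) {f : Fin 3 → P}
    (hfree : ∀ i, ∀ p ∈ extra X M i, p ≠ f i → ∃ x, x ≠ i ∧ p ∈ s x)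
    {x i j : Fin 3} (hxi : x ≠ i) (hxj : x ≠ j) (hij : i ≠ j) :
    ∃ d : L, Q x ∈ d ∧ f i ∈ d ∧ f j ∈ d := by
  obtain ⟨V, hV, hVi, hVj⟩ :=
    HasCovers.exists_mem_inter (n := 3) T.hasCovers (T.card_line i) (T.card_line j)
  have hVx : V ∉ M x := HasCovers.not_concurrent (n := 2) T.hasCovers (T.line_inj.ne hij)
    (T.line_inj.ne hxi.symm) (T.line_inj.ne hxj.symm) (T.card_line i) (T.card_line j)
    (T.card_line x) hV hVi hVj
  obtain ⟨D, hDc, hDV, hD⟩ := T.hasCovers.exists_residual_cover T.line_inj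
    (fun i => by rw [T.card_line]; omega) hV {x} (by simpa using hVx)
  simp only [Finset.card_singleton, Finset.mem_singleton, forall_eq] at hDc hD
  have hDc : D.card ≤ 3 := by omega
  have hcov : ∀ a b, a ≠ b → x ≠ a → V ∈ M b → ∀ p ∈ extra X M a, ∃ d ∈ D, p ∈ d :=
    fun a b hab hxa hVb p hp => by
      have hp' := mem_extra.1 hp
      exact hD p hp'.1.1 (fun e => hp'.2 b hab.symm (e ▸ hVb)) (hp'.2 x hxa)
  have hhit : ∀ a b, a ≠ b → x ≠ a → V ∈ M a → V ∈ M b → ∀ d ∈ D, ∃ p ∈ extra X M a, p ∈ d :=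
    fun a b hab hxa hVa hVb d hd =>
      exists_mem_of_card_le (fun p hp => (mem_extra.1 hp).1.2) (fun hm => hDV _ hm hVa)
        (hcov a b hab hxa hVb) (hDc.trans (T.card_extra a).ge) hd
  have hsi : s i ∉ D := fun hs => by
    obtain ⟨p, hp, hps⟩ := hhit i j hij hxi hVi hVj _ hs
    exact hmiss i p hp hps
  have hsj : s j ∉ D := fun hs => by
    obtain ⟨p, hp, hps⟩ := hhit j i hij.symm hxj hVj hVi _ hs
    exact hmiss j p hp hps
  have hQ : ∀ y, ∃ d ∈ D, Q y ∈ d := fun y =>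
    hD _ (T.inner_mem y) (fun e => T.inner_notMem y i (e ▸ hVi)) (T.inner_notMem y x)
  by_cases hsx : s x ∈ D
  · obtain ⟨d, hd, hQd⟩ := hQ x
    refine ⟨d, hQd, ?_⟩
    have key : ∀ a b, a ≠ b → x ≠ a → x ≠ b → V ∈ M a → V ∈ M b → s b ∉ D → f a ∈ d :=
      fun a b hab hxa hxb hVa hVb hsb => by
        obtain ⟨p, hp, hpd⟩ := hhit a b hab hxa hVa hVb d hd
        by_contra hfd
        obtain ⟨u, hu, hpu⟩ := hfree a p hp fun e => hfd (e ▸ hpd)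
        rcases fin_three_cases a b x u hab hxa.symm hxb.symm with rfl | rfl | rfl
        · exact hu rfl
        · exact hsb (T.eq_side_of_extra hxb hp hQd hpd hpu ▸ hd)
        · have := eq_of_card_le (fun p hp => (mem_extra.1 hp).1.2) (fun hm => hDV _ hm hVa)
            (hcov a b hab hxa hVb) (hDc.trans (T.card_extra a).ge) hp hd hsx hpd hpu
          exact T.notMem_side _ (this ▸ hQd)
    exact ⟨key i j hij hxi hxj hVi hVj hsj, key j i hij.symm hxj hxi hVj hVi hsi⟩
  · exfalso
    have hs : ∀ y, s y ∉ D := fun y => by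
      rcases fin_three_cases x i j y hxi hxj hij with rfl | rfl | rfl <;> assumption
    choose d hdD hQd using hQ
    have hdinj : d.Injective := fun y z hyz => by
      by_contra hne
      obtain ⟨w, hwy, hwz⟩ := exists_third y z hne
      exact hs w (T.eq_side hwy.symm hwz.symm hne (hQd y) (hyz ▸ hQd z) ▸ hdD y)
    have himg : Finset.univ.image d = D := by
      refine Finset.eq_of_subset_of_card_le (fun m hm => ?_) ?_
      · obtain ⟨y, -, rfl⟩ := Finset.mem_image.1 hm
        exact hdD y
      · rw [Finset.card_image_of_injective _ hdinj]
        simpa using hDc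
    have key : ∀ a b, a ≠ b → x ≠ a → V ∈ M b → ∃ r ∈ extra X M a, r ∈ s x ∧ r ∈ d x :=
      fun a b hab hxa hVb => by
        obtain ⟨r, hr, hrs⟩ := T.exists_hit hmiss hxa.symm
        obtain ⟨m, hm, hrm⟩ := hcov a b hab hxa hVb r hr
        obtain ⟨y, -, rfl⟩ := Finset.mem_image.1 (himg ▸ hm)
        by_cases hyx : y = x
        · exact ⟨r, hr, hrs, hyx ▸ hrm⟩
        · exact absurd (T.eq_side_of_extra hyx hr (hQd y) hrm hrs ▸ hdD y) hsx
    obtain ⟨r, hr, hrs, hrd⟩ := key i j hij hxi hVj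
    obtain ⟨t, ht, hts, htd⟩ := key j i hij.symm hxj hVi
    have hrt : r ≠ t := fun e => (mem_extra.1 ht).2 i hij (e ▸ (mem_extra.1 hr).1.2)
    exact hsx (line_unique hrt hrs hts hrd htd ▸ hdD x)

lemma false_of_four_node_line_of_missed (T : IsThreeLineConfig X M Q s)
    (hmiss : ∀ x, ∀ p ∈ extra X M x, p ∉ s x) {l : L} (hl : (nodesOn X l).card = 4)
    (hmeet : ∀ i, ∃ p ∈ extra X M i, p ∈ l) : False := by
  choose e he hel using hmeet
  choose f hf hfs hfree using T.exists_free_node hmiss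
  have hls : ∀ x, l ≠ s x := fun x h => hmiss x (e x) (he x) (h ▸ hel x)
  obtain ⟨a, hQa⟩ : ∃ a, Q a ∈ l := by
    by_contra! hcon
    have hsub : nodesOn X l ⊆ Finset.univ.image e := fun p hp => by
      rw [mem_nodesOn] at hp
      by_cases hpM : ∀ i, p ∉ M i
      · obtain ⟨x, rfl⟩ := T.eq_inner p hp.1 hpM
        exact absurd hp.2 (hcon x)
      · push Not at hpM
        obtain ⟨i, hi⟩ := hpM
        refine Finset.mem_image.2 ⟨i, Finset.mem_univ i, ?_⟩
        by_contra hne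
        have hlm : l = M i := line_unique hne (hel i) hp.2 (mem_extra.1 (he i)).1.2 hi
        have := T.card_line i
        rw [← hlm] at this
        omega
    have := (Finset.card_le_card hsub).trans Finset.card_image_le
    simp [hl] at this
  have hside : ∀ i, e i ≠ f i → e i ∈ s a ∧ i ≠ a := fun i hi => by
    obtain ⟨x, hx, hex⟩ := hfree i (e i) (he i) hi
    by_cases hax : a = x
    · exact ⟨hax ▸ hex, fun h => hx (h ▸ hax.symm ▸ rfl)⟩
    · exact absurd (T.eq_side_of_extra hax (he i) hQa (hel i) hex) (hls x)
  have hfa : e a = f a := by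
    by_contra h
    exact (hside a h).2 rfl
  have key : ∀ i j, i ≠ a → j ≠ a → i ≠ j → e i ≠ f i := fun i j hi hj hij h => by
    obtain ⟨d, hQd, hda, hdi⟩ := T.exists_line_free_nodes hmiss hfree hj hij.symm hi.symm
    have hld : l = d := line_unique ((extra_pairwise he).ne hi) (hel i) (hel a) (h ▸ hdi) (hfa ▸ hda)
    exact hls i (T.eq_side hi.symm hij.symm hj.symm hQa (hld ▸ hQd))
  obtain ⟨i, j, hi, hj, hij⟩ := exists_others a
  exact hls a (line_unique ((extra_pairwise he).ne hij) (hel i) (hel j)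
    (hside i (key i j hi hj hij)).1 (hside j (key j i hj hi hij.symm)).1)

end IsThreeLineConfig

end ThreeLines

section Dichotomy

variable {X : Finset P}

lemma HasCovers.exists_isThreeLineConfig (h : HasCovers L 4 X) (hX : X.card = 15)
    {M : Fin 3 → L} (hM : M.Injective) (h5 : ∀ i, (nodesOn X (M i)).card = 5)
    (heq : ∀ m : L, (nodesOn X m).card = 5 → ∃ i, m = M i) :
    ∃ Q s, IsThreeLineConfig X M Q s := by
  obtain ⟨h1, h3⟩ := h.remove_three hX (hM.ne (show (0 : Fin 3) ≠ 1 by decide))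
    (hM.ne (show (0 : Fin 3) ≠ 2 by decide)) (hM.ne (show (1 : Fin 3) ≠ 2 by decide))
    (h5 0) (h5 1) (h5 2)
  set Y := nodesOff (nodesOff (nodesOff X (M 0)) (M 1)) (M 2) with hY
  have hmem : ∀ p, p ∈ Y ↔ p ∈ X ∧ ∀ i, p ∉ M i := fun p => by
    simp only [hY, mem_nodesOff, Fin.forall_fin_succ, IsEmpty.forall_iff, and_true, and_assoc]
    exact Iff.rfl
  obtain ⟨Q⟩ : Nonempty (Fin 3 ≃ Y) := ⟨(Y.equivFinOfCardEq h3).symm⟩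
  have hQY : ∀ x, (Q x : P) ∈ X ∧ ∀ i, (Q x : P) ∉ M i := fun x => (hmem _).1 (Q x).2
  have hQinj : Function.Injective fun x => (Q x : P) :=
    Subtype.val_injective.comp Q.injective
  have hs : ∀ x, ∃ s : L, (∀ y, y ≠ x → (Q y : P) ∈ s) ∧ (Q x : P) ∉ s := fun x => by
    obtain ⟨y, z, hy, hz, hyz⟩ := exists_others x
    obtain ⟨s, hys, hzs⟩ := exists_line_through L (hQinj.ne hyz)
    have hall : ∀ w, w ≠ x → (Q w : P) ∈ s := fun w hw => by
      rcases fin_three_cases y z x w hyz hy hz with rfl | rfl | rfl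
      · exact hys
      · exact hzs
      · exact absurd rfl hw
    refine ⟨s, hall, fun hx => ?_⟩
    have hfull : nodesOn Y s = Y := by
      refine Finset.Subset.antisymm (Finset.filter_subset _ _) fun p hp => ?_
      obtain ⟨w, hw⟩ := Q.surjective ⟨p, hp⟩
      have hw : (Q w : P) = p := congrArg Subtype.val hw
      refine mem_nodesOn.2 ⟨hp, hw ▸ ?_⟩
      by_cases hwx : w = x
      · exact hwx ▸ hx
      · exact hall w hwx
    have := h1.card_nodesOn_le s
    rw [hfull] at this
    omega
  choose s hs hs' using hs
  exact ⟨fun x => Q x, s,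
    { hasCovers := h
      line_inj := hM
      card_line := h5
      eq_line := heq
      inner_mem := fun x => (hQY x).1
      inner_notMem := fun x => (hQY x).2
      inner_inj := hQinj
      eq_inner := fun p hp hpM => by
        obtain ⟨x, hx⟩ := Q.surjective ⟨p, (hmem p).2 ⟨hp, hpM⟩⟩
        exact ⟨x, (congrArg Subtype.val hx).symm⟩
      mem_side := fun x y hy => hs x y hy
      notMem_side := hs' }⟩

/-- A four-node line misses some maximal line or passes through a common node of two maximal
lines. -/
lemma HasCovers.disjoint_or_meet (h : HasCovers L 4 X) (hX : X.card = 15)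
    (h3 : HasThreeLines L 5 X) {l : L} (hl : (nodesOn X l).card = 4) :
    (∃ m : L, (nodesOn X m).card = 5 ∧ ∀ p ∈ X, p ∈ m → p ∉ l) ∨
      ∃ m m' : L, m ≠ m' ∧ (nodesOn X m).card = 5 ∧ (nodesOn X m').card = 5 ∧
        ∃ p ∈ X, p ∈ l ∧ p ∈ m ∧ p ∈ m' := by
  by_contra! hcon
  obtain ⟨hmeet, hsep⟩ := hcon
  have hsep : ∀ m m' : L, (nodesOn X m).card = 5 → (nodesOn X m').card = 5 → m ≠ m' →
      ∀ p ∈ X, p ∈ l → p ∈ m → p ∉ m' := fun m m' hm hm' hne p => hsep m m' hne hm hm' p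
  obtain ⟨a, b, c, hab, hac, hbc, ha, hb, hc⟩ := h3
  by_cases heq : ∀ m : L, (nodesOn X m).card = 5 → ∃ i, m = ![a, b, c] i
  · have hM : Function.Injective ![a, b, c] := by
      intro i j hij
      fin_cases i <;> fin_cases j <;> simp_all [eq_comm]
    have h5 : ∀ i, (nodesOn X (![a, b, c] i)).card = 5 := fun i => by
      fin_cases i <;> assumption
    obtain ⟨Q, s, T⟩ := h.exists_isThreeLineConfig hX hM h5 heq
    obtain ⟨σ, T, hmiss⟩ := T.exists_comp
    refine T.false_of_four_node_line_of_missed hmiss hl fun i => ?_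
    obtain ⟨p, hp, hpm, hpl⟩ := hmeet _ (T.card_line i)
    exact ⟨p, mem_extra.2 ⟨⟨hp, hpm⟩, fun j hj => hsep _ _ (T.card_line i) (T.card_line j)
      (T.line_inj.ne hj.symm) p hp hpl hpm⟩, hpl⟩
  · push Not at heq
    obtain ⟨d, hd, hne⟩ := heq
    have hda := hne 0
    have hdb := hne 1
    have hdc := hne 2
    simp only [Matrix.cons_val] at hda hdb hdc
    refine h.false_of_four_lines hX (M := ![a, b, c, d]) ?_ (fun i => ?_) hl hmeet hsep
    · intro i j hij
      fin_cases i <;> fin_cases j <;> simp_all [eq_comm]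
    · fin_cases i <;> assumption

end Dichotomy

section UseSets

variable {X : Finset P} {l m k : L}

lemma card_residual_of_disjoint (hX : X.card = 15) (hm : (nodesOn X m).card = 5)
    (hl : (nodesOn X l).card = 4) (hdisj : ∀ p ∈ X, p ∈ m → p ∉ l) :
    (nodesOff (nodesOff X m) l).card = 6 := by
  have h1 := card_nodesOn_add_card_nodesOff X m
  have h2 := card_nodesOn_add_card_nodesOff (nodesOff X m) l
  rw [nodesOn_nodesOff_of_disjoint hdisj] at h2
  omega

lemma HasCovers.residual_of_disjoint (h : HasCovers L 4 X) (hm : (nodesOn X m).card = 5)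
    (hl : (nodesOn X l).card = 4) (hdisj : ∀ p ∈ X, p ∈ m → p ∉ l) :
    HasCovers L 2 (nodesOff (nodesOff X m) l) :=
  (h.remove (n := 3) hm).remove (n := 2) (by rwa [nodesOn_nodesOff_of_disjoint hdisj])

lemma HasCovers.users_of_disjoint (h : HasCovers L 4 X) (hm : (nodesOn X m).card = 5)
    (hl : (nodesOn X l).card = 4) (hdisj : ∀ p ∈ X, p ∈ m → p ∉ l) :
    users X l = nodesOff (nodesOff X m) l := by
  ext A
  simp only [mem_users, mem_nodesOff]
  constructor
  · rintro ⟨hA, C, hC, hlC⟩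
    exact ⟨⟨hA, fun hAm => (hC.tight_disjoint hA hAm hm hdisj hl).1 hlC⟩, hC.notMem l hlC⟩
  · rintro ⟨⟨hA, hAm⟩, hAl⟩
    obtain ⟨C, hC⟩ := h A hA
    have hmC := hC.maximal_mem (by omega) hAm
    have := (hC.erase (n := 3) hmC).maximal_mem (m := l)
      (by rw [nodesOn_nodesOff_of_disjoint hdisj]; omega) hAl
    exact ⟨hA, C, hC, Finset.mem_of_mem_erase this⟩

section Meet

variable {V : P}

lemma card_nodesOn_of_meet (hm : (nodesOn X m).card = 5) (hk : (nodesOn X k).card = 5)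
    (hmk : m ≠ k) (hl : (nodesOn X l).card = 4) (hV : V ∈ X) (hVl : V ∈ l) (hVm : V ∈ m)
    (hVk : V ∈ k) :
    (nodesOn (nodesOff X m) k).card = 4 ∧
      (nodesOn (nodesOff (nodesOff X m) k) l).card = 3 := by
  have hlm : l ≠ m := by rintro rfl; omega
  have hlk : l ≠ k := by rintro rfl; omega
  have h1 := card_nodesOn_nodesOff_of_mem hmk.symm hV hVk hVm
  have h2 := card_nodesOn_nodesOff_of_mem hlm hV hVl hVm
  refine ⟨by omega, ?_⟩
  rw [nodesOn_nodesOff_of_disjoint]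
  · omega
  · intro p hp hpk hpl
    rw [mem_nodesOff] at hp
    exact hlk (line_unique (p := p) (q := V) (fun e => hp.2 (e ▸ hVm)) hpl hVl hpk hVk)

lemma card_residual_of_meet (hX : X.card = 15) (hm : (nodesOn X m).card = 5)
    (hk : (nodesOn X k).card = 5) (hmk : m ≠ k) (hl : (nodesOn X l).card = 4) (hV : V ∈ X)
    (hVl : V ∈ l) (hVm : V ∈ m) (hVk : V ∈ k) :
    (nodesOff (nodesOff (nodesOff X m) k) l).card = 3 := by
  obtain ⟨h1, h2⟩ := card_nodesOn_of_meet hm hk hmk hl hV hVl hVm hVk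
  have h3 := card_nodesOn_add_card_nodesOff X m
  have h4 := card_nodesOn_add_card_nodesOff (nodesOff X m) k
  have h5 := card_nodesOn_add_card_nodesOff (nodesOff (nodesOff X m) k) l
  omega

lemma HasCovers.residual_of_meet (h : HasCovers L 4 X) (hm : (nodesOn X m).card = 5)
    (hk : (nodesOn X k).card = 5) (hmk : m ≠ k) (hl : (nodesOn X l).card = 4) (hV : V ∈ X)
    (hVl : V ∈ l) (hVm : V ∈ m) (hVk : V ∈ k) :
    HasCovers L 1 (nodesOff (nodesOff (nodesOff X m) k) l) := by
  obtain ⟨h1, h2⟩ := card_nodesOn_of_meet hm hk hmk hl hV hVl hVm hVk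
  exact ((h.remove (n := 3) hm).remove (n := 2) h1).remove (n := 1) h2

lemma IsCover.notMem_of_meet {A : P} {C : Finset L} (hC : IsCover 4 X A C) (hlC : l ∈ C)
    (hm : (nodesOn X m).card = 5) (hk : (nodesOn X k).card = 5) (hmk : m ≠ k)
    (hl : (nodesOn X l).card = 4) (hA : A ∈ X) (hV : V ∈ X) (hVl : V ∈ l) (hVm : V ∈ m)
    (hVk : V ∈ k) : A ∉ m := fun hAm => by
  have hAV : V ≠ A := fun e => hC.notMem l hlC (e ▸ hVl)
  have hAk : A ∉ k := fun hAk => hmk (line_unique hAV hVm hAm hVk hAk)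
  have hkC := hC.maximal_mem (by omega) hAk
  obtain rfl := (hC.tight_maximal hA hAm hm).2 V hV hAV hVm l hlC k hkC hVl hVk
  omega

lemma HasCovers.users_of_meet (h : HasCovers L 4 X) (hm : (nodesOn X m).card = 5)
    (hk : (nodesOn X k).card = 5) (hmk : m ≠ k) (hl : (nodesOn X l).card = 4) (hV : V ∈ X)
    (hVl : V ∈ l) (hVm : V ∈ m) (hVk : V ∈ k) :
    users X l = nodesOff (nodesOff (nodesOff X m) k) l := by
  obtain ⟨h1, h2⟩ := card_nodesOn_of_meet hm hk hmk hl hV hVl hVm hVk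
  ext A
  simp only [mem_users, mem_nodesOff]
  constructor
  · rintro ⟨hA, C, hC, hlC⟩
    exact ⟨⟨⟨hA, hC.notMem_of_meet hlC hm hk hmk hl hA hV hVl hVm hVk⟩,
      hC.notMem_of_meet hlC hk hm hmk.symm hl hA hV hVl hVk hVm⟩, hC.notMem l hlC⟩
  · rintro ⟨⟨⟨hA, hAm⟩, hAk⟩, hAl⟩
    obtain ⟨C, hC⟩ := h A hA
    have hC1 := hC.erase (n := 3) (hC.maximal_mem (by omega) hAm)
    have hC2 := hC1.erase (n := 2) (hC1.maximal_mem (by omega) hAk)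
    have := hC2.maximal_mem (m := l) (by omega) hAl
    exact ⟨hA, C, hC, Finset.mem_of_mem_erase (Finset.mem_of_mem_erase this)⟩

end Meet

end UseSets

end LinearSpace

section Oscillation

open scoped Classical

variable {P : Type*} {W : Finset P} {a b c : P → ℝ}

lemma exists_sum_fiber (hW : W.card = 12)
    (ha : ∀ Q ∈ W, (W.filter fun q => a q = a Q).card = 3)
    (hb : ∀ Q ∈ W, (W.filter fun q => b q = b Q).card = 3)
    (hab : ∀ p ∈ W, ∀ q ∈ W, a p = a q → b p = b q → p = q) (g : P → ℝ)
    (hg : ∀ p ∈ W, ∀ q ∈ W, b p = b q → g p = g q) {Q : P} (hQ : Q ∈ W) :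
    ∃ m ∈ W, ∑ q ∈ W, g q = 3 * ∑ q ∈ W with a q = a Q, g q + 3 * g m := by
  set S := W.filter fun q => a q = a Q with hS
  set U := S.biUnion fun s => W.filter fun q => b q = b s with hU
  have hSW : S ⊆ W := Finset.filter_subset _ _
  have hUW : U ⊆ W := Finset.biUnion_subset.2 fun s _ => Finset.filter_subset _ _
  have hdisj : (S : Set P).PairwiseDisjoint fun s => W.filter fun q => b q = b s := by
    intro s hs t ht hst
    refine Finset.disjoint_left.2 fun q hq hq' => hst ?_
    simp only [Finset.mem_filter, hS, Finset.coe_filter, Set.mem_ofPred_eq] at hq hq' hs ht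
    exact hab s hs.1 t ht.1 (hs.2.trans ht.2.symm) (hq.2.symm.trans hq'.2)
  have hUc : U.card = 9 := by
    rw [Finset.card_biUnion hdisj, Finset.sum_congr rfl fun s hs => hb s (hSW hs),
      Finset.sum_const, ha Q hQ, smul_eq_mul]
  have hWU : (W \ U).card = 3 := by rw [Finset.card_sdiff_of_subset hUW]; omega
  obtain ⟨m, hm⟩ : (W \ U).Nonempty := Finset.card_pos.1 (by omega)
  have hm' := Finset.mem_sdiff.1 hm
  have hmU : (W.filter fun q => b q = b m) = W \ U := by
    refine Finset.eq_of_subset_of_card_le (fun q hq => ?_) (by rw [hb m hm'.1, hWU])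
    rw [Finset.mem_filter] at hq
    refine Finset.mem_sdiff.2 ⟨hq.1, fun hqU => hm'.2 ?_⟩
    simp only [hU, Finset.mem_biUnion, Finset.mem_filter] at hqU ⊢
    obtain ⟨s, hs, -, hqs⟩ := hqU
    exact ⟨s, hs, hm'.1, hq.2.symm.trans hqs⟩
  have hfib : ∀ s ∈ W, ∑ q ∈ W with b q = b s, g q = 3 * g s := by
    intro s hs
    rw [Finset.sum_congr rfl fun q hq => hg q (Finset.mem_filter.1 hq).1 s hs
      (Finset.mem_filter.1 hq).2, Finset.sum_const, hb s hs]
    simp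
  refine ⟨m, hm'.1, ?_⟩
  rw [← Finset.sum_sdiff hUW, ← hmU, hfib m hm'.1, Finset.sum_biUnion hdisj,
    Finset.sum_congr rfl fun s hs => hfib s (hSW hs), ← Finset.mul_sum]
  ring

lemma three_mul_sub_le (hW : W.card = 12)
    (ha : ∀ Q ∈ W, (W.filter fun q => a q = a Q).card = 3)
    (hb : ∀ Q ∈ W, (W.filter fun q => b q = b Q).card = 3)
    (hc : ∀ Q ∈ W, (W.filter fun q => c q = c Q).card = 3)
    (hab : ∀ p ∈ W, ∀ q ∈ W, a p = a q → b p = b q → p = q)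
    (hac : ∀ p ∈ W, ∀ q ∈ W, a p = a q → c p = c q → p = q) {f g h : P → ℝ}
    (hf : ∀ p ∈ W, ∀ q ∈ W, a p = a q → f p = f q)
    (hg : ∀ p ∈ W, ∀ q ∈ W, b p = b q → g p = g q)
    (hh : ∀ p ∈ W, ∀ q ∈ W, c p = c q → h p = h q) (hfgh : ∀ p ∈ W, f p + g p + h p = 0)
    {G H : ℝ} (hG : ∀ p ∈ W, ∀ q ∈ W, g p - g q ≤ G) (hH : ∀ p ∈ W, ∀ q ∈ W, h p - h q ≤ H)
    {p q : P} (hp : p ∈ W) (hq : q ∈ W) : 3 * (f p - f q) ≤ G + H := by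
  have key : ∀ Q ∈ W, ∃ m ∈ W, ∃ k ∈ W,
      9 * f Q = 3 * g m + 3 * h k - ∑ x ∈ W, g x - ∑ x ∈ W, h x := by
    intro Q hQ
    obtain ⟨m, hm, h1⟩ := exists_sum_fiber hW ha hb hab g hg hQ
    obtain ⟨k, hk, h2⟩ := exists_sum_fiber hW ha hc hac h hh hQ
    refine ⟨m, hm, k, hk, ?_⟩
    have h3 : ∑ x ∈ W with a x = a Q, (f x + g x + h x) = 0 :=
      Finset.sum_eq_zero fun x hx => hfgh x (Finset.mem_filter.1 hx).1
    have h4 : ∑ x ∈ W with a x = a Q, f x = 3 * f Q := by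
      rw [Finset.sum_congr rfl fun x hx => hf x (Finset.mem_filter.1 hx).1 Q hQ
        (Finset.mem_filter.1 hx).2, Finset.sum_const, ha Q hQ]
      simp
    rw [Finset.sum_add_distrib, Finset.sum_add_distrib, h4] at h3
    linarith
  obtain ⟨m, hm, k, hk, h1⟩ := key p hp
  obtain ⟨m', hm', k', hk', h2⟩ := key q hq
  have := hG m hm m' hm'
  have := hH k hk k' hk'
  linarith

lemma exists_oscillation (hW : W.Nonempty) (f : P → ℝ) :
    ∃ p ∈ W, ∃ q ∈ W, ∀ p' ∈ W, ∀ q' ∈ W, f p' - f q' ≤ f p - f q := by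
  obtain ⟨p, hp, h1⟩ := W.exists_max_image f hW
  obtain ⟨q, hq, h2⟩ := W.exists_min_image f hW
  exact ⟨p, hp, q, hq, fun p' hp' q' hq' => by linarith [h1 p' hp', h2 q' hq']⟩

lemma false_of_fibers (hW : W.card = 12) (habc : ∀ p ∈ W, a p * b p * c p = 1)
    (ha : ∀ Q ∈ W, (W.filter fun q => a q = a Q).card = 3)
    (hb : ∀ Q ∈ W, (W.filter fun q => b q = b Q).card = 3)
    (hc : ∀ Q ∈ W, (W.filter fun q => c q = c Q).card = 3)
    (hab : ∀ p ∈ W, ∀ q ∈ W, a p = a q → b p = b q → p = q) : False := by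
  have hne : ∀ p ∈ W, a p ≠ 0 ∧ b p ≠ 0 ∧ c p ≠ 0 := fun p hp =>
    ⟨fun h => by simpa [h] using habc p hp, fun h => by simpa [h] using habc p hp,
      fun h => by simpa [h] using habc p hp⟩
  have hac : ∀ p ∈ W, ∀ q ∈ W, a p = a q → c p = c q → p = q := by
    intro p hp q hq h1 h2
    refine hab p hp q hq h1 ?_
    have h3 := habc p hp
    have h4 := habc q hq
    rw [h1, h2] at h3
    have := hne q hq
    exact mul_left_cancel₀ (mul_ne_zero this.1 this.2.2) (by linear_combination h3 - h4)
  have hbc : ∀ p ∈ W, ∀ q ∈ W, b p = b q → c p = c q → p = q := by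
    intro p hp q hq h1 h2
    refine hab p hp q hq ?_ h1
    have h3 := habc p hp
    have h4 := habc q hq
    rw [h1, h2] at h3
    have := hne q hq
    exact mul_left_cancel₀ (mul_ne_zero this.2.1 this.2.2) (by linear_combination h3 - h4)
  have hsum : ∀ p ∈ W, Real.log (a p) + Real.log (b p) + Real.log (c p) = 0 := by
    intro p hp
    obtain ⟨h1, h2, h3⟩ := hne p hp
    rw [← Real.log_mul h1 h2, ← Real.log_mul (mul_ne_zero h1 h2) h3, habc p hp, Real.log_one]
  have hW0 : W.Nonempty := Finset.card_pos.1 (by omega)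
  obtain ⟨p₁, hp₁, q₁, hq₁, h1⟩ := exists_oscillation hW0 fun p => Real.log (a p)
  obtain ⟨p₂, hp₂, q₂, hq₂, h2⟩ := exists_oscillation hW0 fun p => Real.log (b p)
  obtain ⟨p₃, hp₃, q₃, hq₃, h3⟩ := exists_oscillation hW0 fun p => Real.log (c p)
  have e : ∀ d : P → ℝ, ∀ p ∈ W, ∀ q ∈ W, d p = d q → Real.log (d p) = Real.log (d q) :=
    fun d p _ q _ h => by rw [h]
  have k1 := three_mul_sub_le hW ha hb hc hab hac (e a) (e b) (e c) hsum h2 h3 hp₁ hq₁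
  have k2 := three_mul_sub_le hW hb ha hc (fun p hp q hq h h' => hab p hp q hq h' h) hbc (e b) (e a)
    (e c) (fun p hp => by linarith [hsum p hp]) h1 h3 hp₂ hq₂
  have k3 := three_mul_sub_le hW hc ha hb (fun p hp q hq h h' => hac p hp q hq h' h)
    (fun p hp q hq h h' => hbc p hp q hq h' h) (e c) (e a)
    (e b) (fun p hp => by linarith [hsum p hp]) h1 h2 hp₃ hq₃
  have z1 := h1 p₁ hp₁ p₁ hp₁
  have z2 := h2 p₁ hp₁ p₁ hp₁
  have z3 := h3 p₁ hp₁ p₁ hp₁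
  have hconst : ∀ p ∈ W, Real.log (a p) = Real.log (a p₁) := by
    intro p hp
    have := h1 p hp p₁ hp₁
    have := h1 p₁ hp₁ p hp
    simp only [sub_self] at *
    linarith
  have hcov : W ⊆ (W.filter fun q => a q = a p₁) ∪ W.filter fun q => a q = - a p₁ := by
    intro p hp
    have h4 : |a p| = |a p₁| := Real.log_injOn_pos (abs_pos.2 (hne p hp).1)
      (abs_pos.2 (hne p₁ hp₁).1) (by rw [Real.log_abs, Real.log_abs, hconst p hp])
    rcases abs_eq_abs.1 h4 with h5 | h5
    · exact Finset.mem_union_left _ (by simp [hp, h5])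
    · exact Finset.mem_union_right _ (by simp [hp, h5])
  have h4 := (Finset.card_le_card hcov).trans (Finset.card_union_le _ _)
  have h5 : (W.filter fun q => a q = - a p₁).card ≤ 3 := by
    rcases (W.filter fun q => a q = - a p₁).eq_empty_or_nonempty with h0 | ⟨q, hq⟩
    · simp [h0]
    · rw [Finset.mem_filter] at hq
      rw [← hq.2, ha q hq.1]
  rw [ha p₁ hp₁] at h4
  omega

end Oscillation

/-! ### Lines of the plane -/

section Plane

open scoped Classical

lemma finsupp_cases_of_degree_le_one {m : Fin 2 →₀ ℕ} (hm : (m.sum fun _ e => e) ≤ 1) :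
    m = 0 ∨ m = Finsupp.single 0 1 ∨ m = Finsupp.single 1 1 := by
  rw [Finsupp.sum_fintype _ _ (by simp), Fin.sum_univ_two] at hm
  have h : ∀ m' : Fin 2 →₀ ℕ, m 0 = m' 0 → m 1 = m' 1 → m = m' := fun m' h0 h1 => by
    ext i; fin_cases i <;> assumption
  have : (m 0 = 0 ∧ m 1 = 0) ∨ (m 0 = 1 ∧ m 1 = 0) ∨ (m 0 = 0 ∧ m 1 = 1) := by omega
  rcases this with ⟨h0, h1⟩ | ⟨h0, h1⟩ | ⟨h0, h1⟩
  · exact .inl (h _ (by simp [h0]) (by simp [h1]))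
  · exact .inr (.inl (h _ (by simp [h0]) (by simp [h1])))
  · exact .inr (.inr (h _ (by simp [h0]) (by simp [h1])))

lemma eq_linear_of_totalDegree_le_one {f : BPoly} (hf : f.totalDegree ≤ 1) :
    ∃ a b c : ℝ, f = C a * X 0 + C b * X 1 + C c := by
  refine ⟨coeff (Finsupp.single 0 1) f, coeff (Finsupp.single 1 1) f, coeff 0 f, ?_⟩
  ext m
  by_cases hm : (m.sum fun _ e => e) ≤ 1
  · rcases finsupp_cases_of_degree_le_one hm with rfl | rfl | rfl <;>
      simp [coeff_X, coeff_C, Finsupp.single_eq_single_iff, eq_comm (a := (0 : Fin 2 →₀ ℕ))]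
  · rw [coeff_eq_zero_of_totalDegree_lt (by
      simpa [Finsupp.sum] using lt_of_le_of_lt hf (not_le.1 hm))]
    have h0 : (0 : Fin 2 →₀ ℕ) ≠ m := by rintro rfl; simp at hm
    have h1 : ∀ i : Fin 2, Finsupp.single i 1 ≠ m := by rintro i rfl; simp at hm
    simp [coeff_X, coeff_C, h0, h1]

lemma totalDegree_linear {a b : ℝ} (c : ℝ) (h : a ≠ 0 ∨ b ≠ 0) :
    (C a * X 0 + C b * X 1 + C c : BPoly).totalDegree = 1 := by
  apply le_antisymm
  · refine (totalDegree_add _ _).trans (max_le ((totalDegree_add _ _).trans (max_le ?_ ?_)) ?_)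
    · exact (totalDegree_mul _ _).trans (by simp)
    · exact (totalDegree_mul _ _).trans (by simp)
    · simp
  · by_contra! h0
    have h1 := totalDegree_eq_zero_iff_eq_C.1 (Nat.lt_one_iff.1 h0)
    have e0 := congrArg (coeff (Finsupp.single 0 1)) h1
    have e1 := congrArg (coeff (Finsupp.single 1 1)) h1
    simp [coeff_X, coeff_C, Finsupp.single_eq_single_iff, eq_comm (a := (0 : Fin 2 →₀ ℕ))] at e0 e1
    tauto

lemma eq_linear_of_totalDegree_eq_one {f : BPoly} (hf : f.totalDegree = 1) :
    ∃ a b c : ℝ, (a ≠ 0 ∨ b ≠ 0) ∧ f = C a * X 0 + C b * X 1 + C c := by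
  obtain ⟨a, b, c, rfl⟩ := eq_linear_of_totalDegree_le_one hf.le
  refine ⟨a, b, c, ?_, rfl⟩
  by_contra! h
  simp [h.1, h.2] at hf

lemma isLine_iff {l : Set Pt} :
    IsLine l ↔ ∃ a b c : ℝ, (a ≠ 0 ∨ b ≠ 0) ∧ l = {x : Pt | a * x 0 + b * x 1 + c = 0} := by
  constructor
  · rintro ⟨f, hf, rfl⟩
    obtain ⟨a, b, c, h, rfl⟩ := eq_linear_of_totalDegree_eq_one hf
    exact ⟨a, b, c, h, by ext x; simp⟩
  · rintro ⟨a, b, c, h, rfl⟩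
    exact ⟨_, totalDegree_linear c h, by ext x; simp⟩

/-- The lines of the plane. -/
def PlaneLine : Type := {l : Set Pt // IsLine l}

instance : Membership Pt PlaneLine := ⟨fun l p => p ∈ l.1⟩

lemma PlaneLine.exists_coeff (l : PlaneLine) :
    ∃ a b c : ℝ, (a ≠ 0 ∨ b ≠ 0) ∧ ∀ x : Pt, x ∈ l ↔ a * x 0 + b * x 1 + c = 0 := by
  obtain ⟨a, b, c, hab, h⟩ := isLine_iff.1 l.2
  exact ⟨a, b, c, hab, fun x => Set.ext_iff.1 h x⟩

lemma exists_planeLine {a b : ℝ} (c : ℝ) (h : a ≠ 0 ∨ b ≠ 0) :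
    ∃ l : PlaneLine, ∀ x : Pt, x ∈ l ↔ a * x 0 + b * x 1 + c = 0 :=
  ⟨⟨_, isLine_iff.2 ⟨a, b, c, h, rfl⟩⟩, fun _ => Iff.rfl⟩

/-- Twice the signed area of a triangle. -/
def orient (A B C : Pt) : ℝ := (B 0 - A 0) * (C 1 - A 1) - (B 1 - A 1) * (C 0 - A 0)

lemma pt_ext {A B : Pt} (h0 : A 0 = B 0) (h1 : A 1 = B 1) : A = B := by
  ext i; fin_cases i <;> assumption

lemma PlaneLine.mem_iff_orient {l : PlaneLine} {A B C : Pt} (hAB : A ≠ B) (hA : A ∈ l)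
    (hB : B ∈ l) : C ∈ l ↔ orient A B C = 0 := by
  obtain ⟨a, b, c, hab, hl⟩ := l.exists_coeff
  rw [hl] at hA hB ⊢
  simp only [orient]
  constructor
  · intro hC
    rcases hab with h | h
    · exact mul_left_cancel₀ h (by linear_combination (C 1 - A 1) * (hB - hA) - (B 1 - A 1) * (hC - hA))
    · exact mul_left_cancel₀ h (by linear_combination (B 0 - A 0) * (hC - hA) - (C 0 - A 0) * (hB - hA))
  · intro h
    have h0 : (B 0 - A 0) * (a * C 0 + b * C 1 + c) = 0 := by
      linear_combination (B 0 - A 0) * hA + (C 0 - A 0) * (hB - hA) + b * h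
    have h1 : (B 1 - A 1) * (a * C 0 + b * C 1 + c) = 0 := by
      linear_combination (B 1 - A 1) * hA + (C 1 - A 1) * (hB - hA) - a * h
    rcases mul_eq_zero.1 h0 with h0 | h0
    · rcases mul_eq_zero.1 h1 with h1 | h1
      · exact absurd (pt_ext (by linarith) (by linarith)) hAB
      · exact h1
    · exact h0

lemma exists_planeLine_through {p q : Pt} (h : p ≠ q) : ∃ l : PlaneLine, p ∈ l ∧ q ∈ l := by
  obtain ⟨l, hl⟩ := exists_planeLine (a := q 1 - p 1) (b := p 0 - q 0) (q 0 * p 1 - p 0 * q 1) <| by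
    by_contra! hc
    exact h (pt_ext (by linarith) (by linarith))
  exact ⟨l, (hl p).2 (by ring), (hl q).2 (by ring)⟩

lemma exists_planeLine_notMem (p : Pt) : ∃ l : PlaneLine, p ∉ l := by
  obtain ⟨l, hl⟩ := exists_planeLine (a := 1) (b := 0) (1 - p 0) (by simp)
  exact ⟨l, by simp [hl]⟩

noncomputable instance : Configuration.HasLines Pt PlaneLine where
  exists_point l := by
    obtain ⟨a, b, c, hab, hl⟩ := l.exists_coeff
    by_contra! h
    simp only [hl] at h
    have h0 := h ![0, 0]
    have h1 := h ![1, 0]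
    have h2 := h ![0, 1]
    simp at h0 h1 h2
    subst h0
    simp_all
  exists_line := exists_planeLine_notMem
  eq_or_eq {p q l m} hpl hql hpm hqm := by
    by_contra! h
    refine h.2 (Subtype.ext (Set.ext fun x => ?_))
    exact (PlaneLine.mem_iff_orient h.1 hpl hql).trans
      (PlaneLine.mem_iff_orient h.1 hpm hqm).symm
  mkLine h := (exists_planeLine_through h).choose
  mkLine_ax h := (exists_planeLine_through h).choose_spec

end Plane

section PlaneCovers

open scoped Classical

lemma orient_mul_sub (A B C p q : Pt) :
    orient p C A * orient q A B - orient q C A * orient p A B =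
      -orient A B C * orient A q p := by
  simp only [orient]; ring

/-- A planar set of `15` points in which every point has a cover by four lines has a
`5`-point line. -/
lemma exists_card_nodesOn_eq_five {X : Finset Pt} (h : HasCovers PlaneLine 4 X)
    (hX : X.card = 15) : ∃ m : PlaneLine, (nodesOn X m).card = 5 := by
  by_contra! hcon
  have h4 : ∀ m : PlaneLine, (nodesOn X m).card ≤ 4 := fun m => by
    have := h.card_nodesOn_le m
    have := hcon m
    omega
  obtain ⟨A, B, C, ⟨hA, hB, hC⟩, ⟨hAB, hAC, hBC⟩, hABC, hlines⟩ := h.exists_triangle hX h4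
  set W := ((X.erase A).erase B).erase C with hW
  have memW : ∀ p, p ∈ W ↔ p ∈ X ∧ p ≠ A ∧ p ≠ B ∧ p ≠ C := fun p => by
    simp only [hW, Finset.mem_erase]; tauto
  have hWc : W.card = 12 := by
    rw [hW, Finset.card_erase_of_mem (by simp [hBC.symm, hAC.symm, hC]),
      Finset.card_erase_of_mem (by simp [hAB.symm, hB]), Finset.card_erase_of_mem hA, hX]
  have hD : orient A B C ≠ 0 := by
    obtain ⟨l, hl, hl'⟩ := exists_line_through PlaneLine hAB
    rw [Ne, ← PlaneLine.mem_iff_orient hAB hl hl']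
    exact hABC l hl hl'
  have hD' : orient B C A ≠ 0 := by
    have : orient B C A = orient A B C := by simp only [orient]; ring
    rwa [this]
  have hD'' : orient C A B ≠ 0 := by
    have : orient C A B = orient A B C := by simp only [orient]; ring
    rwa [this]
  have hne : ∀ p ∈ W, orient p B C ≠ 0 ∧ orient p C A ≠ 0 ∧ orient p A B ≠ 0 := by
    intro p hp
    obtain ⟨hpX, hpA, hpB, hpC⟩ := (memW p).1 hp
    refine ⟨fun h0 => ?_, fun h0 => ?_, fun h0 => ?_⟩
    · obtain ⟨l, hl, hl'⟩ := exists_line_through PlaneLine hpB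
      exact (hlines p hpX hpA hpB hpC l hl).1.2.1 hl' ((PlaneLine.mem_iff_orient hpB hl hl').2 h0)
    · obtain ⟨l, hl, hl'⟩ := exists_line_through PlaneLine hpC
      exact (hlines p hpX hpA hpB hpC l hl).1.2.2 hl' ((PlaneLine.mem_iff_orient hpC hl hl').2 h0)
    · obtain ⟨l, hl, hl'⟩ := exists_line_through PlaneLine hpA
      exact (hlines p hpX hpA hpB hpC l hl).1.1 hl' ((PlaneLine.mem_iff_orient hpA hl hl').2 h0)
  have fiber : ∀ {A B C : Pt}, A ∈ X → orient A B C ≠ 0 → (∀ p ∈ W, p ≠ A ∧ orient p A B ≠ 0) →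
      (∀ p, p ∈ W ↔ p ∈ X ∧ p ≠ A ∧ p ≠ B ∧ p ≠ C) →
      (∀ p ∈ W, ∀ l : PlaneLine, p ∈ l → A ∈ l → B ∉ l ∧ C ∉ l ∧ (nodesOn X l).card = 4) →
      (∀ p ∈ W, ∀ q ∈ W, orient p C A / orient p A B = orient q C A / orient q A B →
        ∀ l : PlaneLine, A ∈ l → q ∈ l → p ∈ l) ∧
      ∀ q ∈ W, (W.filter fun p =>
        orient p C A / orient p A B = orient q C A / orient q A B).card = 3 := by
    intro A B C hA hD hne memW hl
    have key : ∀ p ∈ W, ∀ q ∈ W, ∀ l : PlaneLine, A ∈ l → q ∈ l →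
        (orient p C A / orient p A B = orient q C A / orient q A B ↔ p ∈ l) := by
      intro p hp q hq l hAl hql
      rw [div_eq_div_iff (hne p hp).2 (hne q hq).2, ← sub_eq_zero, orient_mul_sub,
        mul_eq_zero, or_iff_right (neg_ne_zero.2 hD), PlaneLine.mem_iff_orient (hne q hq).1.symm hAl hql]
    refine ⟨fun p hp q hq h l hAl hql => (key p hp q hq l hAl hql).1 h, fun q hq => ?_⟩
    obtain ⟨l, hql, hAl⟩ := exists_line_through PlaneLine (hne q hq).1
    obtain ⟨hBl, hCl, hc⟩ := hl q hq l hql hAl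
    have : (W.filter fun p =>
        orient p C A / orient p A B = orient q C A / orient q A B) = (nodesOn X l).erase A := by
      ext p
      simp only [Finset.mem_filter, Finset.mem_erase, mem_nodesOn]
      constructor
      · rintro ⟨hp, h⟩
        exact ⟨(hne p hp).1, ((memW p).1 hp).1, (key p hp q hq l hAl hql).1 h⟩
      · rintro ⟨hpA, hp, hpl⟩
        have hpW : p ∈ W := (memW p).2 ⟨hp, hpA, by rintro rfl; exact hBl hpl,
          by rintro rfl; exact hCl hpl⟩
        exact ⟨hpW, (key p hpW q hq l hAl hql).2 hpl⟩
    rw [this, Finset.card_erase_of_mem (by simp [hA, hAl]), hc]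
  have hl : ∀ p ∈ W, ∀ l : PlaneLine, p ∈ l → _ := fun p hp =>
    hlines p ((memW p).1 hp).1 ((memW p).1 hp).2.1 ((memW p).1 hp).2.2.1 ((memW p).1 hp).2.2.2
  have fA := fiber hA hD (fun p hp => ⟨((memW p).1 hp).2.1, (hne p hp).2.2⟩) memW
    fun p hp l hpl hAl => ⟨(hl p hp l hpl).1.1 hAl, fun h => (hl p hp l hpl).1.2.2 h hAl,
      (hl p hp l hpl).2 (.inl hAl)⟩
  have fB := fiber hB hD' (fun p hp => ⟨((memW p).1 hp).2.2.1, (hne p hp).1⟩)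
    (fun p => (memW p).trans (by tauto))
    fun p hp l hpl hBl => ⟨(hl p hp l hpl).1.2.1 hBl, fun h => (hl p hp l hpl).1.1 h hBl,
      (hl p hp l hpl).2 (.inr (.inl hBl))⟩
  have fC := fiber hC hD'' (fun p hp => ⟨((memW p).1 hp).2.2.2, (hne p hp).2.1⟩)
    (fun p => (memW p).trans (by tauto))
    fun p hp l hpl hCl => ⟨(hl p hp l hpl).1.2.2 hCl, fun h => (hl p hp l hpl).1.2.1 h hCl,
      (hl p hp l hpl).2 (.inr (.inr hCl))⟩
  refine false_of_fibers (W := W) (a := fun p => orient p C A / orient p A B)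
    (b := fun p => orient p A B / orient p B C) (c := fun p => orient p B C / orient p C A) hWc
    (fun p hp => ?_) fA.2 fB.2 fC.2 fun p hp q hq h1 h2 => ?_
  · obtain ⟨h1, h2, h3⟩ := hne p hp
    field_simp
  · by_contra hpq
    obtain ⟨l, hpl, hAl⟩ := exists_line_through PlaneLine ((memW p).1 hp).2.1
    obtain ⟨m, hpm, hBm⟩ := exists_line_through PlaneLine ((memW p).1 hp).2.2.1
    have hql := fA.1 q hq p hp h1.symm l hAl hpl
    have hqm := fB.1 q hq p hp h2.symm m hBm hpm
    obtain rfl := line_unique hpq hpl hql hpm hqm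
    exact (hl p hp l hpl).1.1 hAl hBm

end PlaneCovers

/-! ### Fundamental polynomials and covers -/

section Translation

open scoped Classical

namespace PlaneLine

/-- A polynomial of degree one whose zero set is the line `l`. -/
noncomputable def poly (l : PlaneLine) : BPoly := l.2.choose

lemma totalDegree_poly (l : PlaneLine) : l.poly.totalDegree = 1 := l.2.choose_spec.1

lemma mem_val {l : PlaneLine} {x : Pt} : x ∈ l.1 ↔ x ∈ l := Iff.rfl

lemma coe_eq (l : PlaneLine) : l.1 = {x : Pt | eval x l.poly = 0} := l.2.choose_spec.2

lemma eval_poly_eq_zero {l : PlaneLine} {x : Pt} : eval x l.poly = 0 ↔ x ∈ l :=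
  (Set.ext_iff.1 l.coe_eq x).symm

lemma poly_ne_zero (l : PlaneLine) : l.poly ≠ 0 := fun h => by
  have := l.totalDegree_poly
  simp [h] at this

lemma infinite (l : PlaneLine) : {x : Pt | x ∈ l}.Infinite := by
  obtain ⟨a, b, c, hab, hl⟩ := l.exists_coeff
  have hpos : a ^ 2 + b ^ 2 ≠ 0 := fun h => by
    rcases hab with h0 | h0 <;> exact absurd h (by positivity)
  refine Set.infinite_of_injective_forall_mem
    (f := fun t : ℝ => ![-(a * c) / (a ^ 2 + b ^ 2) - t * b, -(b * c) / (a ^ 2 + b ^ 2) + t * a])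
    (fun s t hst => ?_) fun t => ?_
  · have h0 := congrFun hst 0
    have h1 := congrFun hst 1
    simp at h0 h1
    rcases hab with h | h
    · exact h1.resolve_right h
    · exact h0.resolve_right h
  · simp only [Set.mem_ofPred_eq, hl, Matrix.cons_val_zero, Matrix.cons_val_one]
    field_simp
    ring

end PlaneLine

variable {n : ℕ} {X : Finset Pt} {A : Pt}

lemma exists_isCover_of_isFund {f : Fin n → BPoly} (hf : ∀ i, (f i).totalDegree = 1)
    (hA : IsFund n X A (∏ i, f i)) :
    ∃ C : Finset PlaneLine, IsCover n X A C ∧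
      ∀ x, eval x (∏ i, f i) = 0 → ∃ l ∈ C, x ∈ l := by
  let g : Fin n → PlaneLine := fun i => ⟨{x | eval x (f i) = 0}, f i, hf i, rfl⟩
  have hx : ∀ x, eval x (∏ i, f i) = 0 → ∃ l ∈ Finset.univ.image g, x ∈ l := fun x hx => by
    rw [map_prod, Finset.prod_eq_zero_iff] at hx
    obtain ⟨i, -, hi⟩ := hx
    exact ⟨g i, Finset.mem_image_of_mem _ (Finset.mem_univ i), hi⟩
  refine ⟨Finset.univ.image g, ⟨?_, ?_, ?_⟩, hx⟩
  · exact Finset.card_image_le.trans (by simp)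
  · rintro l hl hAl
    obtain ⟨i, -, rfl⟩ := Finset.mem_image.1 hl
    have h1 := hA.2.1
    rw [map_prod, Finset.prod_eq_zero (Finset.mem_univ i) (show eval A (f i) = 0 from hAl)] at h1
    exact zero_ne_one h1
  · exact fun B hB hBA => hx B (hA.2.2 B hB hBA)

lemma IsCover.exists_isFund {C : Finset PlaneLine} (hC : IsCover n X A C) :
    ∃ f : Fin n → BPoly, (∀ i, (f i).totalDegree = 1) ∧ IsFund n X A (∏ i, f i) ∧
      ∀ l ∈ C, ∃ i, l.1 = {x : Pt | eval x (f i) = 0} := by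
  obtain ⟨l₀, hl₀⟩ := exists_planeLine_notMem A
  obtain ⟨g, hgA, hgC⟩ : ∃ g : Fin n → PlaneLine, (∀ i, A ∉ g i) ∧ ∀ l ∈ C, ∃ i, g i = l := by
    refine ⟨fun i => if h : i.1 < C.card then C.equivFin.symm ⟨i, h⟩ else l₀, fun i => ?_,
      fun l hl => ⟨⟨C.equivFin ⟨l, hl⟩, (C.equivFin ⟨l, hl⟩).2.trans_le hC.card_le⟩, ?_⟩⟩
    · dsimp only
      split_ifs with h
      · exact hC.notMem _ (C.equivFin.symm ⟨i, h⟩).2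
      · exact hl₀
    · simp
  have hne : ∀ i, eval A (g i).poly ≠ 0 := fun i h => hgA i (PlaneLine.eval_poly_eq_zero.1 h)
  have hdeg : ∀ i, (MvPolynomial.C (eval A (g i).poly)⁻¹ * (g i).poly).totalDegree = 1 := fun i => by
    rw [totalDegree_mul_of_isDomain (by simpa using hne i) (g i).poly_ne_zero, totalDegree_C,
      PlaneLine.totalDegree_poly]
  refine ⟨fun i => MvPolynomial.C (eval A (g i).poly)⁻¹ * (g i).poly, hdeg, ⟨?_, ?_, ?_⟩, ?_⟩
  · refine (totalDegree_finsetProd _ _).trans ?_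
    simp [hdeg]
  · rw [map_prod]
    exact Finset.prod_eq_one fun i _ => by simp [hne i]
  · intro B hB hBA
    obtain ⟨l, hl, hBl⟩ := hC.exists_mem B hB hBA
    obtain ⟨i, rfl⟩ := hgC l hl
    rw [map_prod]
    exact Finset.prod_eq_zero (Finset.mem_univ i) (by simp [PlaneLine.eval_poly_eq_zero.2 hBl])
  · intro l hl
    obtain ⟨i, rfl⟩ := hgC l hl
    refine ⟨i, ?_⟩
    rw [PlaneLine.coe_eq]
    ext x
    simp [hne i]

lemma IsGC.hasCovers (h : IsGC n (X : Set Pt)) : HasCovers PlaneLine n X := fun A hA => by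
  obtain ⟨p, hp, f, hf, rfl⟩ := h.2 A hA
  obtain ⟨C, hC, -⟩ := exists_isCover_of_isFund hf hp
  exact ⟨C, hC⟩

lemma IsPoised.isFund_unique (h : IsPoised n (X : Set Pt)) {p q : BPoly} (hp : IsFund n X A p)
    (hq : IsFund n X A q) : p = q := by
  refine (h.2 fun B => if B = A then 1 else 0).unique ⟨hp.1, fun B hB => ?_⟩ ⟨hq.1, fun B hB => ?_⟩
  · split_ifs with hBA
    · exact hBA ▸ hp.2.1
    · exact hp.2.2 B hB hBA
  · split_ifs with hBA
    · exact hBA ▸ hq.2.1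
    · exact hq.2.2 B hB hBA

lemma IsPoised.eq_zero (h : IsPoised n (X : Set Pt)) {p : BPoly} (hp : p.totalDegree ≤ n)
    (h0 : ∀ B ∈ X, eval B p = 0) : p = 0 :=
  (h.2 fun _ => 0).unique ⟨hp, h0⟩ ⟨by simp, by simp⟩

lemma eq_zero_of_vanishes_nodesOff
    (h : ∀ p : BPoly, p.totalDegree ≤ n + 1 → (∀ B ∈ X, eval B p = 0) → p = 0) (m : PlaneLine)
    (p : BPoly) (hp : p.totalDegree ≤ n) (h0 : ∀ B ∈ nodesOff X m, eval B p = 0) : p = 0 := by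
  have := h (p * m.poly)
    ((totalDegree_mul _ _).trans (by rw [PlaneLine.totalDegree_poly]; omega)) fun B hB => by
      rw [map_mul]
      by_cases hBm : B ∈ m
      · rw [PlaneLine.eval_poly_eq_zero.2 hBm, mul_zero]
      · rw [h0 B (by simp [hB, hBm]), zero_mul]
  exact (mul_eq_zero.1 this).resolve_right m.poly_ne_zero

lemma HasCovers.isGC (h : HasCovers PlaneLine n X) (hX : X.card = (n + 1) * (n + 2) / 2)
    (h0 : ∀ p : BPoly, p.totalDegree ≤ n → (∀ B ∈ X, eval B p = 0) → p = 0) :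
    IsGC n (X : Set Pt) := by
  choose! C hC using h
  have hf : ∀ A ∈ X, ∃ f : Fin n → BPoly, (∀ i, (f i).totalDegree = 1) ∧ IsFund n X A (∏ i, f i) :=
    fun A hA => by
      obtain ⟨f, h1, h2, -⟩ := (hC A hA).exists_isFund
      exact ⟨f, h1, h2⟩
  choose! f hfd hff using hf
  refine ⟨⟨by rw [Set.ncard_coe_finset, hX], fun c => ?_⟩,
    fun A hA => ⟨_, hff A hA, f A, hfd A hA, rfl⟩⟩
  refine existsUnique_of_exists_of_unique
    ⟨∑ A ∈ X, MvPolynomial.C (c A) * ∏ i, f A i, ?_, fun B hB => ?_⟩ fun p q hp hq => ?_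
  · refine totalDegree_finsetSum_le fun A hA => (totalDegree_mul _ _).trans ?_
    have := (hff A hA).1
    simpa using this
  · rw [map_sum, Finset.sum_eq_single_of_mem B hB fun A hA hAB => by
      rw [map_mul, (hff A hA).2.2 B hB hAB.symm, mul_zero]]
    rw [map_mul, (hff B hB).2.1, eval_C, mul_one]
  · refine sub_eq_zero.1 (h0 _ ((totalDegree_sub _ _).trans (max_le hp.1 hq.1)) fun B hB => ?_)
    rw [map_sub, hp.2 B hB, hq.2 B hB, sub_self]

lemma IsGC.coe_users {X : Finset Pt} (h : IsGC 4 (X : Set Pt)) (l : PlaneLine) :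
    UseSet 4 (X : Set Pt) l.1 = users X l := by
  ext A
  rw [Finset.mem_coe, mem_users]
  refine and_congr_right fun hA => ⟨?_, ?_⟩
  · rintro ⟨p, f, hp, hf, hl, hfp⟩
    obtain ⟨q, hq, g, hg, rfl⟩ := h.2 A hA
    obtain rfl := h.1.isFund_unique hp hq
    obtain ⟨C, hC, hCx⟩ := exists_isCover_of_isFund hg hq
    refine ⟨C, hC, ?_⟩
    obtain ⟨S, hS, hS5⟩ := l.infinite.exists_subset_card_eq 5
    refine mem_of_covered (S := S) hS (fun x hx => hCx x ?_) (by have := hC.card_le; omega)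
    obtain ⟨r, hr⟩ := hfp
    have hxl : x ∈ l.1 := hS hx
    rw [hl] at hxl
    rw [hr, map_mul, show eval x f = 0 from hxl, zero_mul]
  · rintro ⟨C, hC, hlC⟩
    obtain ⟨f, hf, hp, hi⟩ := hC.exists_isFund
    obtain ⟨i, hi⟩ := hi l hlC
    exact ⟨_, f i, hp, hf i, hi, Finset.dvd_prod_of_mem f (Finset.mem_univ i)⟩

lemma IsGC.isGC_of_disjoint (h : IsGC 4 (X : Set Pt)) (hX : X.card = 15) {l m : PlaneLine}
    (hm : (nodesOn X m).card = 5) (hl : (nodesOn X l).card = 4)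
    (hdisj : ∀ p ∈ X, p ∈ m → p ∉ l) : IsGC 2 (nodesOff (nodesOff X m) l : Set Pt) :=
  (h.hasCovers.residual_of_disjoint hm hl hdisj).isGC
    (card_residual_of_disjoint hX hm hl hdisj)
    (eq_zero_of_vanishes_nodesOff (eq_zero_of_vanishes_nodesOff (fun _ => h.1.eq_zero) m) l)

lemma IsGC.isGC_of_meet (h : IsGC 4 (X : Set Pt)) (hX : X.card = 15) {l m k : PlaneLine}
    (hm : (nodesOn X m).card = 5) (hk : (nodesOn X k).card = 5) (hmk : m ≠ k)
    (hl : (nodesOn X l).card = 4) {V : Pt} (hV : V ∈ X) (hVl : V ∈ l) (hVm : V ∈ m)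
    (hVk : V ∈ k) : IsGC 1 (nodesOff (nodesOff (nodesOff X m) k) l : Set Pt) :=
  (h.hasCovers.residual_of_meet hm hk hmk hl hV hVl hVm hVk).isGC
    (card_residual_of_meet hX hm hk hmk hl hV hVl hVm hVk)
    (eq_zero_of_vanishes_nodesOff (eq_zero_of_vanishes_nodesOff
      (eq_zero_of_vanishes_nodesOff (fun _ => h.1.eq_zero) m) k) l)

lemma isNodeLine_coe {k : ℕ} {l : PlaneLine} :
    IsNodeLine k (X : Set Pt) l.1 ↔ (nodesOn X l).card = k := by
  have : (X : Set Pt) ∩ l.1 = nodesOn X l := by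
    ext p
    simp only [Finset.mem_coe, mem_nodesOn, Set.mem_inter_iff]
    exact Iff.rfl
  rw [IsNodeLine, this, Set.ncard_coe_finset]
  exact and_iff_right l.2

end Translation

/-- For a `GC_4` set `X` and a `4`-node line `ℓ`: `|X_ℓ| = 6` or `|X_ℓ| = 3`;
`|X_ℓ| = 6` iff there is a maximal line `M₀` with `M₀ ∩ ℓ ∩ X = ∅`, and then
`X_ℓ = X \ (ℓ ∪ M₀)` is a `GC_2` set; `|X_ℓ| = 3` iff there are two maximal lines `M'`, `M''`
meeting at a node of `X` on `ℓ`, and then `X_ℓ = X \ (ℓ ∪ M' ∪ M'')` is a `GC_1` set. -/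
theorem GC4_fourNodeLine_useSet (X ℓ : Set Pt) (hX : IsGC 4 X)
    (hℓ : IsNodeLine 4 X ℓ) :
    ((UseSet 4 X ℓ).ncard = 6 ∨ (UseSet 4 X ℓ).ncard = 3) ∧
    ((UseSet 4 X ℓ).ncard = 6 ↔
      ∃ M₀ : Set Pt, IsMaxLine 4 X M₀ ∧ M₀ ∩ ℓ ∩ X = ∅) ∧
    ((UseSet 4 X ℓ).ncard = 6 →
      ∃ M₀ : Set Pt, IsMaxLine 4 X M₀ ∧ M₀ ∩ ℓ ∩ X = ∅ ∧
        UseSet 4 X ℓ = X \ (ℓ ∪ M₀) ∧ IsGC 2 (UseSet 4 X ℓ)) ∧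
    ((UseSet 4 X ℓ).ncard = 3 ↔
      ∃ M' M'' : Set Pt, IsMaxLine 4 X M' ∧ IsMaxLine 4 X M'' ∧ M' ≠ M'' ∧
        ∃ A : Pt, A ∈ X ∧ A ∈ ℓ ∧ A ∈ M' ∧ A ∈ M'') ∧
    ((UseSet 4 X ℓ).ncard = 3 →
      ∃ M' M'' : Set Pt, IsMaxLine 4 X M' ∧ IsMaxLine 4 X M'' ∧ M' ≠ M'' ∧
        (∃ A : Pt, A ∈ X ∧ A ∈ ℓ ∧ A ∈ M' ∧ A ∈ M'') ∧
        UseSet 4 X ℓ = X \ (ℓ ∪ M' ∪ M'') ∧ IsGC 1 (UseSet 4 X ℓ)) := by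
  obtain ⟨X, rfl⟩ := (Set.finite_of_ncard_pos (by rw [hX.1.1]; norm_num)).exists_finset_coe
  obtain ⟨l, rfl⟩ : ∃ l : PlaneLine, l.1 = ℓ := ⟨⟨ℓ, hℓ.1⟩, rfl⟩
  have hc : X.card = 15 := by rw [← Set.ncard_coe_finset, hX.1.1]
  have hl := isNodeLine_coe.1 hℓ
  have h := hX.hasCovers
  rw [hX.coe_users l, Set.ncard_coe_finset]
  have h6 : ∀ M₀ : Set Pt, IsMaxLine 4 X M₀ → M₀ ∩ l.1 ∩ X = ∅ →
      (users X l).card = 6 ∧ (users X l : Set Pt) = (X : Set Pt) \ (l.1 ∪ M₀) ∧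
        IsGC 2 (users X l : Set Pt) := by
    intro M₀ hM h0
    obtain ⟨m, rfl⟩ : ∃ m : PlaneLine, m.1 = M₀ := ⟨⟨M₀, hM.1⟩, rfl⟩
    have hm := isNodeLine_coe.1 hM
    have hdisj : ∀ p ∈ X, p ∈ m → p ∉ l := fun p hp hpm hpl =>
      (Set.ext_iff.1 h0 p).1 ⟨⟨hpm, hpl⟩, hp⟩
    rw [h.users_of_disjoint hm hl hdisj]
    refine ⟨card_residual_of_disjoint hc hm hl hdisj, ?_, hX.isGC_of_disjoint hc hm hl hdisj⟩
    ext p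
    simp only [Finset.mem_coe, mem_nodesOff, Set.mem_sdiff, Set.mem_union, PlaneLine.mem_val]
    tauto
  have h3 : ∀ M' M'' : Set Pt, IsMaxLine 4 X M' → IsMaxLine 4 X M'' → M' ≠ M'' →
      (∃ A : Pt, A ∈ (X : Set Pt) ∧ A ∈ l.1 ∧ A ∈ M' ∧ A ∈ M'') →
      (users X l).card = 3 ∧ (users X l : Set Pt) = (X : Set Pt) \ (l.1 ∪ M' ∪ M'') ∧
        IsGC 1 (users X l : Set Pt) := by
    rintro M' M'' hM' hM'' hne ⟨A, hA, hAl, hA', hA''⟩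
    obtain ⟨m, rfl⟩ : ∃ m : PlaneLine, m.1 = M' := ⟨⟨M', hM'.1⟩, rfl⟩
    obtain ⟨k, rfl⟩ : ∃ k : PlaneLine, k.1 = M'' := ⟨⟨M'', hM''.1⟩, rfl⟩
    have hm := isNodeLine_coe.1 hM'
    have hk := isNodeLine_coe.1 hM''
    have hmk : m ≠ k := fun e => hne (congrArg Subtype.val e)
    rw [h.users_of_meet hm hk hmk hl hA hAl hA' hA'']
    refine ⟨card_residual_of_meet hc hm hk hmk hl hA hAl hA' hA'', ?_,
      hX.isGC_of_meet hc hm hk hmk hl hA hAl hA' hA''⟩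
    ext p
    simp only [Finset.mem_coe, mem_nodesOff, Set.mem_sdiff, Set.mem_union, PlaneLine.mem_val]
    tauto
  have hcases : (∃ M₀ : Set Pt, IsMaxLine 4 X M₀ ∧ M₀ ∩ l.1 ∩ X = ∅) ∨
      ∃ M' M'' : Set Pt, IsMaxLine 4 X M' ∧ IsMaxLine 4 X M'' ∧ M' ≠ M'' ∧
        ∃ A : Pt, A ∈ (X : Set Pt) ∧ A ∈ l.1 ∧ A ∈ M' ∧ A ∈ M'' := by
    obtain ⟨m, hm⟩ := exists_card_nodesOn_eq_five h hc
    rcases h.disjoint_or_meet hc (h.hasThreeLines_four hc hm) hl with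
      ⟨m, hm, hdisj⟩ | ⟨m, k, hmk, hm, hk, p, hp, hpl, hpm, hpk⟩
    · refine Or.inl ⟨m.1, isNodeLine_coe.2 hm, Set.eq_empty_iff_forall_notMem.2 ?_⟩
      rintro p ⟨⟨hpm, hpl⟩, hp⟩
      exact hdisj p hp hpm hpl
    · exact Or.inr ⟨m.1, k.1, isNodeLine_coe.2 hm, isNodeLine_coe.2 hk,
        fun e => hmk (Subtype.ext e), p, hp, hpl, hpm, hpk⟩
  rcases hcases with ⟨M₀, hM, h0⟩ | ⟨M', M'', hM', hM'', hne, hA⟩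
  · obtain ⟨hc6, hU, hG⟩ := h6 M₀ hM h0
    exact ⟨Or.inl hc6, ⟨fun _ => ⟨M₀, hM, h0⟩, fun _ => hc6⟩, fun _ => ⟨M₀, hM, h0, hU, hG⟩,
      ⟨fun h => by omega, fun ⟨M', M'', hM', hM'', hne, hA⟩ => (h3 M' M'' hM' hM'' hne hA).1⟩,
      fun h => by omega⟩
  · obtain ⟨hc3, hU, hG⟩ := h3 M' M'' hM' hM'' hne hA
    exact ⟨Or.inr hc3, ⟨fun h => by omega, fun ⟨M₀, hM, h0⟩ => (h6 M₀ hM h0).1⟩,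
      fun h => by omega, ⟨fun _ => ⟨M', M'', hM', hM'', hne, hA⟩, fun _ => hc3⟩,
      fun _ => ⟨M', M'', hM', hM'', hne, hA, hU, hG⟩⟩
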